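/- Let H be a complex Hénon map which is uniformly hyperbolic on J*. Then the stable set of J* equals the union of the stable sets of its points: W^s_{J*} = ⋃_{p ∈ J*} W^s_p. -/

import Mathlib

open Filter Metric Topology Set

noncomputable section

/-- An elementary Hénon map `(z,w) ↦ (P(z) + a·w, b·z)` with `deg P ≥ 2`, `a ≠ 0`, `b ≠ 0`. -/
structure ElemHenon where
  P : Polynomial ℂ
  a : ℂ
  b : ℂ
  ha : a ≠ 0
  hb : b ≠ 0
  hdeg : 2 ≤ P.natDegree

def ElemHenon.toFun (h : ElemHenon) : ℂ × ℂ → ℂ × ℂ :=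
  fun p => (h.P.eval p.1 + h.a * p.2, h.b * p.1)

def ElemHenon.invFun (h : ElemHenon) : ℂ × ℂ → ℂ × ℂ :=
  fun p => (p.2 / h.b, (p.1 - h.P.eval (p.2 / h.b)) / h.a)

/-- A complex Hénon map: a nonempty composition `H = H₁ ∘ ⋯ ∘ Hₙ` of elementary Hénon maps. -/
structure HenonMap where
  comps : List ElemHenon
  ne : comps ≠ []

/-- The map `H = H₁ ∘ ⋯ ∘ Hₙ`. -/
def HenonMap.toFun (H : HenonMap) : ℂ × ℂ → ℂ × ℂ :=
  H.comps.foldr (fun h f => h.toFun ∘ f) id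

/-- The inverse map `H⁻¹ = Hₙ⁻¹ ∘ ⋯ ∘ H₁⁻¹`. -/
def HenonMap.invFun (H : HenonMap) : ℂ × ℂ → ℂ × ℂ :=
  H.comps.foldl (fun f h => h.invFun ∘ f) id

/-- The degree `d = ∏ deg Pᵢ`. -/
def HenonMap.deg (H : HenonMap) : ℕ :=
  (H.comps.map fun h => h.P.natDegree).prod

/-- The (constant) Jacobian determinant of `H`; each factor contributes `-aᵢbᵢ`. -/
def HenonMap.jacDet (H : HenonMap) : ℂ :=
  (H.comps.map fun h => -(h.a * h.b)).prod

/-- Points with bounded forward orbit. -/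
def Kplus (H : HenonMap) : Set (ℂ × ℂ) :=
  {p | Bornology.IsBounded (Set.range fun n : ℕ => H.toFun^[n] p)}

/-- Points with bounded backward orbit. -/
def Kminus (H : HenonMap) : Set (ℂ × ℂ) :=
  {p | Bornology.IsBounded (Set.range fun n : ℕ => H.invFun^[n] p)}

def Jplus (H : HenonMap) : Set (ℂ × ℂ) := frontier (Kplus H)

def Jminus (H : HenonMap) : Set (ℂ × ℂ) := frontier (Kminus H)

/-- The Julia set `J = J⁺ ∩ J⁻`. -/
def Jset (H : HenonMap) : Set (ℂ × ℂ) := Jplus H ∩ Jminus H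

/-- The forward escape function `G⁺(p) = lim d⁻ⁿ log⁺ ‖Hⁿ(p)‖`. -/
def Gplus (H : HenonMap) (p : ℂ × ℂ) : ℝ :=
  limUnder atTop fun n : ℕ => Real.log (max ‖H.toFun^[n] p‖ 1) / (H.deg : ℝ) ^ n

/-- The backward escape function `G⁻(p) = lim d⁻ⁿ log⁺ ‖H⁻ⁿ(p)‖`. -/
def Gminus (H : HenonMap) (p : ℂ × ℂ) : ℝ :=
  limUnder atTop fun n : ℕ => Real.log (max ‖H.invFun^[n] p‖ 1) / (H.deg : ℝ) ^ n

/-- `p` is a periodic saddle point: `H^k(p) = p` for some `k ≥ 1` and `D(H^k)_p` has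
an eigenvalue of modulus `< 1` and an eigenvalue of modulus `> 1`. -/
def IsSaddlePeriodic (H : HenonMap) (p : ℂ × ℂ) : Prop :=
  ∃ k : ℕ, 1 ≤ k ∧ H.toFun^[k] p = p ∧
    ∃ (v₁ v₂ : ℂ × ℂ) (μ₁ μ₂ : ℂ), v₁ ≠ 0 ∧ v₂ ≠ 0 ∧
      fderiv ℂ (H.toFun^[k]) p v₁ = μ₁ • v₁ ∧
      fderiv ℂ (H.toFun^[k]) p v₂ = μ₂ • v₂ ∧
      ‖μ₁‖ < 1 ∧ 1 < ‖μ₂‖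

/-- `J*`: the closure of the set of periodic saddle points. -/
def Jstar (H : HenonMap) : Set (ℂ × ℂ) :=
  closure {p | IsSaddlePeriodic H p}

/-- The stable set of a point. -/
def Ws (H : HenonMap) (p : ℂ × ℂ) : Set (ℂ × ℂ) :=
  {x | Tendsto (fun n : ℕ => dist (H.toFun^[n] x) (H.toFun^[n] p)) atTop (𝓝 0)}

/-- The unstable set of a point. -/
def Wu (H : HenonMap) (p : ℂ × ℂ) : Set (ℂ × ℂ) :=
  {x | Tendsto (fun n : ℕ => dist (H.invFun^[n] x) (H.invFun^[n] p)) atTop (𝓝 0)}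

/-- The stable set of a set. -/
def WsSet (H : HenonMap) (S : Set (ℂ × ℂ)) : Set (ℂ × ℂ) :=
  {x | Tendsto (fun n : ℕ => infDist (H.toFun^[n] x) S) atTop (𝓝 0)}

/-- The unstable set of a set. -/
def WuSet (H : HenonMap) (S : Set (ℂ × ℂ)) : Set (ℂ × ℂ) :=
  {x | Tendsto (fun n : ℕ => infDist (H.invFun^[n] x) S) atTop (𝓝 0)}

/-- The local stable set of size `ε`. -/
def WsLoc (H : HenonMap) (ε : ℝ) (p : ℂ × ℂ) : Set (ℂ × ℂ) :=
  {x | (∀ n : ℕ, dist (H.toFun^[n] x) (H.toFun^[n] p) ≤ ε) ∧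
       Tendsto (fun n : ℕ => dist (H.toFun^[n] x) (H.toFun^[n] p)) atTop (𝓝 0)}

/-- The local unstable set of size `ε`. -/
def WuLoc (H : HenonMap) (ε : ℝ) (p : ℂ × ℂ) : Set (ℂ × ℂ) :=
  {x | (∀ n : ℕ, dist (H.invFun^[n] x) (H.invFun^[n] p) ≤ ε) ∧
       Tendsto (fun n : ℕ => dist (H.invFun^[n] x) (H.invFun^[n] p)) atTop (𝓝 0)}

/-- A parametrization of the stable manifold of `p`: an injective holomorphic immersion
`Φ : ℂ → ℂ²` with `Φ(0) = p` and image `W^s_p`. -/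
def IsStableParam (H : HenonMap) (p : ℂ × ℂ) (Φ : ℂ → ℂ × ℂ) : Prop :=
  Differentiable ℂ Φ ∧ Function.Injective Φ ∧ (∀ z, deriv Φ z ≠ 0) ∧
    Φ 0 = p ∧ Set.range Φ = Ws H p

/-- A parametrization of the unstable manifold of `p`. -/
def IsUnstableParam (H : HenonMap) (p : ℂ × ℂ) (Ψ : ℂ → ℂ × ℂ) : Prop :=
  Differentiable ℂ Ψ ∧ Function.Injective Ψ ∧ (∀ z, deriv Ψ z ≠ 0) ∧
    Ψ 0 = p ∧ Set.range Ψ = Wu H p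

/-- Uniform hyperbolicity of `H` on a compact completely invariant set `S`:
a continuous invariant splitting `ℂ² = E^s_x ⊕ E^u_x` into complex lines, with uniform
contraction on `E^s` and uniform expansion on `E^u`.  Continuity of the line fields is
expressed by the closedness of their total spaces over `S` (equivalent to continuity
for fields of lines of constant dimension over a compact set). -/
def UniformlyHyperbolicOn (H : HenonMap) (S : Set (ℂ × ℂ)) : Prop :=
  IsCompact S ∧ H.toFun '' S = S ∧
  ∃ (Es Eu : (ℂ × ℂ) → Submodule ℂ (ℂ × ℂ)) (c lam : ℝ),
    0 < c ∧ 0 < lam ∧ lam < 1 ∧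
    (∀ x ∈ S, Module.finrank ℂ (Es x) = 1) ∧
    (∀ x ∈ S, Module.finrank ℂ (Eu x) = 1) ∧
    (∀ x ∈ S, IsCompl (Es x) (Eu x)) ∧
    IsClosed {q : (ℂ × ℂ) × (ℂ × ℂ) | q.1 ∈ S ∧ q.2 ∈ Es q.1} ∧
    IsClosed {q : (ℂ × ℂ) × (ℂ × ℂ) | q.1 ∈ S ∧ q.2 ∈ Eu q.1} ∧
    (∀ x ∈ S, (Es x).map (fderiv ℂ H.toFun x : (ℂ × ℂ) →ₗ[ℂ] (ℂ × ℂ)) = Es (H.toFun x)) ∧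
    (∀ x ∈ S, (Eu x).map (fderiv ℂ H.toFun x : (ℂ × ℂ) →ₗ[ℂ] (ℂ × ℂ)) = Eu (H.toFun x)) ∧
    (∀ x ∈ S, ∀ v ∈ Es x, ∀ n : ℕ, 1 ≤ n →
      ‖fderiv ℂ (H.toFun^[n]) x v‖ ≤ (lam ^ n / c) * ‖v‖) ∧
    (∀ x ∈ S, ∀ v ∈ Eu x, ∀ n : ℕ, 1 ≤ n →
      ‖fderiv ℂ (H.toFun^[n]) x v‖ ≥ (c / lam ^ n) * ‖v‖)

/-- `p ∈ J*` is weakly stably exposed: there are a parametrization `Φ` of `W^s_p` and a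
nonempty simply connected open set `V ⊂ ℂ` with `0 ∈ ∂V`, `∂V ⊂ J*_{p,s}` and
`Φ(V) ⊂ K ∖ J*`. -/
def WeaklyStablyExposed (H : HenonMap) (p : ℂ × ℂ) : Prop :=
  ∃ (Φ : ℂ → ℂ × ℂ) (V : Set ℂ), IsStableParam H p Φ ∧
    V.Nonempty ∧ IsOpen V ∧ SimplyConnectedSpace V ∧
    (0 : ℂ) ∈ frontier V ∧ frontier V ⊆ Φ ⁻¹' Jstar H ∧
    Φ '' V ⊆ (Kplus H ∩ Kminus H) \ Jstar H

/-- `p ∈ J*` is weakly unstably exposed. -/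
def WeaklyUnstablyExposed (H : HenonMap) (p : ℂ × ℂ) : Prop :=
  ∃ (Ψ : ℂ → ℂ × ℂ) (V : Set ℂ), IsUnstableParam H p Ψ ∧
    V.Nonempty ∧ IsOpen V ∧ SimplyConnectedSpace V ∧
    (0 : ℂ) ∈ frontier V ∧ frontier V ⊆ Ψ ⁻¹' Jstar H ∧
    Ψ '' V ⊆ (Kplus H ∩ Kminus H) \ Jstar H

/-- The product `M (n-1) * ⋯ * M 1 * M 0`. -/
def matProd {S R : Type*} [Fintype S] [DecidableEq S] [Semiring R] (M : ℕ → Matrix S S R) :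
    ℕ → Matrix S S R
  | 0 => 1
  | n + 1 => M n * matProd M n

section PathSum

variable {S R : Type*} [Fintype S] [DecidableEq S] [CommRing R]

theorem sum_path_weight (M : ℕ → Matrix S S R) (n : ℕ) (F : S → S → R) :
    ∑ s : Fin (n + 1) → S, F (s (Fin.last n)) (s 0) *
      ∏ k : Fin n, M k (s k.succ) (s k.castSucc) = ∑ i, ∑ j, F i j * matProd M n i j := by
  induction n generalizing F with
  | zero =>
    rw [← (Equiv.funUnique (Fin 1) S).symm.sum_comp]
    simp [matProd, Matrix.one_apply]
  | succ n ih =>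
    rw [← (Fin.snocEquiv (fun _ : Fin (n + 2) => S)).sum_comp, Fintype.sum_prod_type_right]
    have h := ih (fun i j => ∑ x, F x j * M n x i)
    trans ∑ s : Fin (n + 1) → S, (∑ x, F x (s 0) * M n x (s (Fin.last n))) *
      ∏ k : Fin n, M k (s k.succ) (s k.castSucc)
    · refine Finset.sum_congr rfl fun s _ => ?_
      rw [Finset.sum_mul]
      refine Finset.sum_congr rfl fun x _ => ?_
      rw [Fin.prod_univ_castSucc]
      have h0 : (Fin.snocEquiv (fun _ : Fin (n + 2) => S)) (x, s) 0 = s 0 := by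
        have : (0 : Fin (n + 2)) = Fin.castSucc 0 := rfl
        rw [this]; simp [Fin.snocEquiv]
      rw [h0]
      simp only [Fin.snocEquiv, Equiv.coe_fn_mk, Fin.snoc_last, Fin.succ_last, Fin.snoc_castSucc,
        ← Fin.castSucc_succ, Fin.val_castSucc, Fin.val_last]
      ring
    · rw [h]
      simp only [matProd, Matrix.mul_apply, Finset.mul_sum, Finset.sum_mul]
      rw [Finset.sum_comm]
      conv_rhs => rw [Finset.sum_comm]
      refine Finset.sum_congr rfl fun j _ => ?_
      rw [Finset.sum_comm]
      refine Finset.sum_congr rfl fun i _ => Finset.sum_congr rfl fun x _ => by ring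

/-- The trace of a product of matrices as a sum over closed paths. -/
theorem trace_matProd (M : ℕ → Matrix S S R) (n : ℕ) :
    (matProd M (n + 1)).trace =
      ∑ s : Fin (n + 1) → S, ∏ k : Fin (n + 1), M k (s (k + 1)) (s k) := by
  have h := sum_path_weight M n (fun i j => M n j i)
  simp only [Matrix.trace, matProd, Matrix.mul_apply, Matrix.diag_apply]
  rw [Finset.sum_comm, ← h]
  refine Finset.sum_congr rfl fun s _ => ?_
  rw [Fin.prod_univ_castSucc]
  simp [mul_comm]

theorem matProd_add (M : ℕ → Matrix S S R) (a b : ℕ) :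
    matProd M (a + b) = matProd (fun k => M (k + b)) a * matProd M b := by
  induction a with
  | zero => simp [matProd]
  | succ a ih => rw [Nat.add_right_comm, matProd, ih, matProd, mul_assoc]

theorem matProd_mul_of_periodic {M : ℕ → Matrix S S R} {m : ℕ} (hM : Function.Periodic M m)
    (l : ℕ) : matProd M (m * l) = matProd M m ^ l := by
  induction l with
  | zero => simp [matProd]
  | succ l ih =>
    have : (fun k => M (k + m * l)) = M := funext fun k => by
      have := hM.nat_mul l k
      rwa [Nat.cast_id, mul_comm] at this
    rw [mul_add, mul_one, add_comm, matProd_add, this, ih, pow_succ']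

theorem det_matProd (M : ℕ → Matrix S S R) (n : ℕ) :
    (matProd M n).det = ∏ k ∈ Finset.range n, (M k).det := by
  induction n with
  | zero => simp [matProd]
  | succ n ih => rw [matProd, Matrix.det_mul, ih, Finset.prod_range_succ, mul_comm]

theorem matProd_mulVec {M : ℕ → Matrix S S R} {v : ℕ → S → R}
    (h : ∀ k, (M k).mulVec (v k) = v (k + 1)) (n : ℕ) : (matProd M n).mulVec (v 0) = v n := by
  induction n with
  | zero => simp [matProd]
  | succ n ih => rw [matProd, ← Matrix.mulVec_mulVec, ih, h]

theorem map_matProd {R' : Type*} [CommRing R'] (f : R →+* R') (M : ℕ → Matrix S S R) (n : ℕ) :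
    (matProd M n).map f = matProd (fun k => (M k).map f) n := by
  induction n with
  | zero => simp [matProd]
  | succ n ih => simp [matProd, Matrix.map_mul, ih]

end PathSum

section Residue

variable {ι R : Type*} [Fintype ι] [CommRing R]

theorem prod_aeval_X [DecidableEq ι] (g : ι → Polynomial R) :
    ∏ j, Polynomial.aeval (MvPolynomial.X j : MvPolynomial ι R) (g j) =
      ∑ e ∈ Fintype.piFinset fun j => Finset.range ((g j).natDegree + 1),
        MvPolynomial.monomial (Finsupp.equivFunOnFinite.symm e) (∏ j, (g j).coeff (e j)) := by
  simp_rw [Polynomial.aeval_eq_sum_range, Finset.prod_univ_sum]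
  refine Finset.sum_congr rfl fun e _ => ?_
  rw [MvPolynomial.monomial_eq, Finsupp.prod_fintype _ _ (by simp), map_prod,
    ← Finset.prod_mul_distrib]
  simp [MvPolynomial.smul_eq_C_mul]

theorem monomial_eq_prod_aeval (e : ι →₀ ℕ) :
    (MvPolynomial.monomial e 1 : MvPolynomial ι R) =
      ∏ j, Polynomial.aeval (MvPolynomial.X j) (Polynomial.X ^ e j : Polynomial R) := by
  rw [MvPolynomial.monomial_eq, Finsupp.prod_fintype _ _ (by simp)]
  simp

/-- The functional on `R[zⱼ : j ∈ ι]` which is the tensor product of functionals on the `R[zⱼ]`. -/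
def tensorFunctional (φ : ι → Polynomial R →ₗ[R] R) : MvPolynomial ι R →ₗ[R] R :=
  (MvPolynomial.basisMonomials ι R).constr R fun e => ∏ j, φ j (Polynomial.X ^ e j)

theorem tensorFunctional_monomial (φ : ι → Polynomial R →ₗ[R] R) (e : ι →₀ ℕ) (r : R) :
    tensorFunctional φ (MvPolynomial.monomial e r) = r * ∏ j, φ j (Polynomial.X ^ e j) := by
  have h := (MvPolynomial.basisMonomials ι R).constr_basis R
    (fun e => ∏ j, φ j (Polynomial.X ^ e j)) e
  rw [MvPolynomial.coe_basisMonomials] at h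
  rw [← mul_one r, ← smul_eq_mul, ← MvPolynomial.smul_monomial, map_smul, smul_eq_mul,
    tensorFunctional, h, smul_eq_mul, mul_one]

theorem tensorFunctional_prod [DecidableEq ι] (φ : ι → Polynomial R →ₗ[R] R) (g : ι → Polynomial R) :
    tensorFunctional φ (∏ j, Polynomial.aeval (MvPolynomial.X j) (g j)) = ∏ j, φ j (g j) := by
  have h : ∀ j, φ j (g j) =
      ∑ i ∈ Finset.range ((g j).natDegree + 1), (g j).coeff i * φ j (Polynomial.X ^ i) := by
    intro j
    conv_lhs => rw [(g j).as_sum_range_C_mul_X_pow]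
    simp [← Polynomial.smul_eq_C_mul]
  simp_rw [h, Finset.prod_univ_sum, prod_aeval_X, map_sum, tensorFunctional_monomial,
    Finset.prod_mul_distrib]
  rfl

theorem linearMap_ext_monomial {σ M : Type*} [AddCommMonoid M] [Module R M]
    {f g : MvPolynomial σ R →ₗ[R] M}
    (h : ∀ e, f (MvPolynomial.monomial e 1) = g (MvPolynomial.monomial e 1)) : f = g :=
  (MvPolynomial.basisMonomials σ R).ext fun e => by simpa using h e

/-- The residue at infinity of `g / p ^ (j + 1)`. -/
def residueCoeff (p : Polynomial R) (j : ℕ) : Polynomial R →ₗ[R] R :=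
  Polynomial.lcoeff R (p.natDegree * (j + 1) - 1) ∘ₗ Polynomial.modByMonicHom (p ^ (j + 1))

theorem residueCoeff_zero_mul {p : Polynomial R} (hp : p.Monic) (g : Polynomial R) :
    residueCoeff p 0 (p * g) = 0 := by
  simp [residueCoeff, mul_comm p g, Polynomial.mul_self_modByMonic hp]

theorem residueCoeff_succ_mul [Nontrivial R] {p : Polynomial R} (hp : p.Monic)
    (hd : 1 ≤ p.natDegree) (j : ℕ) (g : Polynomial R) :
    residueCoeff p (j + 1) (p * g) = residueCoeff p j g := by
  have hdeg : (g %ₘ p ^ (j + 1)).natDegree < p.natDegree * (j + 1) := by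
    have := Polynomial.natDegree_modByMonic_lt g (hp.pow (j + 1)) (fun h => by
      have := congrArg Polynomial.natDegree h
      rw [hp.natDegree_pow, Polynomial.natDegree_one] at this
      have : 0 < (j + 1) * p.natDegree := by positivity
      omega)
    rwa [hp.natDegree_pow, mul_comm] at this
  have hdeg2 : (p * (g %ₘ p ^ (j + 1))).degree < (p ^ (j + 2)).degree := by
    rw [mul_comm p, pow_succ p (j + 1), hp.degree_mul, hp.degree_mul]
    exact WithBot.add_lt_add_right (by rw [Polynomial.degree_eq_natDegree hp.ne_zero]; simp)
      (Polynomial.degree_modByMonic_lt g (hp.pow (j + 1)))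
  have h := (Polynomial.div_modByMonic_unique (f := p * g) (g /ₘ p ^ (j + 1))
    (p * (g %ₘ p ^ (j + 1))) (hp.pow (j + 2)) ⟨by
      conv_rhs => rw [← Polynomial.modByMonic_add_div g (p ^ (j + 1))]
      ring, hdeg2⟩).2
  have he : p.natDegree * (j + 1 + 1) - 1 = p.natDegree + (p.natDegree * (j + 1) - 1) := by
    have : 0 < p.natDegree * (j + 1) := by positivity
    rw [mul_add _ (j + 1)]; omega
  simp only [residueCoeff, LinearMap.comp_apply, Polynomial.modByMonicHom_apply,
    Polynomial.lcoeff_apply, h, he]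
  rw [Polynomial.coeff_mul_add_eq_of_natDegree_le le_rfl (by omega), hp.coeff_natDegree, one_mul]

theorem residueCoeff_X_pow [Nontrivial R] {p : Polynomial R} (hp : p.Monic)
    (hd : 1 ≤ p.natDegree) {j e : ℕ}
    (he : e ≤ p.natDegree * (j + 1) - 1) :
    residueCoeff p j (Polynomial.X ^ e) = if e = p.natDegree * (j + 1) - 1 then 1 else 0 := by
  have : 0 < p.natDegree * (j + 1) := by positivity
  have h : (Polynomial.X ^ e : Polynomial R) %ₘ p ^ (j + 1) = Polynomial.X ^ e := by
    rw [Polynomial.modByMonic_eq_self_iff (hp.pow _), Polynomial.degree_X_pow,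
      Polynomial.degree_eq_natDegree (hp.pow _).ne_zero, hp.natDegree_pow, mul_comm (j + 1)]
    exact_mod_cast (by omega)
  simp [residueCoeff, h, Polynomial.coeff_X_pow, eq_comm]

end Residue

section GlobalResidue

variable {ι R : Type*} [Fintype ι] [DecidableEq ι] [CommRing R] [IsDomain R]

theorem sum_le_totalDegree_of_tensorFunctional_ne_zero {p : ι → Polynomial R}
    (hp : ∀ j, (p j).Monic) (hd : ∀ j, 2 ≤ (p j).natDegree) (K : ι → ℕ) {f : MvPolynomial ι R}
    (hf : tensorFunctional (fun j => residueCoeff (p j) (K j)) f ≠ 0) :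
    ∑ j, ((p j).natDegree * (K j + 1) - 1) ≤ f.totalDegree := by
  rw [f.as_sum, map_sum] at hf
  obtain ⟨e, he, hne⟩ := Finset.exists_ne_zero_of_sum_ne_zero hf
  rw [tensorFunctional_monomial] at hne
  refine le_trans ?_ (MvPolynomial.le_totalDegree he)
  rw [Finsupp.sum_fintype _ _ (by simp)]
  refine Finset.sum_le_sum fun j _ => ?_
  by_contra! hlt
  refine hne ?_
  rw [Finset.prod_eq_zero (Finset.mem_univ j), mul_zero]
  rw [residueCoeff_X_pow (hp j) (by have := hd j; omega) hlt.le, if_neg hlt.ne]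

/-- The global residue functional attached to the complete intersection `pⱼ(zⱼ) = wⱼ`, where
the `wⱼ` are thought of as perturbations of lower degree. -/
def globalResidueFun (p : ι → Polynomial R) (w : ι → MvPolynomial ι R) (f : MvPolynomial ι R) :
    R :=
  ∑ᶠ K : ι → ℕ, tensorFunctional (fun j => residueCoeff (p j) (K j)) (f * ∏ j, w j ^ K j)

theorem globalResidue_bound {p : ι → Polynomial R} {w : ι → MvPolynomial ι R}
    (hp : ∀ j, (p j).Monic) (hd : ∀ j, 2 ≤ (p j).natDegree) (hw : ∀ j, (w j).totalDegree ≤ 1)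
    {f : MvPolynomial ι R} {K : ι → ℕ}
    (h : tensorFunctional (fun j => residueCoeff (p j) (K j)) (f * ∏ j, w j ^ K j) ≠ 0) :
    ∑ j, ((p j).natDegree - 1) + ∑ j, K j ≤ f.totalDegree := by
  have h1 := sum_le_totalDegree_of_tensorFunctional_ne_zero hp hd K h
  have h2 : (f * ∏ j, w j ^ K j).totalDegree ≤ f.totalDegree + ∑ j, K j := by
    refine (MvPolynomial.totalDegree_mul _ _).trans (Nat.add_le_add_left ?_ _)
    refine (MvPolynomial.totalDegree_finsetProd _ _).trans (Finset.sum_le_sum fun j _ => ?_)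
    exact (MvPolynomial.totalDegree_pow _ _).trans (by nlinarith [hw j])
  have h3 : ∑ j, ((p j).natDegree - 1) + ∑ j, K j + ∑ j, K j ≤
      ∑ j, ((p j).natDegree * (K j + 1) - 1) := by
    rw [← Finset.sum_add_distrib, ← Finset.sum_add_distrib]
    refine Finset.sum_le_sum fun j _ => ?_
    have := hd j
    have h4 : 2 * K j ≤ (p j).natDegree * K j := Nat.mul_le_mul_right _ this
    rw [mul_add, mul_one]
    omega
  omega

theorem globalResidue_finite {p : ι → Polynomial R} {w : ι → MvPolynomial ι R}
    (hp : ∀ j, (p j).Monic) (hd : ∀ j, 2 ≤ (p j).natDegree) (hw : ∀ j, (w j).totalDegree ≤ 1)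
    (f : MvPolynomial ι R) :
    (Function.support fun K : ι → ℕ =>
      tensorFunctional (fun j => residueCoeff (p j) (K j)) (f * ∏ j, w j ^ K j)).Finite := by
  refine (Set.finite_Iic (fun _ : ι => f.totalDegree)).subset fun K hK j => ?_
  have := globalResidue_bound hp hd hw hK
  have h2 : K j ≤ ∑ j, K j := Finset.single_le_sum (fun _ _ => Nat.zero_le _) (Finset.mem_univ j)
  change K j ≤ f.totalDegree
  omega

/-- `globalResidueFun` as a linear map. -/
def globalResidue {p : ι → Polynomial R} {w : ι → MvPolynomial ι R}
    (hp : ∀ j, (p j).Monic) (hd : ∀ j, 2 ≤ (p j).natDegree) (hw : ∀ j, (w j).totalDegree ≤ 1) :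
    MvPolynomial ι R →ₗ[R] R where
  toFun := globalResidueFun p w
  map_add' f g := by
    simp only [globalResidueFun, add_mul, map_add]
    exact finsum_add_distrib (globalResidue_finite hp hd hw f) (globalResidue_finite hp hd hw g)
  map_smul' r f := by
    simp only [globalResidueFun, smul_mul_assoc, map_smul, smul_eq_mul, RingHom.id_apply]
    exact (mul_finsum _ _).symm

variable {p : ι → Polynomial R} {w : ι → MvPolynomial ι R}
  (hp : ∀ j, (p j).Monic) (hd : ∀ j, 2 ≤ (p j).natDegree) (hw : ∀ j, (w j).totalDegree ≤ 1)

theorem globalResidue_monomial {e : ι →₀ ℕ} (he : ∑ j, e j ≤ ∑ j, ((p j).natDegree - 1)) :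
    globalResidue hp hd hw (MvPolynomial.monomial e 1) =
      ∏ j, if e j = (p j).natDegree - 1 then 1 else 0 := by
  rw [Fintype.prod_ite_zero, Finset.prod_const_one]
  have htd : (MvPolynomial.monomial e (1 : R)).totalDegree = ∑ j, e j := by
    rw [MvPolynomial.totalDegree_monomial _ one_ne_zero, Finsupp.sum_fintype _ _ (by simp)]
  change globalResidueFun p w _ = _
  rw [globalResidueFun, finsum_eq_single _ 0]
  · simp only [Pi.zero_apply, pow_zero, Finset.prod_const_one, mul_one]
    split_ifs with h
    · rw [tensorFunctional_monomial, one_mul]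
      refine Finset.prod_eq_one fun j _ => ?_
      rw [residueCoeff_X_pow (hp j) (by have := hd j; omega) (by rw [h j]; omega), if_pos]
      simpa using h j
    · by_contra hne
      refine h ?_
      rw [tensorFunctional_monomial, one_mul] at hne
      have hge : ∀ j, (p j).natDegree - 1 ≤ e j := by
        intro j
        by_contra! hlt
        refine hne (Finset.prod_eq_zero (Finset.mem_univ j) ?_)
        rw [residueCoeff_X_pow (hp j) (by have := hd j; omega) (by omega), if_neg (by omega)]
      have := (Finset.sum_eq_sum_iff_of_le fun j _ => hge j).1
        (le_antisymm (Finset.sum_le_sum fun j _ => hge j) he)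
      exact fun j => (this j (Finset.mem_univ j)).symm
  · intro K hK
    by_contra hne
    have := globalResidue_bound hp hd hw hne
    rw [htd] at this
    refine hK (funext fun j => ?_)
    have h2 : K j ≤ ∑ j, K j :=
      Finset.single_le_sum (fun _ _ => Nat.zero_le _) (Finset.mem_univ j)
    change K j = 0
    omega

theorem tensorFunctional_residueCoeff_mul {p : ι → Polynomial R} (hp : ∀ j, (p j).Monic)
    (hd : ∀ j, 2 ≤ (p j).natDegree) (K : ι → ℕ) (k : ι) (f : MvPolynomial ι R) :
    tensorFunctional (fun j => residueCoeff (p j) (K j + (Pi.single k 1 : ι → ℕ) j))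
      (Polynomial.aeval (MvPolynomial.X k) (p k) * f) =
    tensorFunctional (fun j => residueCoeff (p j) (K j)) f := by
  suffices h : tensorFunctional (fun j => residueCoeff (p j) (K j + (Pi.single k 1 : ι → ℕ) j)) ∘ₗ
      LinearMap.mulLeft R (Polynomial.aeval (MvPolynomial.X k) (p k)) =
      tensorFunctional (fun j => residueCoeff (p j) (K j)) from LinearMap.congr_fun h f
  refine linearMap_ext_monomial fun e => ?_
  have h : Polynomial.aeval (MvPolynomial.X k : MvPolynomial ι R) (p k) *
      MvPolynomial.monomial e 1 = ∏ j, Polynomial.aeval (MvPolynomial.X j)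
        ((if j = k then p j else 1) * (Polynomial.X ^ e j : Polynomial R)) := by
    simp only [map_mul, Finset.prod_mul_distrib, monomial_eq_prod_aeval]
    congr 1
    rw [Finset.prod_eq_single k (by intro b _ hb; simp [hb]) (by simp)]
    simp
  rw [LinearMap.comp_apply, LinearMap.mulLeft_apply, h, monomial_eq_prod_aeval,
    tensorFunctional_prod, tensorFunctional_prod]
  refine Finset.prod_congr rfl fun j _ => ?_
  by_cases hj : j = k
  · subst hj
    simpa using residueCoeff_succ_mul (hp j) (by have := hd j; omega) (K j) (Polynomial.X ^ e j)
  · simp [hj]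

theorem tensorFunctional_residueCoeff_mul_of_eq_zero {p : ι → Polynomial R}
    (hp : ∀ j, (p j).Monic) {K : ι → ℕ} {k : ι} (hK : K k = 0)
    (f : MvPolynomial ι R) :
    tensorFunctional (fun j => residueCoeff (p j) (K j))
      (Polynomial.aeval (MvPolynomial.X k) (p k) * f) = 0 := by
  suffices h : tensorFunctional (fun j => residueCoeff (p j) (K j)) ∘ₗ
      LinearMap.mulLeft R (Polynomial.aeval (MvPolynomial.X k) (p k)) = 0 from
    LinearMap.congr_fun h f
  refine linearMap_ext_monomial fun e => ?_
  have h : Polynomial.aeval (MvPolynomial.X k : MvPolynomial ι R) (p k) *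
      MvPolynomial.monomial e 1 = ∏ j, Polynomial.aeval (MvPolynomial.X j)
        ((if j = k then p j else 1) * (Polynomial.X ^ e j : Polynomial R)) := by
    simp only [map_mul, Finset.prod_mul_distrib, monomial_eq_prod_aeval]
    congr 1
    rw [Finset.prod_eq_single k (by intro b _ hb; simp [hb]) (by simp)]
    simp
  rw [LinearMap.comp_apply, LinearMap.mulLeft_apply, h, tensorFunctional_prod]
  refine Finset.prod_eq_zero (Finset.mem_univ k) ?_
  rw [hK]
  simpa using residueCoeff_zero_mul (hp k) _

theorem globalResidue_mul_eq (k : ι) (f : MvPolynomial ι R) :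
    globalResidue hp hd hw (Polynomial.aeval (MvPolynomial.X k) (p k) * f) =
      globalResidue hp hd hw (w k * f) := by
  change globalResidueFun p w _ = globalResidueFun p w _
  have hinj : Function.Injective fun K : ι → ℕ => K + Pi.single k 1 :=
    add_left_injective _
  rw [globalResidueFun, ← finsum_mem_univ]
  rw [finsum_mem_inter_support_eq' _ Set.univ (Set.range fun K : ι → ℕ => K + Pi.single k 1),
    finsum_mem_range hinj, globalResidueFun]
  · refine finsum_congr fun K => ?_
    have h1 : ∏ j, w j ^ (K + Pi.single k 1 : ι → ℕ) j = w k * ∏ j, w j ^ K j := by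
      simp only [Pi.add_apply, pow_add, Finset.prod_mul_distrib]
      rw [mul_comm]
      congr 1
      rw [Finset.prod_eq_single k (by intro b _ hb; simp [hb]) (by simp)]
      simp
    rw [h1, mul_assoc, mul_comm (w k) f, mul_assoc f]
    exact tensorFunctional_residueCoeff_mul hp hd K k _
  · intro K hK
    simp only [Set.mem_univ, true_iff]
    by_cases h0 : K k = 0
    · exact (hK (by simpa only [mul_assoc] using
        tensorFunctional_residueCoeff_mul_of_eq_zero hp h0 _)).elim
    · refine ⟨K - Pi.single k 1, funext fun j => ?_⟩
      by_cases hj : j = k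
      · subst hj; simp; omega
      · simp [hj]

end GlobalResidue

section TraceFormula

theorem linearMap_prod_aeval_X {ι A : Type*} [Fintype ι] [DecidableEq ι] [CommRing A]
    {L : MvPolynomial ι A →ₗ[A] A} {t : ι → ℕ}
    (hL : ∀ e : ι →₀ ℕ, ∑ j, e j ≤ ∑ j, t j →
      L (MvPolynomial.monomial e 1) = ∏ j, if e j = t j then 1 else 0)
    {g : ι → Polynomial A} (hg : ∑ j, (g j).natDegree ≤ ∑ j, t j) :
    L (∏ j, Polynomial.aeval (MvPolynomial.X j) (g j)) = ∏ j, (g j).coeff (t j) := by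
  rw [prod_aeval_X, map_sum]
  have h : ∀ e ∈ Fintype.piFinset fun j => Finset.range ((g j).natDegree + 1),
      L (MvPolynomial.monomial (Finsupp.equivFunOnFinite.symm e) (∏ j, (g j).coeff (e j))) =
      if e = t then ∏ j, (g j).coeff (e j) else 0 := by
    intro e he
    rw [Fintype.mem_piFinset] at he
    rw [← mul_one (∏ j, (g j).coeff (e j)), ← smul_eq_mul, ← MvPolynomial.smul_monomial, map_smul,
      hL]
    · simp [Fintype.prod_ite_zero, funext_iff]
    · refine le_trans (Finset.sum_le_sum fun j _ => ?_) hg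
      have := Finset.mem_range.1 (he j)
      simp; omega
  rw [Finset.sum_congr rfl h, Finset.sum_ite_eq']
  split_ifs with ht
  · rfl
  · simp only [Fintype.mem_piFinset, Finset.mem_range, not_forall, not_lt] at ht
    obtain ⟨j, hj⟩ := ht
    exact (Finset.prod_eq_zero (Finset.mem_univ j)
      (Polynomial.coeff_eq_zero_of_natDegree_lt (by omega))).symm

variable {ι K A : Type*} [Field K] [CommRing A] [Algebra K A]

/-- The extension of scalars of a linear functional on a polynomial ring. -/
def extendScalars (A : Type*) [CommRing A] [Algebra K A] (L : MvPolynomial ι K →ₗ[K] K) :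
    MvPolynomial ι A →ₗ[A] A :=
  (MvPolynomial.basisMonomials ι A).constr A fun e =>
    algebraMap K A (L (MvPolynomial.monomial e 1))

theorem extendScalars_monomial (L : MvPolynomial ι K →ₗ[K] K) (e : ι →₀ ℕ) :
    extendScalars A L (MvPolynomial.monomial e 1) =
      algebraMap K A (L (MvPolynomial.monomial e 1)) := by
  have h := (MvPolynomial.basisMonomials ι A).constr_basis A
    (fun e => algebraMap K A (L (MvPolynomial.monomial e 1))) e
  rwa [MvPolynomial.coe_basisMonomials] at h

theorem extendScalars_monomial' (L : MvPolynomial ι K →ₗ[K] K) (e : ι →₀ ℕ) (a : A) :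
    extendScalars A L (MvPolynomial.monomial e a) =
      a * algebraMap K A (L (MvPolynomial.monomial e 1)) := by
  rw [← extendScalars_monomial, ← smul_eq_mul, ← map_smul, MvPolynomial.smul_monomial, smul_eq_mul,
    mul_one]

theorem extendScalars_map (L : MvPolynomial ι K →ₗ[K] K) (f : MvPolynomial ι K) :
    extendScalars A L (MvPolynomial.map (algebraMap K A) f) = algebraMap K A (L f) := by
  induction f using MvPolynomial.induction_on' with
  | monomial e a =>
    rw [MvPolynomial.map_monomial, extendScalars_monomial', ← map_mul, ← smul_eq_mul, ← map_smul,
      MvPolynomial.smul_monomial, smul_eq_mul, mul_one]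
  | add f g hf hg => simp [hf, hg]

theorem extendScalars_mul_eq_zero {L : MvPolynomial ι K →ₗ[K] K} {q : MvPolynomial ι K}
    (hq : ∀ f, L (q * f) = 0) (f : MvPolynomial ι A) :
    extendScalars A L (MvPolynomial.map (algebraMap K A) q * f) = 0 := by
  induction f using MvPolynomial.induction_on' with
  | monomial e a =>
    have : MvPolynomial.monomial e a = a • MvPolynomial.map (algebraMap K A)
        (MvPolynomial.monomial e 1) := by
      simp [MvPolynomial.smul_monomial]
    rw [this, mul_smul_comm, map_smul, ← map_mul, extendScalars_map, hq, map_zero, smul_zero]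
  | add f g hf hg => simp [hf, hg, mul_add]

variable {L : MvPolynomial ι K →ₗ[K] K} {gen : ι → MvPolynomial ι K}

theorem map_eq_zero_of_mem_span {κ B M : Type*} [CommRing B] [AddCommGroup M] (Φ : B →+ M)
    {q : κ → B} (h : ∀ k f, Φ (q k * f) = 0) {f : B} (hf : f ∈ Ideal.span (Set.range q)) :
    Φ f = 0 := by
  suffices H : ∀ g, Φ (f * g) = 0 by simpa using H 1
  induction hf using Submodule.span_induction with
  | mem x hx => obtain ⟨k, rfl⟩ := hx; exact h k
  | zero => simp
  | add x y _ _ hx hy => simp [add_mul, hx, hy]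
  | smul a x _ hx => intro g; rw [smul_eq_mul, mul_comm a, mul_assoc]; exact hx _

theorem bezout_mul_sub_mem {π : MvPolynomial ι K →ₐ[K] A} {Bez : MvPolynomial ι A}
    {J : Ideal (MvPolynomial ι A)}
    (hB : ∀ k, Bez * (MvPolynomial.C (π (MvPolynomial.X k)) - MvPolynomial.X k) ∈ J)
    (g : MvPolynomial ι K) :
    Bez * (MvPolynomial.C (π g) - MvPolynomial.map (algebraMap K A) g) ∈ J := by
  induction g using MvPolynomial.induction_on with
  | C a =>
    have : (MvPolynomial.C (π (MvPolynomial.C a)) : MvPolynomial ι A) =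
        MvPolynomial.map (algebraMap K A) (MvPolynomial.C a) := by
      rw [MvPolynomial.map_C]
      exact congrArg _ (π.commutes a)
    rw [this, sub_self, mul_zero]
    exact J.zero_mem
  | add f g hf hg =>
    have := J.add_mem hf hg
    rw [map_add, map_add, map_add]
    convert this using 1
    ring
  | mul_X g k hg =>
    have h1 := J.mul_mem_right (MvPolynomial.C (π (MvPolynomial.X k))) hg
    have h2 := J.mul_mem_left (MvPolynomial.map (algebraMap K A) g) (hB k)
    have := J.add_mem h1 h2
    rw [map_mul, map_mul, map_mul, MvPolynomial.map_X]
    convert this using 1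
    ring

variable {L : MvPolynomial ι K →ₗ[K] K} {gen : ι → MvPolynomial ι K}
  {π : MvPolynomial ι K →ₐ[K] A} {Bez : MvPolynomial ι A} {c : K}

theorem smul_eq_sum_of_bezout (hL : ∀ k f, L (gen k * f) = 0)
    (hB : ∀ k, Bez * (MvPolynomial.C (π (MvPolynomial.X k)) - MvPolynomial.X k) ∈
        Ideal.span (Set.range fun k => MvPolynomial.map (algebraMap K A) (gen k)))
    (hc : extendScalars A L Bez = algebraMap K A c) (g : MvPolynomial ι K) :
    c • π g = ∑ e ∈ Bez.support, L (MvPolynomial.monomial e 1 * g) • Bez.coeff e := by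
  have h := map_eq_zero_of_mem_span (extendScalars A L).toAddMonoidHom
    (fun k f => extendScalars_mul_eq_zero (hL k) f) (bezout_mul_sub_mem hB g)
  have h2 : extendScalars A L (Bez * (MvPolynomial.C (π g) -
    MvPolynomial.map (algebraMap K A) g)) = 0 := h
  rw [mul_sub, map_sub, sub_eq_zero, mul_comm Bez, ← MvPolynomial.smul_eq_C_mul, map_smul, hc,
    smul_eq_mul, mul_comm, ← Algebra.smul_def] at h2
  rw [h2]
  conv_lhs => rw [Bez.as_sum, Finset.sum_mul, map_sum]
  refine Finset.sum_congr rfl fun e _ => ?_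
  have : MvPolynomial.monomial e (Bez.coeff e) = Bez.coeff e • MvPolynomial.map (algebraMap K A)
        (MvPolynomial.monomial e 1) := by
      simp [MvPolynomial.smul_monomial]
  rw [this, smul_mul_assoc, map_smul, ← map_mul, extendScalars_map, smul_eq_mul, mul_comm,
    ← Algebra.smul_def]

theorem finite_of_bezout (hπ : Function.Surjective π) (hL : ∀ k f, L (gen k * f) = 0)
    (hB : ∀ k, Bez * (MvPolynomial.C (π (MvPolynomial.X k)) - MvPolynomial.X k) ∈
        Ideal.span (Set.range fun k => MvPolynomial.map (algebraMap K A) (gen k)))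
    (hc : extendScalars A L Bez = algebraMap K A c) (hc0 : c ≠ 0) : Module.Finite K A := by
  classical
  refine ⟨⟨Bez.support.image Bez.coeff, ?_⟩⟩
  rw [eq_top_iff]
  rintro x -
  obtain ⟨g, rfl⟩ := hπ x
  rw [← inv_smul_smul₀ hc0 (π g), smul_eq_sum_of_bezout hL hB hc g]
  refine Submodule.smul_mem _ _ (Submodule.sum_mem _ fun e he => Submodule.smul_mem _ _
    (Submodule.subset_span ?_))
  simp only [Finset.coe_image]
  exact ⟨e, he, rfl⟩

theorem trace_mulLeft_of_bezout (hπ : Function.Surjective π) (hker : ∀ f, π f = 0 → L f = 0)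
    (hL : ∀ k f, L (gen k * f) = 0)
    (hB : ∀ k, Bez * (MvPolynomial.C (π (MvPolynomial.X k)) - MvPolynomial.X k) ∈
        Ideal.span (Set.range fun k => MvPolynomial.map (algebraMap K A) (gen k)))
    (hc : extendScalars A L Bez = algebraMap K A c) (hc0 : c ≠ 0) (g j : MvPolynomial ι K)
    (hj : π j = MvPolynomial.eval (fun k => π (MvPolynomial.X k)) Bez) :
    c * LinearMap.trace K A (LinearMap.mulLeft K (π g)) = L (g * j) := by
  have := finite_of_bezout hπ hL hB hc hc0
  let Lq : A →ₗ[K] K := (LinearMap.ker π.toLinearMap).liftQ L (fun f hf => hker f hf) ∘ₗ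
    (π.toLinearMap.quotKerEquivOfSurjective hπ).symm.toLinearMap
  have hLq : ∀ f, Lq (π f) = L f := fun f => by
    have : (π.toLinearMap.quotKerEquivOfSurjective hπ).symm (π f) = Submodule.Quotient.mk f := by
      rw [LinearEquiv.symm_apply_eq]; rfl
    simp only [Lq, LinearMap.comp_apply, LinearEquiv.coe_coe, this]
    rfl
  have hmul : c • LinearMap.mulLeft K (π g) = ∑ e ∈ Bez.support,
      (Lq ∘ₗ LinearMap.mulLeft K (π (MvPolynomial.monomial e 1 * g))).smulRight
        (Bez.coeff e) := by
    refine LinearMap.ext fun x => ?_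
    obtain ⟨f, rfl⟩ := hπ x
    have := smul_eq_sum_of_bezout hL hB hc (g * f)
    rw [map_mul] at this
    simp only [LinearMap.smul_apply, LinearMap.mulLeft_apply, LinearMap.sum_apply,
      LinearMap.smulRight_apply, LinearMap.comp_apply]
    rw [this]
    refine Finset.sum_congr rfl fun e _ => ?_
    rw [← map_mul, hLq, mul_assoc]
  rw [← smul_eq_mul, ← map_smul, hmul, map_sum, ← hLq, map_mul, hj, MvPolynomial.eval_eq,
    Finset.mul_sum, map_sum]
  refine Finset.sum_congr rfl fun e _ => ?_
  rw [LinearMap.trace_smulRight, LinearMap.comp_apply, LinearMap.mulLeft_apply]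
  congr 1
  rw [map_mul, MvPolynomial.monomial_eq, map_one, one_mul, Finsupp.prod, map_prod]
  simp only [map_pow]
  ring

end TraceFormula

section CyclicSystem

theorem det_one_sub_matProd_smul {B : Type*} [CommRing B] {S : Type*} [Fintype S] [DecidableEq S]
    {M : ℕ → Matrix S S B} {v : ℕ → S → B} (h : ∀ k, (M k).mulVec (v k) = v (k + 1)) {n : ℕ}
    (hn : v n = v 0) (k : ℕ) : (1 - matProd M n).det • v k = 0 := by
  have h0 : (1 - matProd M n).det • v 0 = 0 := by
    have h1 : (1 - matProd M n).mulVec (v 0) = 0 := by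
      rw [Matrix.sub_mulVec, Matrix.one_mulVec, matProd_mulVec h, hn, sub_self]
    have h2 := congrArg (Matrix.mulVec (Matrix.adjugate (1 - matProd M n))) h1
    rwa [Matrix.mulVec_mulVec, Matrix.adjugate_mul, Matrix.mulVec_zero, Matrix.smul_mulVec,
      Matrix.one_mulVec] at h2
  rw [← matProd_mulVec h k, ← Matrix.mulVec_smul, h0, Matrix.mulVec_zero]

theorem det_one_sub_fin_two {B : Type*} [CommRing B] (M : Matrix (Fin 2) (Fin 2) B) :
    (1 - M).det = 1 - M.trace + M.det := by
  simp [Matrix.det_fin_two, Matrix.trace_fin_two]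
  ring

theorem eval_eq_divByMonic {A : Type*} [CommRing A] (f : Polynomial A) (x : A) :
    f = (Polynomial.X - Polynomial.C x) * (f /ₘ (Polynomial.X - Polynomial.C x)) +
      Polynomial.C (f.eval x) := by
  conv_lhs => rw [← Polynomial.modByMonic_add_div f (Polynomial.X - Polynomial.C x),
    Polynomial.modByMonic_X_sub_C_eq_C_eval]
  ring

theorem eval_divByMonic_eq_derivative {A : Type*} [CommRing A] (f : Polynomial A) (x : A) :
    (f /ₘ (Polynomial.X - Polynomial.C x)).eval x = f.derivative.eval x := by
  conv_rhs => rw [eval_eq_divByMonic f x]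
  simp [Polynomial.derivative_mul]

variable {n : ℕ}

/-- A matrix of univariate polynomials, evaluated at the variable `k`. -/
def siteMatrix {A S : Type*} [CommRing A] (E : Fin (n + 1) → Matrix S S (Polynomial A)) (k : ℕ) :
    Matrix S S (MvPolynomial (Fin (n + 1)) A) :=
  (E (Fin.ofNat (n + 1) k)).map
    (Polynomial.aeval (MvPolynomial.X (Fin.ofNat (n + 1) k) : MvPolynomial (Fin (n + 1)) A))

theorem trace_siteMatrix {A S : Type*} [CommRing A] [Fintype S] [DecidableEq S]
    (E : Fin (n + 1) → Matrix S S (Polynomial A)) :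
    (matProd (siteMatrix E) (n + 1)).trace = ∑ s : Fin (n + 1) → S,
      ∏ k, Polynomial.aeval (MvPolynomial.X k) (E k (s (k + 1)) (s k)) := by
  rw [trace_matProd]
  simp [siteMatrix]

theorem linearMap_trace_siteMatrix {A : Type*} [CommRing A]
    {L : MvPolynomial (Fin (n + 1)) A →ₗ[A] A} {t : Fin (n + 1) → ℕ} (ht : ∀ k, 1 ≤ t k)
    (hL : ∀ e : Fin (n + 1) →₀ ℕ, ∑ j, e j ≤ ∑ j, t j →
      L (MvPolynomial.monomial e 1) = ∏ j, if e j = t j then 1 else 0)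
    {E : Fin (n + 1) → Matrix (Fin 2) (Fin 2) (Polynomial A)}
    (h0 : ∀ k, (E k 0 0).natDegree ≤ t k)
    (h1 : ∀ k i j, (i, j) ≠ (0, 0) → (E k i j).natDegree = 0) :
    L (matProd (siteMatrix E) (n + 1)).trace = ∏ k, (E k 0 0).coeff (t k) := by
  rw [trace_siteMatrix, map_sum]
  have hdeg : ∀ k i j, (E k i j).natDegree ≤ t k := by
    intro k i j
    by_cases hij : (i, j) = (0, 0)
    · obtain ⟨rfl, rfl⟩ := Prod.mk.inj hij
      exact h0 k
    · rw [h1 k i j hij]; exact Nat.zero_le _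
  rw [Finset.sum_congr rfl fun s _ => linearMap_prod_aeval_X hL
    (g := fun k => E k (s (k + 1)) (s k)) (Finset.sum_le_sum fun k _ => hdeg k _ _)]
  rw [Finset.sum_eq_single (fun _ => 0)]
  · intro s _ hs
    obtain ⟨k, hk⟩ := Function.ne_iff.1 hs
    refine Finset.prod_eq_zero (Finset.mem_univ k) (Polynomial.coeff_eq_zero_of_natDegree_lt ?_)
    rw [h1 _ _ _ (fun h => hk (Prod.mk.inj h).2)]
    exact ht k
  · simp

end CyclicSystem

/-- A cyclic system of equations `z (k+1) = P k (z k) + α k * z (k-1)`. -/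
structure CyclicSystem (n : ℕ) where
  P : Fin (n + 1) → Polynomial ℂ
  α : Fin (n + 1) → ℂ
  two_le : ∀ k, 2 ≤ (P k).natDegree

namespace CyclicSystem

variable {n : ℕ} (Q : CyclicSystem n)

/-- The leading coefficients. -/
def lc (k : Fin (n + 1)) : ℂ := (Q.P k).leadingCoeff

theorem lc_ne_zero (k : Fin (n + 1)) : Q.lc k ≠ 0 := by
  have := Q.two_le k
  rw [lc, Polynomial.leadingCoeff_ne_zero]
  rintro h
  rw [h] at this
  simp at this

/-- The monic polynomials proportional to the `P k`. -/
def monicP (k : Fin (n + 1)) : Polynomial ℂ := Polynomial.C (Q.lc k)⁻¹ * Q.P k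

theorem monic_monicP (k : Fin (n + 1)) : (Q.monicP k).Monic := by
  rw [Polynomial.Monic, monicP, Polynomial.leadingCoeff_mul, Polynomial.leadingCoeff_C]
  exact inv_mul_cancel₀ (Q.lc_ne_zero k)

theorem natDegree_monicP (k : Fin (n + 1)) : (Q.monicP k).natDegree = (Q.P k).natDegree :=
  Polynomial.natDegree_C_mul (inv_ne_zero (Q.lc_ne_zero k))

/-- The lower order terms in the equations. -/
def lower (k : Fin (n + 1)) : MvPolynomial (Fin (n + 1)) ℂ :=
  MvPolynomial.C (Q.lc k)⁻¹ * MvPolynomial.X (k + 1) +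
    MvPolynomial.C (-((Q.lc k)⁻¹ * Q.α k)) * MvPolynomial.X (k - 1)

theorem totalDegree_lower (k : Fin (n + 1)) : (Q.lower k).totalDegree ≤ 1 := by
  refine (MvPolynomial.totalDegree_add _ _).trans (max_le ?_ ?_) <;>
  · refine (MvPolynomial.totalDegree_mul _ _).trans ?_
    rw [MvPolynomial.totalDegree_C, MvPolynomial.totalDegree_X]

/-- The residue functional of the system. -/
def residue : MvPolynomial (Fin (n + 1)) ℂ →ₗ[ℂ] ℂ :=
  globalResidue Q.monic_monicP (fun k => (Q.natDegree_monicP k).symm ▸ Q.two_le k)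
    Q.totalDegree_lower

/-- The generators of the ideal of the system. -/
def gen (k : Fin (n + 1)) : MvPolynomial (Fin (n + 1)) ℂ :=
  Polynomial.aeval (MvPolynomial.X k) (Q.monicP k) - Q.lower k

theorem residue_gen_mul (k : Fin (n + 1)) (f : MvPolynomial (Fin (n + 1)) ℂ) :
    Q.residue (Q.gen k * f) = 0 := by
  rw [gen, sub_mul, map_sub, sub_eq_zero]
  exact globalResidue_mul_eq _ _ _ k f

/-- The top exponents. -/
def top (k : Fin (n + 1)) : ℕ := (Q.P k).natDegree - 1

theorem one_le_top (k : Fin (n + 1)) : 1 ≤ Q.top k := by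
  have := Q.two_le k
  rw [top]; omega

theorem residue_monomial (e : Fin (n + 1) →₀ ℕ) (he : ∑ j, e j ≤ ∑ j, Q.top j) :
    Q.residue (MvPolynomial.monomial e 1) = ∏ j, if e j = Q.top j then 1 else 0 := by
  have h := globalResidue_monomial Q.monic_monicP
    (fun k => (Q.natDegree_monicP k).symm ▸ Q.two_le k) Q.totalDegree_lower (e := e)
    (by simp only [natDegree_monicP]; exact he)
  simp only [natDegree_monicP] at h
  exact h

/-- The coordinate ring of the solution scheme. -/
def Ring : Type := MvPolynomial (Fin (n + 1)) ℂ ⧸ Ideal.span (Set.range Q.gen)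

instance : CommRing Q.Ring :=
  inferInstanceAs (CommRing (MvPolynomial (Fin (n + 1)) ℂ ⧸ Ideal.span (Set.range Q.gen)))

instance : Algebra ℂ Q.Ring :=
  inferInstanceAs (Algebra ℂ (MvPolynomial (Fin (n + 1)) ℂ ⧸ Ideal.span (Set.range Q.gen)))

/-- The projection to the coordinate ring. -/
def proj : MvPolynomial (Fin (n + 1)) ℂ →ₐ[ℂ] Q.Ring := Ideal.Quotient.mkₐ ℂ _

theorem proj_surjective : Function.Surjective Q.proj := Ideal.Quotient.mkₐ_surjective _ _

theorem proj_eq_zero {f : MvPolynomial (Fin (n + 1)) ℂ} :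
    Q.proj f = 0 ↔ f ∈ Ideal.span (Set.range Q.gen) := Ideal.Quotient.eq_zero_iff_mem

theorem residue_eq_zero (f : MvPolynomial (Fin (n + 1)) ℂ) (hf : Q.proj f = 0) :
    Q.residue f = 0 :=
  map_eq_zero_of_mem_span Q.residue.toAddMonoidHom Q.residue_gen_mul (Q.proj_eq_zero.1 hf)

/-- The equation of the system, in any algebra where the generators vanish. -/
theorem equation_of_gen_eq_zero {B : Type*} [CommRing B] [Algebra ℂ B] {z : Fin (n + 1) → B}
    {k : Fin (n + 1)} (h : MvPolynomial.aeval z (Q.gen k) = 0) :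
    z (k + 1) = Polynomial.aeval (z k) (Q.P k) + algebraMap ℂ B (Q.α k) * z (k - 1) := by
  have h2 : MvPolynomial.aeval z (Q.gen k) = algebraMap ℂ B (Q.lc k)⁻¹ *
      (Polynomial.aeval (z k) (Q.P k) + algebraMap ℂ B (Q.α k) * z (k - 1) - z (k + 1)) := by
    rw [gen, monicP, lower]
    simp only [map_sub, map_add, map_mul, Polynomial.aeval_C, MvPolynomial.aeval_X, map_neg,
      ← Polynomial.aeval_algHom_apply, MvPolynomial.algHom_C, AlgHom.commutes]
    ring
  rw [h2] at h
  have h3 := congrArg (fun x => algebraMap ℂ B (Q.lc k) * x) h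
  simp only [← mul_assoc, ← map_mul, mul_inv_cancel₀ (Q.lc_ne_zero k), map_one, one_mul,
    mul_zero] at h3
  exact (sub_eq_zero.1 h3).symm

/-- The matrices of divided differences. -/
def bezMatrix (k : Fin (n + 1)) : Matrix (Fin 2) (Fin 2) (Polynomial Q.Ring) :=
  !![((Q.P k).map (algebraMap ℂ Q.Ring)) /ₘ
      (Polynomial.X - Polynomial.C (Q.proj (MvPolynomial.X k))),
    Polynomial.C (algebraMap ℂ Q.Ring (Q.α k)); 1, 0]

/-- The Bezoutian. -/
def bez : MvPolynomial (Fin (n + 1)) Q.Ring :=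
  (1 - matProd (siteMatrix Q.bezMatrix) (n + 1)).det

theorem proj_gen (k : Fin (n + 1)) : Q.proj (Q.gen k) = 0 :=
  Q.proj_eq_zero.2 (Ideal.subset_span ⟨k, rfl⟩)

theorem aeval_proj_X (f : MvPolynomial (Fin (n + 1)) ℂ) :
    MvPolynomial.aeval (fun k => Q.proj (MvPolynomial.X k)) f = Q.proj f := by
  rw [← MvPolynomial.comp_aeval_apply, MvPolynomial.aeval_X_left_apply]

theorem bez_mul_mem (k : Fin (n + 1)) :
    Q.bez * (MvPolynomial.C (Q.proj (MvPolynomial.X k)) - MvPolynomial.X k) ∈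
      Ideal.span (Set.range fun k => MvPolynomial.map (algebraMap ℂ Q.Ring) (Q.gen k)) := by
  set J := Ideal.span (Set.range fun k => MvPolynomial.map (algebraMap ℂ Q.Ring) (Q.gen k)) with hJ
  let φ : MvPolynomial (Fin (n + 1)) Q.Ring →ₐ[Q.Ring] MvPolynomial (Fin (n + 1)) Q.Ring ⧸ J :=
    Ideal.Quotient.mkₐ Q.Ring J
  let x : Fin (n + 1) → MvPolynomial (Fin (n + 1)) Q.Ring ⧸ J :=
    fun k => φ (MvPolynomial.C (Q.proj (MvPolynomial.X k)))
  let y : Fin (n + 1) → MvPolynomial (Fin (n + 1)) Q.Ring ⧸ J := fun k => φ (MvPolynomial.X k)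
  have hx : ∀ k, x (k + 1) =
      Polynomial.aeval (x k) (Q.P k) + algebraMap ℂ _ (Q.α k) * x (k - 1) := by
    intro k
    refine Q.equation_of_gen_eq_zero ?_
    have : MvPolynomial.aeval x (Q.gen k) = algebraMap Q.Ring _ (MvPolynomial.aeval
        (fun k => Q.proj (MvPolynomial.X k)) (Q.gen k)) := by
      rw [← MvPolynomial.aeval_algebraMap_apply]
      rfl
    rw [this, aeval_proj_X, proj_gen, map_zero]
  have hy : ∀ k, y (k + 1) =
      Polynomial.aeval (y k) (Q.P k) + algebraMap ℂ _ (Q.α k) * y (k - 1) := by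
    intro k
    refine Q.equation_of_gen_eq_zero ?_
    have : MvPolynomial.aeval y (Q.gen k) =
        φ (MvPolynomial.map (algebraMap ℂ Q.Ring) (Q.gen k)) := by
      have h1 := MvPolynomial.aeval_map_algebraMap Q.Ring y (Q.gen k)
      rw [← h1, ← MvPolynomial.comp_aeval_apply, MvPolynomial.aeval_X_left_apply]
    rw [this]
    exact Ideal.Quotient.eq_zero_iff_mem.2 (Ideal.subset_span ⟨k, rfl⟩)
  let v : ℕ → Fin 2 → MvPolynomial (Fin (n + 1)) Q.Ring ⧸ J := fun k =>
    ![x (Fin.ofNat (n + 1) k) - y (Fin.ofNat (n + 1) k),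
      x (Fin.ofNat (n + 1) k - 1) - y (Fin.ofNat (n + 1) k - 1)]
  have hs : ∀ k, Fin.ofNat (n + 1) (k + 1) = Fin.ofNat (n + 1) k + 1 := fun k => by
    ext; simp [Fin.val_add]
  have hM : ∀ k, ((siteMatrix Q.bezMatrix k).map φ).mulVec (v k) = v (k + 1) := by
    intro k
    have hdd := eval_eq_divByMonic ((Q.P (Fin.ofNat (n + 1) k)).map (algebraMap ℂ Q.Ring))
      (Q.proj (MvPolynomial.X (Fin.ofNat (n + 1) k)))
    have hdy := congrArg (Polynomial.aeval (y (Fin.ofNat (n + 1) k))) hdd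
    rw [Polynomial.aeval_map_algebraMap, map_add, map_mul, map_sub, Polynomial.aeval_X,
      Polynomial.aeval_C, Polynomial.aeval_C, Polynomial.eval_map_algebraMap,
      ← Polynomial.aeval_algebraMap_apply] at hdy
    have hxe : ∀ k, algebraMap Q.Ring (MvPolynomial (Fin (n + 1)) Q.Ring ⧸ J)
      (Q.proj (MvPolynomial.X k)) = x k := fun _ => rfl
    rw [hxe] at hdy
    simp only [v, hs, add_sub_cancel_right]
    ext i
    fin_cases i
    · simp only [siteMatrix, bezMatrix, Matrix.mulVec, Matrix.map_apply, dotProduct,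
        Fin.sum_univ_two, Matrix.of_apply, Matrix.cons_val_zero, Matrix.cons_val_one,
        Matrix.cons_val', Matrix.cons_val_fin_one, Fin.zero_eta, Fin.isValue]
      rw [hx, hy, hdy, ← Polynomial.aeval_algHom_apply, Polynomial.aeval_C, AlgHom.commutes,
        ← IsScalarTower.algebraMap_apply]
      change Polynomial.aeval (y (Fin.ofNat (n + 1) k)) _ * _ + _ = _
      ring
    · simp [siteMatrix, bezMatrix, Matrix.mulVec, dotProduct]
  have hkey := det_one_sub_matProd_smul hM (n := n + 1) (by simp [v]) k.val
  have hb : φ Q.bez = (1 - matProd (fun k => (siteMatrix Q.bezMatrix k).map φ) (n + 1)).det := by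
    have := map_matProd φ.toRingHom (siteMatrix Q.bezMatrix) (n + 1)
    rw [bez, AlgHom.map_det, map_sub, map_one]
    exact congrArg (fun N => (1 - N).det) this
  rw [← Ideal.Quotient.eq_zero_iff_mem]
  change φ (Q.bez * _) = 0
  rw [map_mul, map_sub, hb]
  have h0 := congrFun hkey 0
  simp [v] at h0
  exact h0

theorem natDegree_divByMonic_X_sub_C_le {A : Type*} [CommRing A] (f : Polynomial A) (x : A) :
    (f /ₘ (Polynomial.X - Polynomial.C x)).natDegree ≤ f.natDegree - 1 := by
  nontriviality A
  rw [Polynomial.natDegree_divByMonic _ (Polynomial.monic_X_sub_C x),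
    Polynomial.natDegree_X_sub_C]

theorem coeff_divByMonic_X_sub_C_top {A : Type*} [CommRing A] {f : Polynomial A} {d : ℕ}
    (hf : f.natDegree ≤ d + 1) (x : A) :
    (f /ₘ (Polynomial.X - Polynomial.C x)).coeff d = f.coeff (d + 1) := by
  have h := natDegree_divByMonic_X_sub_C_le f x
  conv_rhs => rw [eval_eq_divByMonic f x, sub_mul, Polynomial.coeff_add, Polynomial.coeff_sub,
    Polynomial.coeff_X_mul, Polynomial.coeff_C_mul, Polynomial.coeff_C_of_ne_zero (by omega)]
  rw [Polynomial.coeff_eq_zero_of_natDegree_lt (n := d + 1) (by omega)]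
  ring

theorem residue_C (a : ℂ) : Q.residue (MvPolynomial.C a) = 0 := by
  have h := Q.residue_monomial 0 (by simp)
  rw [Finset.prod_eq_zero (Finset.mem_univ 0)
    (by rw [if_neg]; have := Q.one_le_top 0; simp; omega)] at h
  rw [← mul_one (MvPolynomial.C a), ← MvPolynomial.smul_eq_C_mul, map_smul]
  simp only [MvPolynomial.monomial_zero', MvPolynomial.C_1] at h
  rw [h, smul_zero]

theorem extendScalars_residue_C (a : Q.Ring) :
    extendScalars Q.Ring Q.residue (MvPolynomial.C a) = 0 := by
  rw [← MvPolynomial.monomial_zero', extendScalars_monomial', MvPolynomial.monomial_zero',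
    residue_C, map_zero, mul_zero]

/-- The determinant of the Jacobian cocycle. -/
def jac : ℂ := ∏ k, -Q.α k

theorem det_matProd_siteMatrix {A : Type*} [CommRing A]
    {E : Fin (n + 1) → Matrix (Fin 2) (Fin 2) (Polynomial A)} {a : Fin (n + 1) → A}
    (h : ∀ k, (E k).det = Polynomial.C (a k)) :
    (matProd (siteMatrix E) (n + 1)).det = MvPolynomial.C (∏ k, a k) := by
  rw [det_matProd, Finset.prod_range, map_prod]
  refine Finset.prod_congr rfl fun k _ => ?_
  have := AlgHom.map_det (Polynomial.aeval (MvPolynomial.X k : MvPolynomial (Fin (n + 1)) A)) (E k)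
  rw [h, Polynomial.aeval_C, MvPolynomial.algebraMap_eq] at this
  rw [this]
  simp [siteMatrix]

theorem extendScalars_bez :
    extendScalars Q.Ring Q.residue Q.bez = algebraMap ℂ Q.Ring (-∏ k, Q.lc k) := by
  have hdet : (matProd (siteMatrix Q.bezMatrix) (n + 1)).det =
      MvPolynomial.C (∏ k, -algebraMap ℂ Q.Ring (Q.α k)) :=
    det_matProd_siteMatrix fun k => by simp [bezMatrix, Matrix.det_fin_two]
  have htr := linearMap_trace_siteMatrix (L := extendScalars Q.Ring Q.residue) Q.one_le_top
    (fun e he => by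
      rw [extendScalars_monomial, Q.residue_monomial e he, map_prod]
      refine Finset.prod_congr rfl fun j _ => ?_
      split_ifs <;> simp) (E := Q.bezMatrix)
    (fun k => by
      refine (natDegree_divByMonic_X_sub_C_le _ _).trans ?_
      exact Nat.sub_le_sub_right (Polynomial.natDegree_map_le) _)
    (fun k i j hij => by
      fin_cases i <;> fin_cases j <;> simp_all [bezMatrix])
  rw [bez, det_one_sub_fin_two, map_add, map_sub, htr, hdet, extendScalars_residue_C,
    ← MvPolynomial.C_1, extendScalars_residue_C, zero_sub, add_zero, map_neg, map_prod]
  congr 1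
  refine Finset.prod_congr rfl fun k _ => ?_
  have h1 : Q.top k + 1 = (Q.P k).natDegree := by have := Q.two_le k; rw [top]; omega
  have h2 := coeff_divByMonic_X_sub_C_top (f := (Q.P k).map (algebraMap ℂ Q.Ring)) (d := Q.top k)
    (by rw [h1]; exact Polynomial.natDegree_map_le) (Q.proj (MvPolynomial.X k))
  refine h2.trans ?_
  rw [Polynomial.coeff_map, h1]
  rfl

/-- The Jacobian matrices, as matrices of polynomials. -/
def jacMatrix (k : Fin (n + 1)) : Matrix (Fin 2) (Fin 2) (Polynomial ℂ) :=
  !![Polynomial.derivative (Q.P k), Polynomial.C (Q.α k); 1, 0]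

/-- The trace of the Jacobian cocycle, as a polynomial. -/
def tr : MvPolynomial (Fin (n + 1)) ℂ := (matProd (siteMatrix Q.jacMatrix) (n + 1)).trace

theorem residue_tr : Q.residue Q.tr = ∏ k, ((Q.P k).natDegree : ℂ) * Q.lc k := by
  rw [tr, linearMap_trace_siteMatrix Q.one_le_top Q.residue_monomial]
  · refine Finset.prod_congr rfl fun k _ => ?_
    have h1 : Q.top k + 1 = (Q.P k).natDegree := by have := Q.two_le k; rw [top]; omega
    change (Polynomial.derivative (Q.P k)).coeff (Q.top k) = _
    rw [Polynomial.coeff_derivative, ← Nat.cast_add_one, h1, mul_comm]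
    rfl
  · exact fun k => Polynomial.natDegree_derivative_le _
  · intro k i j hij
    fin_cases i <;> fin_cases j <;> simp_all [jacMatrix]

theorem eval_bez : Q.proj (1 - Q.tr + MvPolynomial.C Q.jac) =
    MvPolynomial.eval (fun k => Q.proj (MvPolynomial.X k)) Q.bez := by
  have hdet : (matProd (siteMatrix Q.jacMatrix) (n + 1)).det = MvPolynomial.C Q.jac :=
    det_matProd_siteMatrix fun k => by simp [jacMatrix, Matrix.det_fin_two]
  rw [tr, ← hdet, ← det_one_sub_fin_two, bez, AlgHom.map_det, RingHom.map_det, map_sub, map_sub,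
    map_one, map_one]
  have h1 := map_matProd Q.proj.toRingHom (siteMatrix Q.jacMatrix) (n + 1)
  have h2 := map_matProd (MvPolynomial.eval fun k => Q.proj (MvPolynomial.X k))
    (siteMatrix Q.bezMatrix) (n + 1)
  refine congrArg (fun N => (1 - N).det) (h1.trans (Eq.trans ?_ h2.symm))
  congr 1
  ext k i j
  fin_cases i <;> fin_cases j
  · simp only [siteMatrix, jacMatrix, bezMatrix]
    change Q.proj (Polynomial.aeval _ _) = MvPolynomial.eval _ (Polynomial.aeval _ _)
    rw [← Polynomial.aeval_algHom_apply, ← MvPolynomial.coe_aeval_eq_eval]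
    change _ = MvPolynomial.aeval _ (Polynomial.aeval _ _)
    rw [← Polynomial.aeval_algHom_apply, MvPolynomial.aeval_X]
    refine Eq.trans ?_ (eval_divByMonic_eq_derivative _ _).symm
    rw [Polynomial.derivative_map, Polynomial.eval_map_algebraMap]
    rfl
  · simp only [siteMatrix, jacMatrix, bezMatrix]
    change Q.proj (Polynomial.aeval _ (Polynomial.C (Q.α _))) = MvPolynomial.eval _
      (Polynomial.aeval _ (Polynomial.C (algebraMap ℂ Q.Ring (Q.α _))))
    rw [Polynomial.aeval_C, Polynomial.aeval_C, AlgHom.commutes, MvPolynomial.algebraMap_eq,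
      MvPolynomial.eval_C]
  · simp [siteMatrix, jacMatrix, bezMatrix]
  · simp [siteMatrix, jacMatrix, bezMatrix]

theorem prod_lc_ne_zero : -∏ k, Q.lc k ≠ 0 :=
  neg_ne_zero.2 (Finset.prod_ne_zero_iff.2 fun k _ => Q.lc_ne_zero k)

instance : Module.Finite ℂ Q.Ring :=
  finite_of_bezout Q.proj_surjective Q.residue_gen_mul Q.bez_mul_mem Q.extendScalars_bez
    Q.prod_lc_ne_zero

theorem trace_mulLeft (g : MvPolynomial (Fin (n + 1)) ℂ) :
    (-∏ k, Q.lc k) * LinearMap.trace ℂ Q.Ring (LinearMap.mulLeft ℂ (Q.proj g)) =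
      Q.residue (g * (1 - Q.tr + MvPolynomial.C Q.jac)) :=
  trace_mulLeft_of_bezout Q.proj_surjective Q.residue_eq_zero Q.residue_gen_mul Q.bez_mul_mem
    Q.extendScalars_bez Q.prod_lc_ne_zero g _ Q.eval_bez

/-- Bézout's theorem for the system. -/
theorem finrank_ring : Module.finrank ℂ Q.Ring = ∏ k, (Q.P k).natDegree := by
  have h := Q.trace_mulLeft 1
  rw [map_one, LinearMap.mulLeft_one, one_mul, map_add, map_sub, residue_C, ← MvPolynomial.C_1,
    residue_C, residue_tr, Finset.prod_mul_distrib, zero_sub, add_zero, ← Module.End.one_eq_id,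
    LinearMap.trace_one, mul_comm, mul_neg, neg_inj] at h
  have h2 := mul_right_cancel₀ (neg_ne_zero.1 Q.prod_lc_ne_zero) h
  exact_mod_cast h2

theorem residue_tr_sq : Q.residue (Q.tr * Q.tr) =
    (1 + Q.jac) * ∏ k, ((Q.P k).natDegree : ℂ) * Q.lc k
    + (∏ k, Q.lc k) * LinearMap.trace ℂ Q.Ring (LinearMap.mulLeft ℂ (Q.proj Q.tr)) := by
  have h := Q.trace_mulLeft Q.tr
  rw [mul_add, mul_sub, mul_one, map_add, map_sub, mul_comm Q.tr (MvPolynomial.C _),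
    ← MvPolynomial.smul_eq_C_mul, map_smul, residue_tr, smul_eq_mul] at h
  linear_combination h

end CyclicSystem

theorem exists_algHom_of_not_isUnit {A : Type*} [CommRing A] [Algebra ℂ A] [Module.Finite ℂ A]
    {a : A} (ha : ¬ IsUnit a) : ∃ φ : A →ₐ[ℂ] ℂ, φ a = 0 := by
  obtain ⟨M, hM, haM⟩ := exists_max_ideal_of_mem_nonunits ha
  let : Field (A ⧸ M) := Ideal.Quotient.field M
  have hb : Function.Bijective (algebraMap ℂ (A ⧸ M)) :=
    IsAlgClosed.algebraMap_bijective_of_isIntegral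
  let e := AlgEquiv.ofBijective (Algebra.ofId ℂ (A ⧸ M)) hb
  refine ⟨(e.symm : (A ⧸ M) →ₐ[ℂ] ℂ).comp (Ideal.Quotient.mkₐ ℂ M), ?_⟩
  have : Ideal.Quotient.mkₐ ℂ M a = 0 := Ideal.Quotient.eq_zero_iff_mem.2 haM
  rw [AlgHom.comp_apply, this, map_zero]

theorem norm_trace_le_of_norm_eigenvalue_le {V : Type*} [AddCommGroup V] [Module ℂ V]
    [FiniteDimensional ℂ V] (f : V →ₗ[ℂ] V) {c : ℝ}
    (h : ∀ μ, Module.End.HasEigenvalue f μ → ‖μ‖ ≤ c) :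
    ‖LinearMap.trace ℂ V f‖ ≤ Module.finrank ℂ V * c := by
  rw [Module.End.trace_eq_sum_roots_charpoly_of_splits (IsAlgClosed.splits _)]
  have hc : Multiset.card f.charpoly.roots = Module.finrank ℂ V := by
    rw [IsAlgClosed.card_roots_eq_natDegree, LinearMap.charpoly_natDegree]
  have hn : ∀ s : Multiset ℂ, (∀ x ∈ s, ‖x‖ ≤ c) → ‖s.sum‖ ≤ Multiset.card s * c := by
    intro s
    induction s using Multiset.induction_on with
    | empty => simp
    | cons a s ih =>
      intro hs
      rw [Multiset.sum_cons, Multiset.card_cons]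
      have h1 := ih fun x hx => hs x (Multiset.mem_cons_of_mem hx)
      have h2 := hs a (Multiset.mem_cons_self a s)
      push_cast
      linarith [norm_add_le a s.sum]
  rw [← hc]
  refine hn _ fun x hx => h x ?_
  rw [Module.End.hasEigenvalue_iff_isRoot_charpoly]
  exact Polynomial.isRoot_of_mem_roots hx

namespace CyclicSystem

variable {n : ℕ} (Q : CyclicSystem n)

theorem norm_trace_mulLeft_le (g : MvPolynomial (Fin (n + 1)) ℂ) {c : ℝ}
    (h : ∀ z : Fin (n + 1) → ℂ, (∀ k, z (k + 1) = (Q.P k).eval (z k) + Q.α k * z (k - 1)) →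
      ‖MvPolynomial.eval z g‖ ≤ c) :
    ‖LinearMap.trace ℂ Q.Ring (LinearMap.mulLeft ℂ (Q.proj g))‖ ≤
      Module.finrank ℂ Q.Ring * c := by
  refine norm_trace_le_of_norm_eigenvalue_le _ fun μ hμ => ?_
  obtain ⟨v, hv, hv0⟩ := hμ.exists_hasEigenvector
  rw [Module.End.mem_eigenspace_iff, LinearMap.mulLeft_apply] at hv
  have hu : ¬ IsUnit (Q.proj g - algebraMap ℂ Q.Ring μ) := by
    intro hu
    apply hv0
    rw [← hu.mul_right_eq_zero, sub_mul, hv, Algebra.smul_def, sub_self]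
  obtain ⟨φ, hφ⟩ := exists_algHom_of_not_isUnit hu
  rw [map_sub, AlgHom.commutes, sub_eq_zero] at hφ
  have hz : ∀ f, φ (Q.proj f) = MvPolynomial.aeval (fun k => φ (Q.proj (MvPolynomial.X k))) f := by
    intro f
    have := MvPolynomial.comp_aeval_apply (φ := φ.comp Q.proj) (f := MvPolynomial.X) (p := f)
    rw [MvPolynomial.aeval_X_left_apply] at this
    exact this
  have := h (fun k => φ (Q.proj (MvPolynomial.X k))) fun k => by
    have := Q.equation_of_gen_eq_zero (B := ℂ) (z := fun k => φ (Q.proj (MvPolynomial.X k)))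
      (k := k) (by rw [← hz, proj_gen, map_zero])
    simpa [Polynomial.coe_aeval_eq_eval] using this
  rw [← MvPolynomial.coe_aeval_eq_eval] at this
  have h2 := hz g
  rw [hφ] at h2
  rw [show μ = _ from h2]
  exact this

end CyclicSystem

section Transfer

/-- The Jacobian matrix of a second order recursion. -/
def recMatrix (P : Polynomial ℂ) (α : ℂ) : Matrix (Fin 2) (Fin 2) (Polynomial ℂ) :=
  !![Polynomial.derivative P, Polynomial.C α; 1, 0]

/-- The product of two entries of the Jacobian matrix. -/
def recEntry (P : Polynomial ℂ) (α : ℂ) (u' u : Fin 2 × Fin 2) : Polynomial ℂ :=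
  recMatrix P α u'.1 u.1 * recMatrix P α u'.2 u.2

/-- The part of a polynomial of degree `< 2 * natDegree P` that is carried to the next site
(`f = 1`), to the previous site (`r = 1`), or stays, when `P` is reduced by the recursion. -/
def carry (P : Polynomial ℂ) (α : ℂ) (g : Polynomial ℂ) (f r : Fin 2) : Polynomial ℂ :=
  if f = 0 then
    if r = 0 then g %ₘ (Polynomial.C P.leadingCoeff⁻¹ * P)
    else Polynomial.C (-(P.leadingCoeff⁻¹ * α)) * (g /ₘ (Polynomial.C P.leadingCoeff⁻¹ * P))
  else
    if r = 0 then Polynomial.C P.leadingCoeff⁻¹ * (g /ₘ (Polynomial.C P.leadingCoeff⁻¹ * P))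
    else 0

/-- The transfer matrix computing residues of squares of traces. -/
def transferMatrix (P : Polynomial ℂ) (α : ℂ) :
    Matrix ((Fin 2 × Fin 2) × (Fin 2 × Fin 2)) ((Fin 2 × Fin 2) × (Fin 2 × Fin 2)) ℂ :=
  fun x' x => (carry P α (recEntry P α x'.1 x.1) x'.2.1 x.2.2 *
    Polynomial.X ^ ((x.2.1 : ℕ) + (x'.2.2 : ℕ))).coeff (P.natDegree - 1)

variable {P : Polynomial ℂ} {α : ℂ}

theorem natDegree_recMatrix_le (i j : Fin 2) : (recMatrix P α i j).natDegree ≤ P.natDegree - 1 := by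
  fin_cases i <;> fin_cases j <;> simp [recMatrix]

theorem natDegree_recEntry_le (u' u : Fin 2 × Fin 2) :
    (recEntry P α u' u).natDegree ≤ 2 * (P.natDegree - 1) := by
  refine Polynomial.natDegree_mul_le.trans ?_
  have := natDegree_recMatrix_le (P := P) (α := α) u'.1 u.1
  have := natDegree_recMatrix_le (P := P) (α := α) u'.2 u.2
  omega

theorem monic_normalized (hP : 2 ≤ P.natDegree) :
    (Polynomial.C P.leadingCoeff⁻¹ * P).Monic := by
  rw [Polynomial.Monic, Polynomial.leadingCoeff_mul, Polynomial.leadingCoeff_C]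
  refine inv_mul_cancel₀ (Polynomial.leadingCoeff_ne_zero.2 ?_)
  rintro rfl
  simp at hP

theorem natDegree_normalized (hP : 2 ≤ P.natDegree) :
    (Polynomial.C P.leadingCoeff⁻¹ * P).natDegree = P.natDegree := by
  refine Polynomial.natDegree_C_mul (inv_ne_zero (Polynomial.leadingCoeff_ne_zero.2 ?_))
  rintro rfl
  simp at hP

theorem natDegree_carry_add_le (hP : 2 ≤ P.natDegree) {g : Polynomial ℂ}
    (hg : g.natDegree ≤ 2 * (P.natDegree - 1)) (f r : Fin 2) :
    (carry P α g f r).natDegree + ((f : ℕ) + r) ≤ P.natDegree - 1 ∨ carry P α g f r = 0 := by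
  have hB : (g /ₘ (Polynomial.C P.leadingCoeff⁻¹ * P)).natDegree ≤ P.natDegree - 2 := by
    rw [Polynomial.natDegree_divByMonic _ (monic_normalized hP), natDegree_normalized hP]
    omega
  fin_cases f <;> fin_cases r
  · left
    have := Polynomial.natDegree_modByMonic_lt g (monic_normalized hP) (by
      intro h
      have h2 := natDegree_normalized hP
      rw [h] at h2
      simp at h2
      omega)
    rw [natDegree_normalized hP] at this
    simp [carry]
    omega
  · left
    have := Polynomial.natDegree_C_mul_le (-(P.leadingCoeff⁻¹ * α))
      (g /ₘ (Polynomial.C P.leadingCoeff⁻¹ * P))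
    simp only [carry, Fin.zero_eta, Fin.mk_one, Fin.isValue, if_true, one_ne_zero, if_false]
    omega
  · left
    have := Polynomial.natDegree_C_mul_le (P.leadingCoeff⁻¹)
      (g /ₘ (Polynomial.C P.leadingCoeff⁻¹ * P))
    simp only [carry, Fin.zero_eta, Fin.mk_one, Fin.isValue, if_true, one_ne_zero, if_false]
    omega
  · right
    simp [carry]

theorem recEntry_divByMonic_eq_zero (hP : 2 ≤ P.natDegree) {u' u : Fin 2 × Fin 2}
    (h : u' ≠ (0, 0) ∨ u ≠ (0, 0)) :
    recEntry P α u' u /ₘ (Polynomial.C P.leadingCoeff⁻¹ * P) = 0 := by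
  refine (Polynomial.divByMonic_eq_zero_iff (monic_normalized hP)).2 ?_
  refine Polynomial.degree_lt_degree ?_
  rw [natDegree_normalized hP]
  have h0 : ∀ i j : Fin 2, (i, j) ≠ (0, 0) → (recMatrix P α i j).natDegree = 0 := by
    intro i j hij
    fin_cases i <;> fin_cases j <;> simp_all [recMatrix]
  have h1 := natDegree_recMatrix_le (P := P) (α := α) u'.1 u.1
  have h2 := natDegree_recMatrix_le (P := P) (α := α) u'.2 u.2
  have h3 : (recEntry P α u' u).natDegree ≤ _ := Polynomial.natDegree_mul_le
  by_cases h4 : (u'.1, u.1) = (0, 0)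
  · by_cases h5 : (u'.2, u.2) = (0, 0)
    · exfalso
      simp only [Prod.mk.injEq] at h4 h5
      rcases h with h | h
      · exact h (Prod.ext h4.1 h5.1)
      · exact h (Prod.ext h4.2 h5.2)
    · have := h0 _ _ h5
      omega
  · have := h0 _ _ h4
    omega

theorem coeff_recEntry_divByMonic (hP : 2 ≤ P.natDegree) :
    (recEntry P α (0, 0) (0, 0) /ₘ (Polynomial.C P.leadingCoeff⁻¹ * P)).coeff (P.natDegree - 2) =
      (P.natDegree * P.leadingCoeff) ^ 2 := by
  set g := recEntry P α (0, 0) (0, 0) with hg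
  have h1 := Polynomial.modByMonic_add_div g (Polynomial.C P.leadingCoeff⁻¹ * P)
  have h2 := Polynomial.natDegree_modByMonic_lt g (monic_normalized hP) (by
      intro h
      have h2 := natDegree_normalized hP
      rw [h] at h2
      simp at h2
      omega)
  rw [natDegree_normalized hP] at h2
  have hB : (g /ₘ (Polynomial.C P.leadingCoeff⁻¹ * P)).natDegree ≤ P.natDegree - 2 := by
    rw [Polynomial.natDegree_divByMonic _ (monic_normalized hP), natDegree_normalized hP]
    have : g.natDegree ≤ _ := natDegree_recEntry_le (P := P) (α := α) (0, 0) (0, 0)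
    omega
  have h3 := congrArg (fun q => Polynomial.coeff q (P.natDegree + (P.natDegree - 2))) h1
  simp only [Polynomial.coeff_add] at h3
  rw [Polynomial.coeff_eq_zero_of_natDegree_lt (by omega), zero_add,
    Polynomial.coeff_mul_add_eq_of_natDegree_le (natDegree_normalized hP).le hB] at h3
  have h4 : (Polynomial.C P.leadingCoeff⁻¹ * P).coeff P.natDegree = 1 := by
    have := monic_normalized hP
    rw [Polynomial.Monic, Polynomial.leadingCoeff, natDegree_normalized hP] at this
    exact this
  rw [h4, one_mul] at h3
  rw [h3, show P.natDegree + (P.natDegree - 2) = (P.natDegree - 1) + (P.natDegree - 1) by omega]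
  have h5 : g = Polynomial.derivative P * Polynomial.derivative P := rfl
  rw [h5, Polynomial.coeff_mul_add_eq_of_natDegree_le (Polynomial.natDegree_derivative_le _)
    (Polynomial.natDegree_derivative_le _), Polynomial.coeff_derivative,
    ← Nat.cast_add_one, show P.natDegree - 1 + 1 = P.natDegree by omega]
  rw [Polynomial.leadingCoeff]
  ring

theorem coeff_mul_X_pow_of_natDegree_le {A : Type*} [CommRing A] {b : Polynomial A} {d e : ℕ}
    (hb : b.natDegree ≤ d) (he : e ≤ 1) :
    (b * Polynomial.X ^ e).coeff (d + 1) = if e = 1 then b.coeff d else 0 := by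
  interval_cases e
  · rw [pow_zero, mul_one, Polynomial.coeff_eq_zero_of_natDegree_lt (by omega)]
    simp
  · rw [pow_one, Polynomial.coeff_mul_X]
    simp

theorem transferMatrix_row (hP : 2 ≤ P.natDegree) (x : (Fin 2 × Fin 2) × (Fin 2 × Fin 2)) :
    transferMatrix P α ((0, 0), (1, 0)) x =
      if x = ((0, 0), (1, 0)) then (P.natDegree : ℂ) ^ 2 * P.leadingCoeff else 0 := by
  have hl : P.leadingCoeff ≠ 0 := by
    rw [Polynomial.leadingCoeff_ne_zero]
    rintro rfl
    simp at hP
  obtain ⟨u, f, r⟩ := x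
  by_cases hu : u = (0, 0)
  · subst hu
    have hB : (recEntry P α (0, 0) (0, 0) /ₘ (Polynomial.C P.leadingCoeff⁻¹ * P)).natDegree ≤
        P.natDegree - 2 := by
      rw [Polynomial.natDegree_divByMonic _ (monic_normalized hP), natDegree_normalized hP]
      have := natDegree_recEntry_le (P := P) (α := α) (0, 0) (0, 0)
      omega
    have h1 := coeff_mul_X_pow_of_natDegree_le hB (e := f) (by omega)
    rw [show P.natDegree - 2 + 1 = P.natDegree - 1 by omega] at h1
    fin_cases r
    · simp only [transferMatrix, carry, Fin.zero_eta, Fin.isValue, one_ne_zero, if_false, if_true,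
        Fin.val_zero, add_zero]
      rw [mul_assoc, Polynomial.coeff_C_mul, h1, coeff_recEntry_divByMonic hP]
      fin_cases f
      · simp
      · simp
        field_simp
    · simp [transferMatrix, carry]
  · have : transferMatrix P α ((0, 0), (1, 0)) (u, f, r) = 0 := by
      simp [transferMatrix, carry, recEntry_divByMonic_eq_zero hP (Or.inr hu)]
    rw [this, if_neg]
    rintro h
    exact hu (Prod.mk.inj h).1

theorem transferMatrix_col (hP : 2 ≤ P.natDegree) (x : (Fin 2 × Fin 2) × (Fin 2 × Fin 2)) :
    transferMatrix P α x ((0, 0), (0, 1)) =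
      if x = ((0, 0), (0, 1)) then -α * ((P.natDegree : ℂ) ^ 2 * P.leadingCoeff) else 0 := by
  have hl : P.leadingCoeff ≠ 0 := by
    rw [Polynomial.leadingCoeff_ne_zero]
    rintro rfl
    simp at hP
  obtain ⟨u, f, r⟩ := x
  by_cases hu : u = (0, 0)
  · subst hu
    have hB : (recEntry P α (0, 0) (0, 0) /ₘ (Polynomial.C P.leadingCoeff⁻¹ * P)).natDegree ≤
        P.natDegree - 2 := by
      rw [Polynomial.natDegree_divByMonic _ (monic_normalized hP), natDegree_normalized hP]
      have := natDegree_recEntry_le (P := P) (α := α) (0, 0) (0, 0)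
      omega
    have h1 := coeff_mul_X_pow_of_natDegree_le hB (e := r) (by omega)
    rw [show P.natDegree - 2 + 1 = P.natDegree - 1 by omega] at h1
    fin_cases f
    · simp only [transferMatrix, carry, Fin.zero_eta, Fin.isValue, one_ne_zero, if_false, if_true,
        Fin.val_zero, zero_add]
      rw [mul_assoc, Polynomial.coeff_C_mul, h1, coeff_recEntry_divByMonic hP]
      fin_cases r
      · simp
      · simp
        field_simp
    · simp [transferMatrix, carry]
  · have : transferMatrix P α (u, f, r) ((0, 0), (0, 1)) = 0 := by
      simp [transferMatrix, carry, recEntry_divByMonic_eq_zero hP (Or.inl hu)]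
    rw [this, if_neg]
    rintro h
    exact hu (Prod.mk.inj h).1

end Transfer

namespace CyclicSystem

variable {n : ℕ} (Q : CyclicSystem n)

/-- Reduction of a univariate polynomial modulo the equation at a site. -/
theorem proj_aeval_eq_sum_carry (k : Fin (n + 1)) (g : Polynomial ℂ) :
    Q.proj (Polynomial.aeval (MvPolynomial.X k) g) =
      ∑ c : Fin 2 × Fin 2, Q.proj (Polynomial.aeval (MvPolynomial.X k)
        (carry (Q.P k) (Q.α k) g c.1 c.2) * (MvPolynomial.X (k + 1) ^ (c.1 : ℕ) *
          MvPolynomial.X (k - 1) ^ (c.2 : ℕ))) := by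
  have h0 : Q.proj (Polynomial.aeval (MvPolynomial.X k) (Q.monicP k)) = Q.proj (Q.lower k) := by
    rw [← sub_eq_zero, ← map_sub]
    exact Q.proj_gen k
  have h1 := congrArg (fun g => Q.proj (Polynomial.aeval (MvPolynomial.X k) g))
    (Polynomial.modByMonic_add_div g (Q.monicP k))
  simp only [map_add, map_mul, h0] at h1
  rw [← h1, Fintype.sum_prod_type]
  simp only [Fin.sum_univ_two, carry, Fin.isValue, if_true, one_ne_zero, if_false, Fin.val_zero,
    Fin.val_one, pow_zero, pow_one, mul_one, one_mul, map_mul, map_zero, map_one, mul_one, one_mul,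
    zero_mul, add_zero]
  simp only [lower, map_add, map_mul, Polynomial.aeval_C, MvPolynomial.algebraMap_eq]
  simp only [monicP, lc]
  ring

theorem proj_eq_imp_residue_eq {f g : MvPolynomial (Fin (n + 1)) ℂ} (h : Q.proj f = Q.proj g) :
    Q.residue f = Q.residue g := by
  rw [← sub_eq_zero, ← map_sub]
  exact Q.residue_eq_zero _ (by rw [map_sub, h, sub_self])

theorem residue_prod_carry (g : Fin (n + 1) → Polynomial ℂ)
    (hg : ∀ k, (g k).natDegree ≤ 2 * ((Q.P k).natDegree - 1)) (c : Fin (n + 1) → Fin 2 × Fin 2) :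
    Q.residue (∏ k, (Polynomial.aeval (MvPolynomial.X k)
        (carry (Q.P k) (Q.α k) (g k) (c k).1 (c k).2) * (MvPolynomial.X (k + 1) ^ ((c k).1 : ℕ) *
          MvPolynomial.X (k - 1) ^ ((c k).2 : ℕ)))) =
      ∏ k, (carry (Q.P k) (Q.α k) (g k) (c k).1 (c k).2 *
        Polynomial.X ^ (((c (k - 1)).1 : ℕ) + ((c (k + 1)).2 : ℕ))).coeff (Q.top k) := by
  by_cases h0 : ∃ k, carry (Q.P k) (Q.α k) (g k) (c k).1 (c k).2 = 0
  · obtain ⟨k, hk⟩ := h0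
    rw [Finset.prod_eq_zero (Finset.mem_univ k) (by rw [hk, map_zero, zero_mul]),
      Finset.prod_eq_zero (Finset.mem_univ k) (by rw [hk, zero_mul, Polynomial.coeff_zero]),
      map_zero]
  · push Not at h0
    rw [← linearMap_prod_aeval_X Q.residue_monomial]
    · congr 1
      simp only [map_mul, map_pow, Polynomial.aeval_X, pow_add, Finset.prod_mul_distrib]
      congr 2
      · rw [← Equiv.prod_comp (Equiv.addRight (1 : Fin (n + 1)))
          (fun k => (MvPolynomial.X k : MvPolynomial (Fin (n + 1)) ℂ) ^ ((c (k - 1)).1 : ℕ))]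
        simp
      · rw [← Equiv.prod_comp (Equiv.subRight (1 : Fin (n + 1)))
          (fun k => (MvPolynomial.X k : MvPolynomial (Fin (n + 1)) ℂ) ^ ((c (k + 1)).2 : ℕ))]
        simp
    · have h1 : ∀ k, (carry (Q.P k) (Q.α k) (g k) (c k).1 (c k).2 *
          Polynomial.X ^ (((c (k - 1)).1 : ℕ) + ((c (k + 1)).2 : ℕ))).natDegree ≤
          (carry (Q.P k) (Q.α k) (g k) (c k).1 (c k).2).natDegree +
            (((c (k - 1)).1 : ℕ) + ((c (k + 1)).2 : ℕ)) := fun k =>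
        Polynomial.natDegree_mul_le.trans (by rw [Polynomial.natDegree_X_pow])
      refine (Finset.sum_le_sum fun k _ => h1 k).trans ?_
      rw [Finset.sum_add_distrib, Finset.sum_add_distrib,
        ← Equiv.sum_comp (Equiv.addRight (1 : Fin (n + 1))) (fun k => ((c (k - 1)).1 : ℕ)),
        ← Equiv.sum_comp (Equiv.subRight (1 : Fin (n + 1))) (fun k => ((c (k + 1)).2 : ℕ)),
        ← Finset.sum_add_distrib, ← Finset.sum_add_distrib]
      refine Finset.sum_le_sum fun k _ => ?_
      simp only [Equiv.coe_addRight, Equiv.subRight_apply, add_sub_cancel_right, sub_add_cancel]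
      exact (natDegree_carry_add_le (Q.two_le k) (hg k) _ _).resolve_right (h0 k)

theorem tr_mul_tr : Q.tr * Q.tr = ∑ u : Fin (n + 1) → Fin 2 × Fin 2,
    ∏ k, Polynomial.aeval (MvPolynomial.X k) (recEntry (Q.P k) (Q.α k) (u (k + 1)) (u k)) := by
  rw [tr, trace_siteMatrix, Finset.sum_mul_sum, ← Fintype.sum_prod_type']
  refine Fintype.sum_equiv (Equiv.arrowProdEquivProdArrow (Fin (n + 1)) (fun _ => Fin 2)
    (fun _ => Fin 2)).symm _ _ fun s => ?_
  rw [← Finset.prod_mul_distrib]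
  refine Finset.prod_congr rfl fun k _ => ?_
  rw [recEntry, map_mul]
  rfl

/-- The reindexing of states by shifting the forward carries. -/
def stateEquiv (n : ℕ) : (Fin (n + 1) → Fin 2 × Fin 2) × (Fin (n + 1) → Fin 2 × Fin 2) ≃
    (Fin (n + 1) → (Fin 2 × Fin 2) × (Fin 2 × Fin 2)) where
  toFun p k := (p.1 k, ((p.2 (k - 1)).1, (p.2 k).2))
  invFun q := (fun k => (q k).1, fun k => ((q (k + 1)).2.1, (q k).2.2))
  left_inv p := by ext k <;> simp
  right_inv q := by ext k <;> simp

theorem residue_tr_mul_tr : Q.residue (Q.tr * Q.tr) =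
    (matProd (fun k => transferMatrix (Q.P (Fin.ofNat (n + 1) k)) (Q.α (Fin.ofNat (n + 1) k)))
      (n + 1)).trace := by
  have h1 : Q.proj (Q.tr * Q.tr) = Q.proj (∑ u : Fin (n + 1) → Fin 2 × Fin 2,
      ∑ c : Fin (n + 1) → Fin 2 × Fin 2, ∏ k, (Polynomial.aeval (MvPolynomial.X k)
        (carry (Q.P k) (Q.α k) (recEntry (Q.P k) (Q.α k) (u (k + 1)) (u k)) (c k).1 (c k).2) *
          (MvPolynomial.X (k + 1) ^ ((c k).1 : ℕ) * MvPolynomial.X (k - 1) ^ ((c k).2 : ℕ)))) := by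
    rw [tr_mul_tr, map_sum, map_sum]
    refine Finset.sum_congr rfl fun u _ => ?_
    rw [map_prod, Finset.prod_congr rfl fun k _ => Q.proj_aeval_eq_sum_carry k _,
      Finset.prod_univ_sum, Fintype.piFinset_univ, map_sum]
    exact Finset.sum_congr rfl fun c _ => (map_prod _ _ _).symm
  rw [Q.proj_eq_imp_residue_eq h1, map_sum, trace_matProd, ← Equiv.sum_comp (stateEquiv n),
    Fintype.sum_prod_type]
  refine Finset.sum_congr rfl fun u _ => ?_
  rw [map_sum]
  refine Finset.sum_congr rfl fun c _ => ?_
  rw [residue_prod_carry _ _ fun k => natDegree_recEntry_le _ _]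
  refine Finset.prod_congr rfl fun k _ => ?_
  simp [transferMatrix, stateEquiv, top]

end CyclicSystem

section Spectral

variable {S : Type*} [Fintype S] [DecidableEq S]

theorem trace_ne_zero_of_isIdempotentElem {e : Matrix S S ℂ} (he : IsIdempotentElem e)
    (h0 : e ≠ 0) : e.trace ≠ 0 := by
  have h1 : IsIdempotentElem (Matrix.toLin' e) := by
    rw [IsIdempotentElem, Module.End.mul_eq_comp, ← Matrix.toLin'_mul, he.eq]
  rw [← Matrix.trace_toLin'_eq, Ne, LinearMap.IsIdempotentElem.trace_eq_zero_iff h1]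
  simpa using h0

theorem le_of_forall_mul_pow_le {a ρ c C : ℝ} (hρ : 0 ≤ ρ) (hc : 0 < c)
    (h : ∀ l : ℕ, c * a ^ (l + 1) ≤ C * ρ ^ (l + 1)) : a ≤ ρ := by
  by_contra! ha
  have ha0 : 0 < a := hρ.trans_lt ha
  have h1 : ∀ l : ℕ, c ≤ C * (ρ / a) ^ (l + 1) := by
    intro l
    rw [div_pow, ← mul_div_assoc, le_div_iff₀ (by positivity)]
    exact h l
  have h2 : Tendsto (fun l : ℕ => C * (ρ / a) ^ (l + 1)) atTop (𝓝 (C * 0)) :=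
    ((tendsto_pow_atTop_nhds_zero_of_lt_one (div_nonneg hρ ha0.le)
      ((div_lt_one ha0).2 ha)).comp (tendsto_add_atTop_nat 1)).const_mul C
  have := ge_of_tendsto' h2 h1
  linarith

theorem aeval_mulVec_of_eigenvector {M : Matrix S S ℂ} {μ : ℂ} {w : S → ℂ}
    (hw : M.mulVec w = μ • w) (q : Polynomial ℂ) :
    (Polynomial.aeval M q).mulVec w = q.eval μ • w := by
  induction q using Polynomial.induction_on' with
  | add p q hp hq => rw [map_add, Matrix.add_mulVec, hp, hq, Polynomial.eval_add, add_smul]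
  | monomial n a =>
    have : ∀ n : ℕ, (M ^ n).mulVec w = μ ^ n • w := by
      intro n
      induction n with
      | zero => simp
      | succ n ih =>
        rw [pow_succ, ← Matrix.mulVec_mulVec, hw, Matrix.mulVec_smul, ih, smul_smul, pow_succ,
          mul_comm]
    rw [Polynomial.aeval_monomial, Polynomial.eval_monomial, ← Algebra.smul_def,
      Matrix.smul_mulVec, this, smul_smul]

theorem norm_le_of_norm_trace_pow_le {M : Matrix S S ℂ} {C ρ : ℝ} (hρ : 0 ≤ ρ)
    (h : ∀ l : ℕ, ‖(M ^ (l + 1)).trace‖ ≤ C * ρ ^ (l + 1)) {μ : ℂ} {w : S → ℂ} (hw0 : w ≠ 0)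
    (hw : M.mulVec w = μ • w) : ‖μ‖ ≤ ρ := by
  obtain ⟨g, hg, hdvd⟩ := Polynomial.exists_eq_pow_rootMultiplicity_mul_and_not_dvd M.charpoly
    (Matrix.charpoly_monic M).ne_zero μ
  set a := Polynomial.rootMultiplicity μ M.charpoly
  have hcop : IsCoprime ((Polynomial.X - Polynomial.C μ) ^ (a + 1)) g :=
    IsCoprime.pow_left ((Polynomial.irreducible_X_sub_C μ).coprime_iff_not_dvd.2 hdvd)
  obtain ⟨u, v, huv⟩ := hcop
  have hzero : ∀ q : Polynomial ℂ,
      Polynomial.aeval M (q * ((Polynomial.X - Polynomial.C μ) ^ (a + 1) * g)) = 0 := by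
    intro q
    rw [pow_succ, mul_assoc, mul_comm _ g, ← mul_assoc _ g, ← hg, map_mul, map_mul,
      Matrix.aeval_self_charpoly, zero_mul, mul_zero]
  set e := Polynomial.aeval M (v * g) with he
  have hid : IsIdempotentElem e := by
    have h1 : v * g * (v * g) =
        v * g - u * v * ((Polynomial.X - Polynomial.C μ) ^ (a + 1) * g) := by
      linear_combination (v * g) * huv
    rw [IsIdempotentElem, he, ← map_mul, h1, map_sub, hzero, sub_zero]
  have hev : (v * g).eval μ = 1 := by
    have := congrArg (Polynomial.eval μ) huv
    simpa using this
  have he0 : e ≠ 0 := by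
    intro h0
    have h1 := aeval_mulVec_of_eigenvector hw (v * g)
    rw [← he, h0, Matrix.zero_mulVec, hev, one_smul] at h1
    exact hw0 h1.symm
  have htr : ∀ l : ℕ, (M ^ l * e).trace = μ ^ l * e.trace := by
    intro l
    obtain ⟨q, hq⟩ := sub_dvd_pow_sub_pow (Polynomial.X : Polynomial ℂ) (Polynomial.C μ) l
    have h1 : M ^ l * e = Polynomial.aeval M (Polynomial.X ^ l * (v * g)) := by
      rw [map_mul, map_pow, Polynomial.aeval_X]
    have h2 : IsNilpotent (Polynomial.aeval M ((Polynomial.X ^ l - Polynomial.C μ ^ l) *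
        (v * g))) := by
      refine ⟨a + 1, ?_⟩
      rw [← map_pow, hq]
      convert hzero (q ^ (a + 1) * v ^ (a + 1) * g ^ a) using 2
      generalize Polynomial.X - Polynomial.C μ = y
      ring
    have h3 := (Matrix.isNilpotent_trace_of_isNilpotent h2).eq_zero
    rw [sub_mul, map_sub, ← h1, Matrix.trace_sub, sub_eq_zero] at h3
    rw [h3, ← map_pow, ← Polynomial.smul_eq_C_mul, map_smul, Matrix.trace_smul, smul_eq_mul]
  refine le_of_forall_mul_pow_le hρ (c := ‖e.trace‖)
    (C := ∑ j ∈ Finset.range ((v * g).natDegree + 1), ‖(v * g).coeff j‖ * (C * ρ ^ j))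
    (norm_pos_iff.2 (trace_ne_zero_of_isIdempotentElem hid he0)) fun l => ?_
  rw [← norm_pow, ← norm_mul, mul_comm, ← htr, he, Polynomial.aeval_eq_sum_range, Finset.mul_sum,
    Matrix.trace_sum, Finset.sum_mul]
  refine (norm_sum_le _ _).trans (Finset.sum_le_sum fun j _ => ?_)
  rw [Matrix.mul_smul, ← pow_add, Matrix.trace_smul, norm_smul, mul_assoc, mul_assoc, ← pow_add]
  refine mul_le_mul_of_nonneg_left ?_ (norm_nonneg _)
  have := h (l + j)
  rwa [show l + 1 + j = l + j + 1 by ring, show j + (l + 1) = l + j + 1 by ring]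

end Spectral

section Periodic

theorem prod_range_mul_of_periodic {R : Type*} [CommMonoid R] {f : ℕ → R} {m : ℕ}
    (hf : Function.Periodic f m) (l : ℕ) :
    ∏ k ∈ Finset.range (m * l), f k = (∏ k ∈ Finset.range m, f k) ^ l := by
  induction l with
  | zero => simp
  | succ l ih =>
    rw [Nat.mul_succ, Finset.prod_range_add, ih, pow_succ]
    congr 1
    refine Finset.prod_congr rfl fun k _ => ?_
    have := hf.nat_mul l k
    rw [← this]
    congr 1
    simp
    ring

theorem matProd_mulVec_eigen {S R : Type*} [Fintype S] [DecidableEq S] [CommRing R]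
    {M : ℕ → Matrix S S R} {c : ℕ → R} {w : S → R} (h : ∀ k, (M k).mulVec w = c k • w) (n : ℕ) :
    (matProd M n).mulVec w = (∏ k ∈ Finset.range n, c k) • w := by
  induction n with
  | zero => simp [matProd]
  | succ n ih =>
    rw [matProd, ← Matrix.mulVec_mulVec, ih, Matrix.mulVec_smul, h, smul_smul,
      Finset.prod_range_succ]

theorem matProd_vecMul_eigen {S R : Type*} [Fintype S] [DecidableEq S] [CommRing R]
    {M : ℕ → Matrix S S R} {c : ℕ → R} {w : S → R} (h : ∀ k, Matrix.vecMul w (M k) = c k • w)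
    (n : ℕ) : Matrix.vecMul w (matProd M n) = (∏ k ∈ Finset.range n, c k) • w := by
  induction n with
  | zero => simp [matProd]
  | succ n ih =>
    rw [matProd, ← Matrix.vecMul_vecMul, h, Matrix.smul_vecMul, ih, smul_smul,
      Finset.prod_range_succ, mul_comm]

variable {P : ℕ → Polynomial ℂ} {α : ℕ → ℂ} {m : ℕ}

/-- The cyclic system on `n + 1` sites given by sequences. -/
def CyclicSystem.ofSeq (α : ℕ → ℂ) (hP2 : ∀ k, 2 ≤ (P k).natDegree) (n : ℕ) : CyclicSystem n where
  P k := P k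
  α k := α k
  two_le k := hP2 k

theorem Function.Periodic.comp_ofNat {A : Type*} {f : ℕ → A} {n : ℕ}
    (hf : Function.Periodic f (n + 1)) (k : ℕ) : f (Fin.ofNat (n + 1) k) = f k :=
  hf.map_mod_nat k

theorem CyclicSystem.eval_tr (Q : CyclicSystem n) (z : Fin (n + 1) → ℂ) :
    MvPolynomial.eval z Q.tr = (matProd (fun k =>
      !![(Polynomial.derivative (Q.P (Fin.ofNat (n + 1) k))).eval (z (Fin.ofNat (n + 1) k)),
        Q.α (Fin.ofNat (n + 1) k); 1, 0]) (n + 1)).trace := by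
  rw [tr, AddMonoidHom.map_trace, map_matProd]
  congr 2
  ext k i j
  have h : ∀ g : Polynomial ℂ, MvPolynomial.eval z (Polynomial.aeval
      (MvPolynomial.X (Fin.ofNat (n + 1) k) : MvPolynomial (Fin (n + 1)) ℂ) g) =
        g.eval (z (Fin.ofNat (n + 1) k)) := by
    intro g
    rw [← MvPolynomial.coe_aeval_eq_eval]
    change MvPolynomial.aeval z _ = _
    rw [← Polynomial.aeval_algHom_apply, MvPolynomial.aeval_X, Polynomial.coe_aeval_eq_eval]
  refine (h _).trans ?_
  fin_cases i <;> fin_cases j <;> simp [jacMatrix]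

theorem norm_trace_pow_transfer_le (hP2 : ∀ k, 2 ≤ (P k).natDegree)
    (hP : Function.Periodic P m) (hα : Function.Periodic α m) {l n : ℕ} (hn : n + 1 = m * l)
    (h : ∀ z : Fin (n + 1) → ℂ, (∀ k, z (k + 1) = (P k).eval (z k) + α k * z (k - 1)) →
      ‖MvPolynomial.eval z (CyclicSystem.ofSeq α hP2 n).tr‖ ≤
        1 + ‖∏ k ∈ Finset.range m, -α k‖ ^ l) :
    ‖((matProd (fun k => transferMatrix (P k) (α k)) m) ^ l).trace‖ ≤
      4 * (max 1 ‖∏ k ∈ Finset.range m, -α k‖ *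
        ∏ k ∈ Finset.range m, ((P k).natDegree * ‖(P k).leadingCoeff‖)) ^ l := by
  set Q := CyclicSystem.ofSeq α hP2 n with hQ
  set Δ := ∏ k ∈ Finset.range m, -α k with hΔ
  have hpm : ∀ {A : Type} {f : ℕ → A}, Function.Periodic f m → Function.Periodic f (n + 1) := by
    intro A f hf
    have := hf.nat_mul l
    rw [hn, mul_comm]
    simpa using this
  have h1 := Q.residue_tr_mul_tr
  have h2 : (fun k => transferMatrix (Q.P (Fin.ofNat (n + 1) k)) (Q.α (Fin.ofNat (n + 1) k))) =
      fun k => transferMatrix (P k) (α k) := by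
    funext k
    exact congrArg₂ transferMatrix ((hpm hP).comp_ofNat k) ((hpm hα).comp_ofNat k)
  have hB : matProd (fun k => transferMatrix (P k) (α k)) (n + 1) =
      matProd (fun k => transferMatrix (P k) (α k)) m ^ l := by
    rw [hn, matProd_mul_of_periodic (fun k => by simp only [hP k, hα k])]
  rw [h2, Q.residue_tr_sq, hB] at h1
  rw [← h1]
  have h3 : Q.jac = Δ ^ l := by
    rw [hΔ, ← prod_range_mul_of_periodic (fun k => by simp only [hα k]), ← hn, Finset.prod_range]
    rfl
  have h4 : (∏ k, ((Q.P k).natDegree : ℝ)) * ∏ k, ‖Q.lc k‖ =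
      (∏ k ∈ Finset.range m, ((P k).natDegree * ‖(P k).leadingCoeff‖ : ℝ)) ^ l := by
    rw [← prod_range_mul_of_periodic (fun k => by simp only [hP k]), ← hn, Finset.prod_range,
      ← Finset.prod_mul_distrib]
    rfl
  have h5 := Q.norm_trace_mulLeft_le Q.tr h
  rw [Q.finrank_ring, Nat.cast_prod] at h5
  set K := ∏ k ∈ Finset.range m, ((P k).natDegree * ‖(P k).leadingCoeff‖ : ℝ) with hK
  have hK0 : 0 ≤ K := Finset.prod_nonneg fun k _ => by positivity
  have h6 : (1 + ‖Δ‖ ^ l : ℝ) ≤ 2 * (max 1 ‖Δ‖) ^ l := by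
    have := one_le_pow₀ (n := l) (le_max_left 1 ‖Δ‖)
    have := pow_le_pow_left₀ (norm_nonneg Δ) (le_max_right 1 ‖Δ‖) l
    linarith
  have h7 : ‖(1 + Q.jac) * ∏ k, ((Q.P k).natDegree : ℂ) * Q.lc k‖ ≤ (1 + ‖Δ‖ ^ l) * K ^ l := by
    rw [norm_mul, h3, Finset.prod_mul_distrib, norm_mul, norm_prod, norm_prod]
    simp only [Complex.norm_natCast]
    rw [h4]
    refine mul_le_mul_of_nonneg_right ?_ (by positivity)
    refine (norm_add_le _ _).trans ?_
    rw [norm_one, norm_pow]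
  have h8 : ‖(∏ k, Q.lc k) * LinearMap.trace ℂ Q.Ring (LinearMap.mulLeft ℂ (Q.proj Q.tr))‖ ≤
      (1 + ‖Δ‖ ^ l) * K ^ l := by
    rw [norm_mul, norm_prod, ← h4, mul_comm]
    refine (mul_le_mul_of_nonneg_right h5 (Finset.prod_nonneg fun k _ => norm_nonneg _)).trans ?_
    apply le_of_eq
    ring
  rw [mul_pow]
  refine (norm_add_le _ _).trans ?_
  have := mul_le_mul_of_nonneg_right h6 (pow_nonneg hK0 l)
  linarith

theorem exists_large_trace (hm : 1 ≤ m) (hP2 : ∀ k, 2 ≤ (P k).natDegree)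
    (hP : Function.Periodic P m) (hα : Function.Periodic α m) :
    ∃ n l, n + 1 = m * (l + 1) ∧ ∃ z : Fin (n + 1) → ℂ,
      (∀ k, z (k + 1) = (P k).eval (z k) + α k * z (k - 1)) ∧
      1 + ‖∏ k ∈ Finset.range m, -α k‖ ^ (l + 1) <
        ‖MvPolynomial.eval z (CyclicSystem.ofSeq α hP2 n).tr‖ := by
  by_contra! hcon
  set M := matProd (fun k => transferMatrix (P k) (α k)) m with hM
  set Δ := ∏ k ∈ Finset.range m, -α k with hΔ
  set K := ∏ k ∈ Finset.range m, ((P k).natDegree * ‖(P k).leadingCoeff‖ : ℝ) with hK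
  have hK0 : 0 < K := Finset.prod_pos fun k _ => by
    have h2 := hP2 k
    have : P k ≠ 0 := by
      intro h
      rw [h] at h2
      simp at h2
    have h3 : (0 : ℝ) < (P k).natDegree := by exact_mod_cast (by omega)
    have h4 : 0 < ‖(P k).leadingCoeff‖ := norm_pos_iff.2 (Polynomial.leadingCoeff_ne_zero.2 this)
    positivity
  have hbd : ∀ l : ℕ, ‖(M ^ (l + 1)).trace‖ ≤ 4 * (max 1 ‖Δ‖ * K) ^ (l + 1) := by
    intro l
    have hn : m * (l + 1) - 1 + 1 = m * (l + 1) :=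
      Nat.sub_add_cancel (Nat.mul_pos hm (Nat.succ_pos l))
    exact norm_trace_pow_transfer_le hP2 hP hα hn (hcon _ l hn)
  have hρ : 0 ≤ max 1 ‖Δ‖ * K := by positivity
  set D := ∏ k ∈ Finset.range m, ((P k).natDegree : ℝ) with hD
  have hD2 : 2 ≤ D := by
    obtain ⟨m, rfl⟩ : ∃ k, m = k + 1 := ⟨m - 1, by omega⟩
    rw [hD, Finset.prod_range_succ]
    have h1 : ∀ k, (2 : ℝ) ≤ (P k).natDegree := fun k => by exact_mod_cast hP2 k
    have h2 : (∏ k ∈ Finset.range m, (1 : ℝ)) ≤ ∏ k ∈ Finset.range m, ((P k).natDegree : ℝ) :=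
      Finset.prod_le_prod (fun _ _ => zero_le_one) fun k _ => by linarith [h1 k]
    rw [Finset.prod_const_one] at h2
    have := h1 m
    nlinarith
  have hnorm : ‖∏ k ∈ Finset.range m, ((P k).natDegree : ℂ) ^ 2 * (P k).leadingCoeff‖ = D * K := by
    rw [norm_prod, hD, hK, ← Finset.prod_mul_distrib]
    refine Finset.prod_congr rfl fun k _ => ?_
    rw [norm_mul, norm_pow, Complex.norm_natCast]
    ring
  have hrow : Matrix.vecMul (Pi.single ((0, 0), (1, 0)) 1) M =
      (∏ k ∈ Finset.range m, ((P k).natDegree : ℂ) ^ 2 * (P k).leadingCoeff) •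
        Pi.single ((0, 0), (1, 0)) 1 := by
    refine matProd_vecMul_eigen (fun k => ?_) m
    ext x
    rw [Matrix.single_one_vecMul, Pi.smul_apply, Matrix.row, transferMatrix_row (hP2 k),
      Pi.single_apply]
    split_ifs <;> simp
  have hcol : M.mulVec (Pi.single ((0, 0), (0, 1)) 1) =
      (∏ k ∈ Finset.range m, -α k * (((P k).natDegree : ℂ) ^ 2 * (P k).leadingCoeff)) •
        Pi.single ((0, 0), (0, 1)) 1 := by
    refine matProd_mulVec_eigen (fun k => ?_) m
    ext x
    rw [Matrix.mulVec_single_one, Pi.smul_apply, Matrix.col, Matrix.transpose_apply,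
      transferMatrix_col (hP2 k), Pi.single_apply]
    split_ifs <;> simp
  have h1 := norm_le_of_norm_trace_pow_le (M := M.transpose) hρ
    (fun l => by rw [← Matrix.transpose_pow, Matrix.trace_transpose]; exact hbd l) (by simp)
    ((Matrix.mulVec_transpose _ _).trans hrow)
  have h2 := norm_le_of_norm_trace_pow_le hρ hbd (by simp) hcol
  rw [hnorm] at h1
  rw [Finset.prod_mul_distrib, norm_mul, hnorm] at h2
  rcases le_total ‖Δ‖ 1 with hle | hle
  · rw [max_eq_left hle] at h1
    nlinarith
  · rw [max_eq_right hle] at h2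
    have : 0 < ‖Δ‖ * K := by positivity
    nlinarith

end Periodic

section NonemptyJstar

theorem exists_eigenvectors_of_norm_det_lt_norm_trace {M : Matrix (Fin 2) (Fin 2) ℂ}
    (h : 1 + ‖M.det‖ < ‖M.trace‖) :
    ∃ (v w : Fin 2 → ℂ) (μ ν : ℂ), v ≠ 0 ∧ w ≠ 0 ∧ M.mulVec v = μ • v ∧ M.mulVec w = ν • w ∧
      ‖μ‖ < 1 ∧ 1 < ‖ν‖ := by
  obtain ⟨s, hs⟩ := IsAlgClosed.exists_pow_nat_eq (M.trace ^ 2 - 4 * M.det) (n := 2) (by norm_num)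
  have key : ∀ s : ℂ, s ^ 2 = M.trace ^ 2 - 4 * M.det →
      ∃ v : Fin 2 → ℂ, v ≠ 0 ∧ M.mulVec v = ((M.trace + s) / 2) • v := by
    intro s hs
    have hdet : (M - ((M.trace + s) / 2) • (1 : Matrix (Fin 2) (Fin 2) ℂ)).det = 0 := by
      rw [Matrix.det_fin_two, Matrix.trace_fin_two] at hs
      rw [Matrix.det_fin_two, Matrix.trace_fin_two]
      simp
      linear_combination (1 / 4 : ℂ) * hs
    obtain ⟨v, hv, hv0⟩ := Matrix.exists_mulVec_eq_zero_iff.2 hdet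
    refine ⟨v, hv, ?_⟩
    rwa [Matrix.sub_mulVec, Matrix.smul_mulVec, Matrix.one_mulVec, sub_eq_zero] at hv0
  obtain ⟨v, hv, hv2⟩ := key s hs
  obtain ⟨w, hw, hw2⟩ := key (-s) (by rw [neg_sq, hs])
  set μ := (M.trace + s) / 2 with hμ
  set ν := (M.trace + -s) / 2 with hν
  have ht : M.trace = μ + ν := by rw [hμ, hν]; ring
  have hd : M.det = μ * ν := by rw [hμ, hν]; linear_combination (1 / 4 : ℂ) * hs
  have h1 : 1 + ‖μ‖ * ‖ν‖ < ‖μ‖ + ‖ν‖ := by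
    rw [← norm_mul, ← hd]
    exact h.trans_le (ht ▸ norm_add_le _ _)
  rcases lt_trichotomy ‖μ‖ 1 with hlt | heq | hgt
  · exact ⟨v, w, μ, ν, hv, hw, hv2, hw2, hlt, by nlinarith⟩
  · rw [heq] at h1
    linarith
  · exact ⟨w, v, ν, μ, hw, hv, hw2, hv2, by nlinarith, hgt⟩

/-- The composition `F (k - 1) ∘ ⋯ ∘ F 0`. -/
def compSeq (F : ℕ → ElemHenon) : ℕ → ℂ × ℂ → ℂ × ℂ
  | 0 => id
  | k + 1 => (F k).toFun ∘ compSeq F k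

theorem compSeq_add (F : ℕ → ElemHenon) (j k : ℕ) :
    compSeq F (j + k) = compSeq (fun i => F (j + i)) k ∘ compSeq F j := by
  induction k with
  | zero => rfl
  | succ k ih => rw [← Nat.add_assoc, compSeq, ih]; rfl

theorem compSeq_mul_of_periodic {F : ℕ → ElemHenon} {m : ℕ} (hF : Function.Periodic F m) (l : ℕ) :
    compSeq F (m * l) = (compSeq F m)^[l] := by
  induction l with
  | zero => rfl
  | succ l ih =>
    rw [Nat.mul_succ, Nat.add_comm, compSeq_add, Function.iterate_succ, ← ih]
    congr 2
    funext i
    rw [Nat.add_comm, hF]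

theorem foldr_toFun_eq_compSeq (L : List ElemHenon) (F : ℕ → ElemHenon)
    (hF : ∀ k (hk : k < L.reverse.length), F k = L.reverse[k]) :
    L.foldr (fun h f => h.toFun ∘ f) id = compSeq F L.length := by
  induction L with
  | nil => rfl
  | cons h t ih =>
    rw [List.foldr_cons, List.length_cons, compSeq, ← ih]
    · congr 2
      have := hF t.length (by simp)
      simpa using this.symm
    · intro k hk
      rw [hF k (by simp at hk ⊢; omega)]
      simp only [List.reverse_cons]
      rw [List.getElem_append_left hk]

theorem HenonMap.exists_periodic_compSeq (H : HenonMap) :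
    ∃ (F : ℕ → ElemHenon) (m : ℕ), 1 ≤ m ∧ Function.Periodic F m ∧
      ∀ l, H.toFun^[l] = compSeq F (m * l) := by
  have hm : 0 < H.comps.reverse.length := by
    rw [List.length_reverse]
    exact List.length_pos_iff.2 H.ne
  have hF : Function.Periodic (fun k => H.comps.reverse[k % H.comps.reverse.length]'
    (Nat.mod_lt _ hm)) H.comps.reverse.length := fun k => by simp
  refine ⟨_, _, hm, hF, fun l => ?_⟩
  have h := foldr_toFun_eq_compSeq H.comps (fun k => H.comps.reverse[k % H.comps.reverse.length]'
    (Nat.mod_lt _ hm)) fun k hk => by simp only [Nat.mod_eq_of_lt hk]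
  rw [compSeq_mul_of_periodic hF, HenonMap.toFun, h.trans (congrArg _ List.length_reverse.symm)]

theorem ElemHenon.hasFDerivAt (h : ElemHenon) (p : ℂ × ℂ) :
    HasFDerivAt h.toFun
      (((h.P.derivative.eval p.1 • ContinuousLinearMap.fst ℂ ℂ ℂ +
        h.a • ContinuousLinearMap.snd ℂ ℂ ℂ)).prod (h.b • ContinuousLinearMap.fst ℂ ℂ ℂ)) p := by
  refine HasFDerivAt.prodMk (HasFDerivAt.add ?_ ?_) ?_
  · exact (h.P.hasDerivAt p.1).comp_hasFDerivAt p hasFDerivAt_fst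
  · exact hasFDerivAt_snd.const_mul h.a
  · exact hasFDerivAt_fst.const_mul h.b

theorem differentiable_compSeq (F : ℕ → ElemHenon) (k : ℕ) : Differentiable ℂ (compSeq F k) := by
  induction k with
  | zero => exact differentiable_id
  | succ k ih => exact Differentiable.comp (fun p => ((F k).hasFDerivAt p).differentiableAt) ih

theorem compSeq_eq_of_orbit {F : ℕ → ElemHenon} {p : ℕ → ℂ × ℂ}
    (hp : ∀ k, (F k).toFun (p k) = p (k + 1)) (k : ℕ) : compSeq F k (p 0) = p k := by
  induction k with
  | zero => rfl
  | succ k ih => rw [compSeq, Function.comp_apply, ih, hp]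

theorem fderiv_compSeq {F : ℕ → ElemHenon} {p : ℕ → ℂ × ℂ}
    (hp : ∀ k, (F k).toFun (p k) = p (k + 1)) {c : ℕ → ℂ} (hc : ∀ k, c (k + 1) = (F k).b)
    (w : Fin 2 → ℂ) (k : ℕ) :
    fderiv ℂ (compSeq F k) (p 0) (w 0, c 0 * w 1) =
      ((matProd (fun k => !![(F k).P.derivative.eval (p k).1, (F k).a * c k; 1, 0]) k).mulVec w 0,
        c k *
          (matProd (fun k =>
            !![(F k).P.derivative.eval (p k).1, (F k).a * c k; 1, 0]) k).mulVec w 1)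
      := by
  induction k with
  | zero =>
    rw [compSeq, fderiv_id]
    simp [matProd]
  | succ k ih =>
    rw [compSeq, fderiv_comp _ ((F k).hasFDerivAt _).differentiableAt
      (differentiable_compSeq F k _), ContinuousLinearMap.comp_apply, ih, compSeq_eq_of_orbit hp,
      ((F k).hasFDerivAt _).fderiv, matProd, ← Matrix.mulVec_mulVec, hc]
    simp [Matrix.mulVec, dotProduct, Fin.sum_univ_two]
    ring

theorem HenonMap.exists_isSaddlePeriodic (H : HenonMap) : ∃ p, IsSaddlePeriodic H p := by
  obtain ⟨F, m, hm, hF, hH⟩ := H.exists_periodic_compSeq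
  set c : ℕ → ℂ := fun k => (F (k + (m - 1))).b with hc
  have hcs : ∀ k, c (k + 1) = (F k).b := fun k => by
    have := hF k
    rw [hc]
    simp only
    rw [show k + 1 + (m - 1) = k + m by omega, this]
  obtain ⟨n, l, hn, z, hz, hlt⟩ := exists_large_trace (P := fun k => (F k).P)
    (α := fun k => (F k).a * c k) (m := m) hm (fun k => (F k).hdeg)
    (fun k => by simp only [hF k]) (fun k => by
      simp only [hc, hF k]
      rw [Nat.add_right_comm, hF])
  have hFn : Function.Periodic F (n + 1) := by
    rw [hn, mul_comm]
    simpa using hF.nat_mul (l + 1)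
  have hcn : Function.Periodic c (n + 1) := fun k => by
    simp only [hc]
    rw [Nat.add_right_comm, hFn]
  set y : ℕ → ℂ := fun k => z (Fin.ofNat (n + 1) k) with hy
  have hyp : ∀ k, y (k + (n + 1)) = y k := fun k => by
    simp only [hy]
    congr 1
    ext
    simp
  have hrec : ∀ k, y (k + 1) = (F k).P.eval (y k) + (F k).a * c k * y (k + n) := by
    intro k
    have h1 := hz (Fin.ofNat (n + 1) k)
    have e1 : Fin.ofNat (n + 1) (k + 1) = Fin.ofNat (n + 1) k + 1 := by
      ext
      simp [Fin.val_add]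
    have e2 : Fin.ofNat (n + 1) (k + n) = Fin.ofNat (n + 1) k - 1 := by
      rw [eq_sub_iff_add_eq]
      ext
      simp [Fin.val_add, add_assoc]
    simp only [hy, e1, e2]
    rw [h1]
    simp only [hFn.comp_ofNat, hcn.comp_ofNat]
  set p : ℕ → ℂ × ℂ := fun k => (y k, c k * y (k + n)) with hp
  have hpF : ∀ k, (F k).toFun (p k) = p (k + 1) := by
    intro k
    simp only [hp, ElemHenon.toFun]
    rw [hrec, hcs, show k + 1 + n = k + (n + 1) by ring, hyp]
    ring_nf
  have htr : MvPolynomial.eval z (CyclicSystem.ofSeq (fun k => (F k).a * c k)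
      (fun k => (F k).hdeg) n).tr =
      (matProd (fun k => !![(F k).P.derivative.eval (p k).1, (F k).a * c k; 1, 0]) (n + 1)).trace
      := by
    rw [CyclicSystem.eval_tr]
    congr 2
    funext k
    simp only [CyclicSystem.ofSeq, hFn.comp_ofNat, hcn.comp_ofNat, hp, hy]
  have hdet : (matProd (fun k =>
      !![(F k).P.derivative.eval (p k).1, (F k).a * c k; 1, 0]) (n + 1)).det =
      (∏ k ∈ Finset.range m, -((F k).a * c k)) ^ (l + 1) := by
    rw [det_matProd, ← prod_range_mul_of_periodic (fun k => by
      simp only [hc, hF k]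
      rw [Nat.add_right_comm, hF]), ← hn]
    simp [Matrix.det_fin_two]
  rw [htr, ← norm_pow, ← hdet] at hlt
  obtain ⟨v, w, μ, ν, hv, hw, hμ, hν, hμ1, hν1⟩ :=
    exists_eigenvectors_of_norm_det_lt_norm_trace hlt
  have hc0 : c 0 ≠ 0 := (F _).hb
  have hcN : c (n + 1) = c 0 := by simpa using hcn 0
  have hne : ∀ v : Fin 2 → ℂ, v ≠ 0 → (v 0, c 0 * v 1) ≠ (0 : ℂ × ℂ) := by
    intro v hv h
    apply hv
    rw [Prod.mk_eq_zero, mul_eq_zero] at h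
    ext i
    fin_cases i
    · exact h.1
    · exact h.2.resolve_left hc0
  refine ⟨p 0, l + 1, by omega, ?_, (v 0, c 0 * v 1), (w 0, c 0 * w 1), μ, ν, hne v hv, hne w hw,
    ?_, ?_, hμ1, hν1⟩
  · rw [hH, ← hn, compSeq_eq_of_orbit hpF]
    simp only [hp]
    rw [hcN]
    have h0 := hyp 0
    have h1 := hyp n
    rw [zero_add] at h0
    rw [h0, add_comm (n + 1) n, h1, zero_add]
  · rw [hH, ← hn, fderiv_compSeq hpF hcs, hμ, hcN]
    simp
    ring
  · rw [hH, ← hn, fderiv_compSeq hpF hcs, hν, hcN]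
    simp
    ring

theorem HenonMap.nonempty_Jstar (H : HenonMap) : (Jstar H).Nonempty := by
  obtain ⟨p, hp⟩ := H.exists_isSaddlePeriodic
  exact ⟨p, subset_closure hp⟩

end NonemptyJstar

section Hyperbolic

variable {E : Type*} [NormedAddCommGroup E] [NormedSpace ℂ E]

/-- A compact set `Λ`, invariant under the diffeomorphism `g` with inverse `h`, together with
continuous families of complementary invariant projections `S`, `U` such that `g` contracts the
range of `S` and `h` contracts the range of `U` by a definite factor. -/
structure HyperbolicSplitting (Λ : Set E) (g h : E → E) (S U : E → E →L[ℂ] E) : Prop where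
  isCompact : IsCompact Λ
  contDiff_fwd : ContDiff ℂ 1 g
  contDiff_bwd : ContDiff ℂ 1 h
  left_inv : ∀ x, h (g x) = x
  right_inv : ∀ x, g (h x) = x
  mapsTo_fwd : MapsTo g Λ Λ
  mapsTo_bwd : MapsTo h Λ Λ
  continuousOn_S : ContinuousOn S Λ
  continuousOn_U : ContinuousOn U Λ
  add : ∀ x ∈ Λ, ∀ v, S x v + U x v = v
  S_U : ∀ x ∈ Λ, ∀ v, S x (U x v) = 0
  U_S : ∀ x ∈ Λ, ∀ v, U x (S x v) = 0
  comm_S : ∀ x ∈ Λ, ∀ v, S (g x) (fderiv ℂ g x v) = fderiv ℂ g x (S x v)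
  comm_U : ∀ x ∈ Λ, ∀ v, U (g x) (fderiv ℂ g x v) = fderiv ℂ g x (U x v)
  contr_S : ∀ x ∈ Λ, ∀ v, ‖fderiv ℂ g x (S x v)‖ ≤ 1 / 8 * ‖v‖
  contr_U : ∀ x ∈ Λ, ∀ v, ‖fderiv ℂ h x (U x v)‖ ≤ 1 / 8 * ‖v‖
  exists_S : ∀ x ∈ Λ, ∃ v ≠ 0, U x v = 0
  exists_U : ∀ x ∈ Λ, ∃ v ≠ 0, S x v = 0

theorem fderiv_fderiv_of_inverse {g h : E → E} (hg : ContDiff ℂ 1 g) (hh : ContDiff ℂ 1 h)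
    (hgh : ∀ x, g (h x) = x) (x v : E) : fderiv ℂ g (h x) (fderiv ℂ h x v) = v := by
  have h1 : g ∘ h = id := funext hgh
  have h2 := fderiv_comp x (hg.differentiable one_ne_zero (h x)) (hh.differentiable one_ne_zero x)
  rw [h1, fderiv_id] at h2
  exact (congrArg (fun L : E →L[ℂ] E => L v) h2).symm

/-- The derivative of `k`, seen through an invariant family `T` of projections, varies little. -/
theorem exists_norm_comp_fderiv_sub_le {Λ : Set E} (hΛ : IsCompact Λ) {k : E → E}
    (hk : ContDiff ℂ 1 k) (hkΛ : MapsTo k Λ Λ) {T : E → E →L[ℂ] E} (hT : ContinuousOn T Λ)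
    (hcomm : ∀ x ∈ Λ, ∀ v, T (k x) (fderiv ℂ k x v) = fderiv ℂ k x (T x v)) {ε : ℝ} (hε : 0 < ε) :
    ∃ r > 0, ∀ x ∈ Λ, ∀ y ∈ Λ, ∀ a, dist x (k y) < r → dist a y < r →
      ‖(T x).comp (fderiv ℂ k a) - (fderiv ℂ k y).comp (T y)‖ ≤ ε := by
  have hfd : Continuous (fderiv ℂ k) := hk.continuous_fderiv one_ne_zero
  set φ : E × E × E → (E →L[ℂ] E) := fun q =>
    (T q.1).comp (fderiv ℂ k q.2.2) - (fderiv ℂ k q.2.1).comp (T q.2.1) with hφ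
  have hcont : ContinuousOn φ (Λ ×ˢ Λ ×ˢ univ) := by
    refine ContinuousOn.sub (ContinuousOn.clm_comp ?_ ?_) (ContinuousOn.clm_comp ?_ ?_)
    · exact hT.comp continuousOn_fst fun q hq => hq.1
    · exact (hfd.comp (continuous_snd.comp continuous_snd)).continuousOn
    · exact (hfd.comp (continuous_fst.comp continuous_snd)).continuousOn
    · exact hT.comp (continuous_fst.comp continuous_snd).continuousOn fun q hq => hq.2.1
  obtain ⟨W, hW, hWφ⟩ := (_root_.continuousOn_iff'.1 hcont) (ball 0 ε) isOpen_ball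
  have hC : IsCompact ((fun y => (k y, y, y)) '' Λ) :=
    hΛ.image (by have := hk.continuous; fun_prop)
  have hCW : (fun y => (k y, y, y)) '' Λ ⊆ W := by
    rintro _ ⟨y, hy, rfl⟩
    have : (k y, y, y) ∈ φ ⁻¹' ball 0 ε ∩ Λ ×ˢ Λ ×ˢ univ := by
      refine ⟨?_, hkΛ hy, hy, mem_univ _⟩
      have h0 : φ (k y, y, y) = 0 := by
        ext v
        simp [hφ, hcomm y hy v]
      rw [mem_preimage, h0]
      exact mem_ball_self hε
    rw [hWφ] at this
    exact this.1
  obtain ⟨r, hr, hrW⟩ := hC.exists_thickening_subset_open hW hCW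
  refine ⟨r, hr, fun x hx y hy a hxy hay => ?_⟩
  have hmem : (x, y, a) ∈ W := by
    refine hrW (mem_thickening_iff.2 ⟨_, mem_image_of_mem _ hy, ?_⟩)
    rw [Prod.dist_eq, Prod.dist_eq, dist_self]
    exact max_lt hxy (max_lt hr hay)
  have : (x, y, a) ∈ φ ⁻¹' ball 0 ε ∩ Λ ×ˢ Λ ×ˢ univ := by
    rw [hWφ]
    exact ⟨hmem, hx, hy, mem_univ _⟩
  have h2 := this.1
  rw [mem_preimage, mem_ball_zero_iff] at h2
  exact h2.le

theorem exists_norm_comp_sub_le {Λ : Set E} (hΛ : IsCompact Λ) {k : E → E}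
    (hk : ContDiff ℂ 1 k) (hkΛ : MapsTo k Λ Λ) {T : E → E →L[ℂ] E} (hT : ContinuousOn T Λ)
    (hcomm : ∀ x ∈ Λ, ∀ v, T (k x) (fderiv ℂ k x v) = fderiv ℂ k x (T x v)) {ε : ℝ} (hε : 0 < ε) :
    ∃ r > 0, ∀ x ∈ Λ, ∀ y ∈ Λ, dist x (k y) < r →
      (∀ a, dist a y < r → ∀ v,
        ‖T x (fderiv ℂ k a v) - fderiv ℂ k y (T y v)‖ ≤ ε * ‖v‖) ∧
      ∀ a b, dist a y < r → dist b y < r →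
        ‖T x (k a - k b) - fderiv ℂ k y (T y (a - b))‖ ≤ ε * ‖a - b‖ := by
  obtain ⟨r, hr, h⟩ := exists_norm_comp_fderiv_sub_le hΛ hk hkΛ hT hcomm hε
  refine ⟨r, hr, fun x hx y hy hxy => ⟨fun a ha v => ?_, fun a b ha hb => ?_⟩⟩
  · exact ContinuousLinearMap.le_of_opNorm_le _ (h x hx y hy a hxy ha) v
  · have hf : ∀ c ∈ ball y r, HasFDerivWithinAt (fun c => T x (k c))
        ((T x).comp (fderiv ℂ k c)) (ball y r) c := fun c _ =>
      ((T x).hasFDerivAt.comp c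
        (hk.differentiable one_ne_zero c).hasFDerivAt).hasFDerivWithinAt
    have := Convex.norm_image_sub_le_of_norm_hasFDerivWithin_le' hf
      (fun c hc => h x hx y hy c hxy hc) (convex_ball y r) hb ha
    simpa only [map_sub, ContinuousLinearMap.comp_apply] using this

namespace HyperbolicSplitting

variable {Λ : Set E} {g h : E → E} {S U : E → E →L[ℂ] E}

theorem symm (H : HyperbolicSplitting Λ g h S U) : HyperbolicSplitting Λ h g U S where
  isCompact := H.isCompact
  contDiff_fwd := H.contDiff_bwd
  contDiff_bwd := H.contDiff_fwd
  left_inv := H.right_inv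
  right_inv := H.left_inv
  mapsTo_fwd := H.mapsTo_bwd
  mapsTo_bwd := H.mapsTo_fwd
  continuousOn_S := H.continuousOn_U
  continuousOn_U := H.continuousOn_S
  add x hx v := by rw [add_comm, H.add x hx]
  S_U := H.U_S
  U_S := H.S_U
  comm_S x hx v := by
    have h1 := H.comm_U (h x) (H.mapsTo_bwd hx) (fderiv ℂ h x v)
    rw [H.right_inv, fderiv_fderiv_of_inverse H.contDiff_fwd H.contDiff_bwd H.right_inv] at h1
    have h2 := fderiv_fderiv_of_inverse H.contDiff_bwd H.contDiff_fwd H.left_inv (h x)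
      (U (h x) (fderiv ℂ h x v))
    rw [← h1, H.right_inv] at h2
    exact h2.symm
  comm_U x hx v := by
    have h1 := H.comm_S (h x) (H.mapsTo_bwd hx) (fderiv ℂ h x v)
    rw [H.right_inv, fderiv_fderiv_of_inverse H.contDiff_fwd H.contDiff_bwd H.right_inv] at h1
    have h2 := fderiv_fderiv_of_inverse H.contDiff_bwd H.contDiff_fwd H.left_inv (h x)
      (S (h x) (fderiv ℂ h x v))
    rw [← h1, H.right_inv] at h2
    exact h2.symm
  contr_S := H.contr_U
  contr_U := H.contr_S
  exists_S := H.exists_U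
  exists_U := H.exists_S

theorem S_S (H : HyperbolicSplitting Λ g h S U) {x : E} (hx : x ∈ Λ) (v : E) :
    S x (S x v) = S x v := by
  have := H.add x hx (S x v)
  rwa [H.U_S x hx, add_zero] at this

theorem U_U (H : HyperbolicSplitting Λ g h S U) {x : E} (hx : x ∈ Λ) (v : E) :
    U x (U x v) = U x v := H.symm.S_S hx v

theorem norm_le (H : HyperbolicSplitting Λ g h S U) {x : E} (hx : x ∈ Λ) (v : E) :
    ‖v‖ ≤ ‖S x v‖ + ‖U x v‖ := by
  conv_lhs => rw [← H.add x hx v]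
  exact norm_add_le _ _

theorem norm_fderiv_S_le (H : HyperbolicSplitting Λ g h S U) {x : E} (hx : x ∈ Λ) (v : E) :
    ‖fderiv ℂ g x (S x v)‖ ≤ 1 / 8 * ‖S x v‖ := by
  have := H.contr_S x hx (S x v)
  rwa [H.S_S hx] at this

theorem le_norm_fderiv_U (H : HyperbolicSplitting Λ g h S U) {x : E} (hx : x ∈ Λ) (v : E) :
    8 * ‖U x v‖ ≤ ‖fderiv ℂ g x (U x v)‖ := by
  have h1 := H.contr_U (g x) (H.mapsTo_fwd hx) (fderiv ℂ g x (U x v))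
  rw [H.comm_U x hx, H.U_U hx] at h1
  have h2 := fderiv_fderiv_of_inverse H.contDiff_bwd H.contDiff_fwd H.left_inv x (U x v)
  rw [h2] at h1
  linarith

/-- Near `Λ`, both `g` and its derivative contract the stable component and expand the
unstable component. -/
theorem exists_cone (H : HyperbolicSplitting Λ g h S U) :
    ∃ r > 0, ∀ x ∈ Λ, ∀ y ∈ Λ, dist x (g y) < r →
      (∀ a, dist a y < r → ∀ v,
        ‖S x (fderiv ℂ g a v)‖ ≤ 1 / 4 * (‖S y v‖ + ‖U y v‖) ∧
        8 * ‖U y v‖ - (‖S y v‖ + ‖U y v‖) ≤ ‖U x (fderiv ℂ g a v)‖) ∧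
      ∀ a b, dist a y < r → dist b y < r →
        ‖S x (g a - g b)‖ ≤ 1 / 4 * (‖S y (a - b)‖ + ‖U y (a - b)‖) ∧
        8 * ‖U y (a - b)‖ - (‖S y (a - b)‖ + ‖U y (a - b)‖) ≤ ‖U x (g a - g b)‖ := by
  obtain ⟨r₁, hr₁, h₁⟩ := exists_norm_comp_sub_le H.isCompact H.contDiff_fwd H.mapsTo_fwd
    H.continuousOn_S H.comm_S (ε := 1 / 8) (by norm_num)
  obtain ⟨r₂, hr₂, h₂⟩ := exists_norm_comp_sub_le H.isCompact H.contDiff_fwd H.mapsTo_fwd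
    H.continuousOn_U H.comm_U (ε := 1 / 8) (by norm_num)
  have key : ∀ x ∈ Λ, ∀ y ∈ Λ, ∀ v w : E, ‖S x w - fderiv ℂ g y (S y v)‖ ≤ 1 / 8 * ‖v‖ →
      ‖U x w - fderiv ℂ g y (U y v)‖ ≤ 1 / 8 * ‖v‖ →
      ‖S x w‖ ≤ 1 / 4 * (‖S y v‖ + ‖U y v‖) ∧
        8 * ‖U y v‖ - (‖S y v‖ + ‖U y v‖) ≤ ‖U x w‖ := by
    intro x hx y hy v w hs hu
    have h1 := H.norm_le hy v
    have h2 := H.norm_fderiv_S_le hy v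
    have h3 := H.le_norm_fderiv_U hy v
    have h4 := norm_sub_norm_le (S x w) (fderiv ℂ g y (S y v))
    have h5 := norm_sub_norm_le (fderiv ℂ g y (U y v)) (U x w)
    rw [norm_sub_rev] at h5
    have h6 := norm_nonneg (U y v)
    have h7 := norm_nonneg (S y v)
    constructor <;> linarith
  refine ⟨min r₁ r₂, lt_min hr₁ hr₂, fun x hx y hy hxy => ?_⟩
  rw [lt_min_iff] at hxy
  obtain ⟨h₁d, h₁f⟩ := h₁ x hx y hy hxy.1
  obtain ⟨h₂d, h₂f⟩ := h₂ x hx y hy hxy.2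
  refine ⟨fun a ha v => ?_, fun a b ha hb => ?_⟩
  · rw [lt_min_iff] at ha
    exact key x hx y hy v _ (h₁d a ha.1 v) (h₂d a ha.2 v)
  · rw [lt_min_iff] at ha hb
    exact key x hx y hy _ _ (h₁f a b ha.1 hb.1) (h₂f a b ha.2 hb.2)

theorem exists_bound (H : HyperbolicSplitting Λ g h S U) :
    ∃ C > 0, ∀ x ∈ Λ, ∀ v, ‖S x v‖ ≤ C * ‖v‖ ∧ ‖U x v‖ ≤ C * ‖v‖ := by
  obtain ⟨A, hA⟩ := H.isCompact.exists_bound_of_continuousOn H.continuousOn_S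
  obtain ⟨B, hB⟩ := H.isCompact.exists_bound_of_continuousOn H.continuousOn_U
  refine ⟨max 1 (max A B), by positivity, fun x hx v => ⟨?_, ?_⟩⟩
  · exact ContinuousLinearMap.le_of_opNorm_le _ ((hA x hx).trans (by simp)) v
  · exact ContinuousLinearMap.le_of_opNorm_le _ ((hB x hx).trans (by simp)) v

/-- Two points near `Λ` which differ in the unstable direction only, and whose preimages
differ in the stable direction only, coincide. -/
theorem exists_eq_of_S_eq_zero (H : HyperbolicSplitting Λ g h S U) :
    ∃ r > 0, ∀ x ∈ Λ, ∀ y ∈ Λ, dist x (h y) < r → ∀ a b, dist a y < r → dist b y < r →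
      S y (a - b) = 0 → U x (h a - h b) = 0 → a = b := by
  obtain ⟨A, hA⟩ := H.isCompact.exists_bound_of_continuousOn
    (H.contDiff_fwd.continuous_fderiv one_ne_zero).continuousOn
  set c := max A 1 with hc
  have hc0 : 0 < c := by positivity
  obtain ⟨r, hr, hlem⟩ := exists_norm_comp_sub_le H.isCompact H.contDiff_bwd H.mapsTo_bwd
    H.continuousOn_U H.symm.comm_S (ε := 1 / (2 * c)) (by positivity)
  refine ⟨r, hr, fun x hx y hy hxy a b ha hb hS hU => ?_⟩
  have h1 := (hlem x hx y hy hxy).2 a b ha hb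
  have h2 := H.add y hy (a - b)
  rw [hS, zero_add] at h2
  rw [hU, zero_sub, norm_neg, h2] at h1
  have h3 := fderiv_fderiv_of_inverse H.contDiff_fwd H.contDiff_bwd H.right_inv y (a - b)
  have h4 := ContinuousLinearMap.le_of_opNorm_le _
    ((hA (h y) (H.mapsTo_bwd hy)).trans (le_max_left A 1)) (fderiv ℂ h y (a - b))
  rw [h3] at h4
  have h5 : c * ‖fderiv ℂ h y (a - b)‖ ≤ 1 / 2 * ‖a - b‖ := by
    refine (mul_le_mul_of_nonneg_left h1 hc0.le).trans (le_of_eq ?_)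
    field_simp
  have h6 : ‖a - b‖ ≤ 0 := by linarith
  exact sub_eq_zero.1 (norm_le_zero_iff.1 h6)

end HyperbolicSplitting

end Hyperbolic

section Closing

variable {E : Type*} [NormedAddCommGroup E] [NormedSpace ℂ E]

theorem IsCompact.exists_dist_lt_of_continuous {X Y : Type*} [PseudoMetricSpace X]
    [PseudoMetricSpace Y] {K : Set X} (hK : IsCompact K) {k : X → Y} (hk : Continuous k) {ε : ℝ}
    (hε : 0 < ε) : ∃ δ > 0, ∀ x ∈ K, ∀ a, dist a x < δ → dist (k a) (k x) < ε := by
  obtain ⟨δ, hδ, h⟩ := Metric.mem_uniformity_dist.1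
    (hK.uniformContinuousAt_of_continuousAt k (fun a _ => hk.continuousAt)
      (Metric.dist_mem_uniformity hε))
  refine ⟨δ, hδ, fun x hx a ha => ?_⟩
  rw [dist_comm] at ha ⊢
  exact h ha hx

namespace HyperbolicSplitting

variable {Λ : Set E} {g h : E → E} {S U : E → E →L[ℂ] E}

theorem exists_norm_S_sub_le (H : HyperbolicSplitting Λ g h S U) :
    ∃ r > 0, ∀ x ∈ Λ, ∀ y ∈ Λ, dist x (g y) < r → ∀ a b, dist a y < r → dist b y < r →
      ‖S x (g a - g b)‖ ≤ 1 / 4 * ‖a - b‖ := by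
  obtain ⟨r, hr, hlem⟩ := exists_norm_comp_sub_le H.isCompact H.contDiff_fwd H.mapsTo_fwd
    H.continuousOn_S H.comm_S (ε := 1 / 8) (by norm_num)
  refine ⟨r, hr, fun x hx y hy hxy a b ha hb => ?_⟩
  have h1 := (hlem x hx y hy hxy).2 a b ha hb
  have h2 := H.contr_S y hy (a - b)
  have h3 := norm_sub_norm_le (S x (g a - g b)) (fderiv ℂ g y (S y (a - b)))
  linarith

/-- Closed pseudo-orbits in `Λ` are shadowed by periodic orbits. -/
theorem exists_cyclic_orbit [CompleteSpace E] (H : HyperbolicSplitting Λ g h S U) {ε : ℝ}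
    (hε : 0 < ε) :
    ∃ δ > 0, ∀ (n : ℕ) [NeZero n] (w : ZMod n → E), (∀ i, w i ∈ Λ) →
      (∀ i, dist (w (i + 1)) (g (w i)) < δ) →
        ∃ z : ZMod n → E, ∀ i, g (z i) = z (i + 1) ∧ dist (z i) (w i) ≤ ε := by
  obtain ⟨r₁, hr₁, hS⟩ := H.exists_norm_S_sub_le
  obtain ⟨r₂, hr₂, hU⟩ := H.symm.exists_norm_S_sub_le
  obtain ⟨r₃, hr₃, heq⟩ := H.exists_eq_of_S_eq_zero
  obtain ⟨C, hC, hbd⟩ := H.exists_bound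
  obtain ⟨r₄, hr₄, hg⟩ := H.isCompact.exists_dist_lt_of_continuous H.contDiff_fwd.continuous
    (half_pos hr₃)
  set m := min (min r₁ r₂) (min r₃ r₄) with hm
  have hm0 : 0 < m := by positivity
  have hm1 : m ≤ r₁ := (min_le_left _ _).trans (min_le_left _ _)
  have hm2 : m ≤ r₂ := (min_le_left _ _).trans (min_le_right _ _)
  have hm3 : m ≤ r₃ := (min_le_right _ _).trans (min_le_left _ _)
  have hm4 : m ≤ r₄ := (min_le_right _ _).trans (min_le_right _ _)
  set ρ := min ε (m / 2) with hρ
  have hρ0 : 0 < ρ := by positivity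
  have hρm : ρ < m := (min_le_right _ _).trans_lt (by linarith)
  set η := min (m / 2) (ρ / (8 * C)) with hη
  have hη0 : 0 < η := by positivity
  have hηm : η < m := (min_le_left _ _).trans_lt (by linarith)
  have hηm2 : η ≤ m / 2 := min_le_left _ _
  have hηC : C * η ≤ ρ / 8 := by
    have : η ≤ ρ / (8 * C) := min_le_right _ _
    rw [le_div_iff₀ (by positivity)] at this
    linarith
  obtain ⟨r₅, hr₅, hh⟩ := H.isCompact.exists_dist_lt_of_continuous H.contDiff_bwd.continuous hη0
  refine ⟨min η r₅, lt_min hη0 hr₅, fun n _ w hw hd => ?_⟩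
  have hd1 : ∀ i, dist (w (i + 1)) (g (w i)) < η := fun i => (hd i).trans_le (min_le_left _ _)
  have hd2 : ∀ i, dist (w i) (h (w (i + 1))) < η := fun i => by
    have := hh (g (w i)) (H.mapsTo_fwd (hw i)) (w (i + 1)) ((hd i).trans_le (min_le_right _ _))
    rwa [H.left_inv, dist_comm] at this
  have hd1' : ∀ i, dist (w i) (g (w (i - 1))) < η := fun i => by
    simpa using hd1 (i - 1)
  set Ψ : (ZMod n → E) → ZMod n → E := fun z i =>
    w i + (S (w i) (g (z (i - 1)) - w i) + U (w i) (h (z (i + 1)) - w i)) with hΨ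
  have hball : ∀ z ∈ closedBall w ρ, ∀ i, dist (z i) (w i) < m := fun z hz i =>
    ((dist_le_pi_dist z w i).trans (mem_closedBall.1 hz)).trans_lt hρm
  have hlip : ∀ z ∈ closedBall w ρ, ∀ z' ∈ closedBall w ρ,
      dist (Ψ z) (Ψ z') ≤ 1 / 2 * dist z z' := by
    intro z hz z' hz'
    refine (dist_pi_le_iff (by positivity)).2 fun i => ?_
    have e : Ψ z i - Ψ z' i = S (w i) (g (z (i - 1)) - g (z' (i - 1))) +
        U (w i) (h (z (i + 1)) - h (z' (i + 1))) := by
      simp only [hΨ, map_sub]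
      abel
    rw [dist_eq_norm, e]
    have h1 := hS (w i) (hw i) (w (i - 1)) (hw _) ((hd1' i).trans (hηm.trans_le hm1))
      (z (i - 1)) (z' (i - 1)) ((hball z hz _).trans_le hm1) ((hball z' hz' _).trans_le hm1)
    have h2 := hU (w i) (hw i) (w (i + 1)) (hw _) ((hd2 i).trans (hηm.trans_le hm2))
      (z (i + 1)) (z' (i + 1)) ((hball z hz _).trans_le hm2) ((hball z' hz' _).trans_le hm2)
    rw [← dist_eq_norm] at h1 h2
    have h3 := dist_le_pi_dist z z' (i - 1)
    have h4 := dist_le_pi_dist z z' (i + 1)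
    refine (norm_add_le _ _).trans ?_
    linarith
  have hw0 : dist (Ψ w) w ≤ ρ / 2 := by
    refine (dist_pi_le_iff (by positivity)).2 fun i => ?_
    rw [dist_eq_norm, show Ψ w i - w i = S (w i) (g (w (i - 1)) - w i) +
      U (w i) (h (w (i + 1)) - w i) by simp only [hΨ]; abel]
    have h1 := (hbd (w i) (hw i) (g (w (i - 1)) - w i)).1
    have h2 := (hbd (w i) (hw i) (h (w (i + 1)) - w i)).2
    have h3 := hd1' i
    have h4 := hd2 i
    rw [← dist_eq_norm, dist_comm] at h1 h2
    have h5 := mul_le_mul_of_nonneg_left h3.le hC.le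
    have h6 := mul_le_mul_of_nonneg_left h4.le hC.le
    refine (norm_add_le _ _).trans ?_
    linarith
  have hmaps : MapsTo Ψ (closedBall w ρ) (closedBall w ρ) := by
    intro z hz
    have h1 := hlip z hz w (mem_closedBall_self hρ0.le)
    have h2 := dist_triangle (Ψ z) (Ψ w) w
    rw [mem_closedBall] at hz ⊢
    linarith
  have hcontr : ContractingWith (1 / 2) (hmaps.restrict Ψ _ _) := by
    refine ⟨by rw [← NNReal.coe_lt_coe]; norm_num, LipschitzWith.of_dist_le_mul fun z z' => ?_⟩
    rw [Subtype.dist_eq, Subtype.dist_eq]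
    simpa using hlip z z.2 z' z'.2
  obtain ⟨z, hz, hfix, -⟩ := hcontr.exists_fixedPoint' isClosed_closedBall.isComplete hmaps
    (mem_closedBall_self hρ0.le) (edist_ne_top _ _)
  have hfi : ∀ i, z i - w i = S (w i) (g (z (i - 1)) - w i) + U (w i) (h (z (i + 1)) - w i) := by
    intro i
    have := congrFun hfix i
    rw [sub_eq_iff_eq_add, add_comm]
    exact this.symm
  have hfS : ∀ i, S (w i) (z i - g (z (i - 1))) = 0 := by
    intro i
    have := congrArg (S (w i)) (hfi i)
    rw [map_add, H.S_S (hw i), H.S_U _ (hw i), add_zero] at this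
    rw [← sub_sub_sub_cancel_right _ _ (w i), map_sub, this, sub_self]
  have hfU : ∀ i, U (w i) (z i - h (z (i + 1))) = 0 := by
    intro i
    have := congrArg (U (w i)) (hfi i)
    rw [map_add, H.U_U (hw i), H.U_S _ (hw i), zero_add] at this
    rw [← sub_sub_sub_cancel_right _ _ (w i), map_sub, this, sub_self]
  refine ⟨z, fun i => ⟨(heq (w i) (hw i) (w (i + 1)) (hw _) ((hd2 i).trans (hηm.trans_le hm3))
    (z (i + 1)) (g (z i)) ((hball z hz _).trans_le hm3) ?_ ?_ ?_).symm, ?_⟩⟩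
  · have h1 := hg (w i) (hw i) (z i) ((hball z hz i).trans_le hm4)
    have h2 := hd1 i
    have h3 := dist_triangle_right (g (z i)) (w (i + 1)) (g (w i))
    linarith
  · have := hfS (i + 1)
    rwa [add_sub_cancel_right] at this
  · rw [H.left_inv, ← neg_sub, map_neg, hfU, neg_zero]
  · exact ((dist_le_pi_dist z w i).trans (mem_closedBall.1 hz)).trans (min_le_left _ _)

end HyperbolicSplitting

end Closing

section SaddleEigenvalue

variable {E : Type*} [NormedAddCommGroup E] [NormedSpace ℂ E]

theorem exists_eigenvalue_of_two_pow_le [FiniteDimensional ℂ E] {L : E →L[ℂ] E} {v : E}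
    (hv : v ≠ 0) {C : ℝ} (h : ∀ l, 2 ^ l * ‖v‖ ≤ C * ‖(L ^ l) v‖) :
    ∃ w ≠ 0, ∃ μ : ℂ, 1 < ‖μ‖ ∧ L w = μ • w := by
  have : CompleteSpace E := FiniteDimensional.complete ℂ E
  have : Nontrivial E := ⟨v, 0, hv⟩
  have hv0 : 0 < ‖v‖ := norm_pos_iff.2 hv
  have hC : 0 < C := by
    have := h 0
    simp only [pow_zero, one_mul, one_apply_eq_self] at this
    nlinarith
  obtain ⟨μ, hμ, hμ1⟩ : ∃ μ ∈ spectrum ℂ L, 1 < ‖μ‖ := by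
    by_contra! hcon
    have h1 : spectralRadius ℂ L < ((3 / 2 : NNReal) : ENNReal) := by
      refine spectrum.spectralRadius_lt_of_forall_lt L fun z hz => ?_
      rw [← NNReal.coe_lt_coe]
      have := hcon z hz
      push_cast
      linarith
    have h2 := (spectrum.pow_nnnorm_pow_one_div_tendsto_nhds_spectralRadius L).eventually
      (gt_mem_nhds h1)
    have h3 : Tendsto (fun l : ℕ => (4 / 3 : ℝ) ^ l) atTop atTop :=
      tendsto_pow_atTop_atTop_of_one_lt (by norm_num)
    obtain ⟨l, ⟨hl1, hl2⟩, hl0⟩ :=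
      ((h2.and (h3.eventually_gt_atTop C)).and (eventually_gt_atTop 0)).exists
    have h4 : ‖L ^ l‖ ≤ (3 / 2) ^ l := by
      have h5 : (‖L ^ l‖₊ : ENNReal) ≤ ((3 / 2 : NNReal) : ENNReal) ^ (l : ℝ) :=
        (ENNReal.rpow_inv_le_iff (by exact_mod_cast hl0)).1 (by simpa only [one_div] using hl1.le)
      rw [ENNReal.rpow_natCast] at h5
      have h6 : ‖L ^ l‖₊ ≤ (3 / 2 : NNReal) ^ l := by exact_mod_cast h5
      exact_mod_cast h6
    have h7 := (L ^ l).le_of_opNorm_le h4 v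
    have h8 : 2 ^ l * ‖v‖ ≤ C * ((3 / 2) ^ l * ‖v‖) :=
      (h l).trans (mul_le_mul_of_nonneg_left h7 hC.le)
    have h9 : (2 : ℝ) ^ l ≤ C * (3 / 2) ^ l := by
      rw [← mul_assoc] at h8
      exact le_of_mul_le_mul_right h8 hv0
    have h10 : (2 : ℝ) ^ l = (4 / 3) ^ l * (3 / 2) ^ l := by
      rw [← mul_pow]
      norm_num
    rw [h10] at h9
    exact absurd (le_of_mul_le_mul_right h9 (by positivity)) (not_le.2 hl2)
  have h1 : μ ∈ spectrum ℂ ((Module.End.toContinuousLinearMap E).symm L) := by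
    rwa [AlgEquiv.spectrum_eq]
  obtain ⟨w, hw⟩ := (Module.End.hasEigenvalue_iff_mem_spectrum.2 h1).exists_hasEigenvector
  exact ⟨w, hw.2, μ, hμ1, hw.apply_eq_smul⟩

namespace HyperbolicSplitting

variable {Λ : Set E} {g h : E → E} {S U : E → E →L[ℂ] E}

theorem exists_eigenvalue_of_cyclic_orbit [FiniteDimensional ℂ E]
    (H : HyperbolicSplitting Λ g h S U) :
    ∃ r > 0, ∀ (n : ℕ) [NeZero n] (z w : ZMod n → E), (∀ i, w i ∈ Λ) →
      (∀ i, g (z i) = z (i + 1)) → (∀ i, dist (w (i + 1)) (g (w i)) < r) →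
        (∀ i, dist (z i) (w i) < r) →
          ∃ v ≠ 0, ∃ μ : ℂ, 1 < ‖μ‖ ∧ fderiv ℂ (g^[n]) (z 0) v = μ • v := by
  obtain ⟨r, hr, hcone⟩ := H.exists_cone
  obtain ⟨C, hC, hbd⟩ := H.exists_bound
  refine ⟨r, hr, fun n _ z w hw hz hdw hdz => ?_⟩
  have hgd : Differentiable ℂ g := H.contDiff_fwd.differentiable one_ne_zero
  have hit : ∀ k : ℕ, g^[k] (z 0) = z k := by
    intro k
    induction k with
    | zero => simp
    | succ k ih => rw [Function.iterate_succ_apply', ih, hz, Nat.cast_succ]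
  obtain ⟨v, hv, hSv⟩ := H.exists_U (w 0) (hw 0)
  have hgrow : ∀ k : ℕ,
      ‖S (w k) (fderiv ℂ (g^[k]) (z 0) v)‖ ≤ ‖U (w k) (fderiv ℂ (g^[k]) (z 0) v)‖ ∧
        2 ^ k * ‖v‖ ≤ ‖U (w k) (fderiv ℂ (g^[k]) (z 0) v)‖ := by
    intro k
    induction k with
    | zero =>
      have h1 := H.add (w 0) (hw 0) v
      rw [hSv, zero_add] at h1
      simp [hSv, h1]
    | succ k ih =>
      have h1 : fderiv ℂ (g^[k + 1]) (z 0) v = fderiv ℂ g (z k) (fderiv ℂ (g^[k]) (z 0) v) := by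
        rw [Function.iterate_succ', fderiv_comp _ (hgd _) (hgd.iterate k _), hit]
        rfl
      obtain ⟨h2, h3⟩ := (hcone (w (k + 1)) (hw _) (w k) (hw _) (hdw k)).1 (z k) (hdz k)
        (fderiv ℂ (g^[k]) (z 0) v)
      rw [← h1] at h2 h3
      rw [Nat.cast_succ, pow_succ]
      have h4 := norm_nonneg (U (w k) (fderiv ℂ (g^[k]) (z 0) v))
      constructor <;> linarith [ih.1, ih.2]
  have hper : g^[n] (z 0) = z 0 := by rw [hit, ZMod.natCast_self]
  refine exists_eigenvalue_of_two_pow_le (C := C) hv fun l => ?_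
  have h1 := ((hgd.iterate n (z 0)).hasFDerivAt.iterate hper l).fderiv
  rw [← Function.iterate_mul] at h1
  rw [← h1]
  have h2 := (hgrow (n * l)).2
  have h3 := (hbd (w (n * l : ℕ)) (hw _) (fderiv ℂ (g^[n * l]) (z 0) v)).2
  have h4 : (2 : ℝ) ^ l ≤ 2 ^ (n * l) :=
    pow_le_pow_right₀ (by norm_num) (Nat.le_mul_of_pos_left l (NeZero.pos n))
  exact ((mul_le_mul_of_nonneg_right h4 (norm_nonneg v)).trans h2).trans h3

/-- Closed pseudo-orbits in `Λ` are shadowed by periodic orbits of saddle type. -/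
theorem exists_saddle_orbit [FiniteDimensional ℂ E] (H : HyperbolicSplitting Λ g h S U) {ε : ℝ}
    (hε : 0 < ε) :
    ∃ δ > 0, ∀ (n : ℕ) (w : ℕ → E), 1 ≤ n → w n = w 0 → (∀ i < n, w i ∈ Λ) →
      (∀ i < n, dist (w (i + 1)) (g (w i)) < δ) →
        ∃ z, g^[n] z = z ∧ (∀ i < n, dist (g^[i] z) (w i) ≤ ε) ∧
          (∃ v ≠ 0, ∃ μ : ℂ, 1 < ‖μ‖ ∧ fderiv ℂ (g^[n]) z v = μ • v) ∧
          (∃ v ≠ 0, ∃ μ : ℂ, 1 < ‖μ‖ ∧ fderiv ℂ (h^[n]) z v = μ • v) := by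
  have : CompleteSpace E := FiniteDimensional.complete ℂ E
  obtain ⟨r₁, hr₁, hg⟩ := H.exists_eigenvalue_of_cyclic_orbit
  obtain ⟨r₂, hr₂, hh⟩ := H.symm.exists_eigenvalue_of_cyclic_orbit
  obtain ⟨r₃, hr₃, hcont⟩ := H.isCompact.exists_dist_lt_of_continuous H.contDiff_bwd.continuous hr₂
  set ρ := min ε (min r₁ r₂ / 2) with hρ
  have hρ0 : 0 < ρ := by positivity
  have hρr : ρ < min r₁ r₂ := (min_le_right _ _).trans_lt (half_lt_self (lt_min hr₁ hr₂))
  obtain ⟨δ, hδ, hcl⟩ := H.exists_cyclic_orbit hρ0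
  refine ⟨min δ (min r₁ r₃), by positivity, fun n w hn hwn hw hd => ?_⟩
  have : NeZero n := ⟨by omega⟩
  set w' : ZMod n → E := fun i => w i.val with hw'
  have hw'Λ : ∀ i, w' i ∈ Λ := fun i => hw _ i.val_lt
  have hsucc : ∀ i : ZMod n, w' (i + 1) = w (i.val + 1) := by
    intro i
    have hlt := i.val_lt
    rcases (show i.val + 1 < n ∨ i.val + 1 = n by omega) with h1 | h1
    · have : ((i.val + 1 : ℕ) : ZMod n) = i + 1 := by simp
      simp only [hw']
      rw [← this, ZMod.val_natCast_of_lt h1]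
    · have : ((i.val + 1 : ℕ) : ZMod n) = i + 1 := by simp
      simp only [hw']
      rw [← this, h1, hwn, ZMod.natCast_self, ZMod.val_zero]
  have hd' : ∀ i, dist (w' (i + 1)) (g (w' i)) < min δ (min r₁ r₃) := fun i => by
    rw [hsucc]
    exact hd _ i.val_lt
  obtain ⟨z, hz⟩ := hcl n w' hw'Λ fun i => (hd' i).trans_le (min_le_left _ _)
  have hit : ∀ k : ℕ, g^[k] (z 0) = z k := by
    intro k
    induction k with
    | zero => simp
    | succ k ih => rw [Function.iterate_succ_apply', ih, (hz k).1, Nat.cast_succ]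
  refine ⟨z 0, by rw [hit, ZMod.natCast_self], fun i hi => ?_, ?_, ?_⟩
  · have := (hz i).2
    simp only [hw', ZMod.val_natCast_of_lt hi] at this
    rw [hit]
    exact this.trans (min_le_left _ _)
  · exact hg n z w' hw'Λ (fun i => (hz i).1)
      (fun i => (hd' i).trans_le ((min_le_right _ _).trans (min_le_left _ _)))
      (fun i => ((hz i).2.trans_lt hρr).trans_le (min_le_left _ _))
  · have := hh n (fun i => z (-i)) (fun i => w' (-i)) (fun i => hw'Λ _) (fun i => ?_) (fun i => ?_)
      (fun i => ((hz (-i)).2.trans_lt hρr).trans_le (min_le_right _ _))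
    · simpa using this
    · have h1 := (hz (-(i + 1))).1
      rw [show -(i + 1) + 1 = -i by ring] at h1
      rw [← h1, H.left_inv]
    · have h1 := hd' (-(i + 1))
      rw [show -(i + 1) + 1 = -i by ring] at h1
      have h2 := hcont (g (w' (-(i + 1)))) (H.mapsTo_fwd (hw'Λ _)) (w' (-i))
        (h1.trans_le ((min_le_right _ _).trans (min_le_right _ _)))
      rwa [H.left_inv, dist_comm] at h2

end HyperbolicSplitting

end SaddleEigenvalue

section Shadowing

variable {E : Type*} [NormedAddCommGroup E] [NormedSpace ℂ E]

theorem Relation.ReflTransGen.exists_path {A : Type*} {R : A → A → Prop} {a b : A}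
    (h : Relation.ReflTransGen R a b) :
    ∃ (k : ℕ) (q : ℕ → A), q 0 = a ∧ q k = b ∧ ∀ i < k, R (q i) (q (i + 1)) := by
  induction h using Relation.ReflTransGen.head_induction_on with
  | refl => exact ⟨0, fun _ => b, rfl, rfl, fun i hi => absurd hi (Nat.not_lt_zero i)⟩
  | @head a c hac _ ih =>
    obtain ⟨k, q, h0, hk, hq⟩ := ih
    refine ⟨k + 1, fun i => Nat.casesOn i a q, rfl, hk, fun i hi => ?_⟩
    cases i with
    | zero =>
      rw [← h0] at hac
      exact hac
    | succ i => exact hq i (by omega)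

/-- An infinite `R`-chain each of whose steps can be undone extends to closed `R`-chains. -/
theorem exists_closed_chain {A : Type*} {R : A → A → Prop} {y : ℕ → A}
    (hy : ∀ i, R (y i) (y (i + 1))) (hback : ∀ i, Relation.ReflTransGen R (y (i + 1)) (y i))
    (M : ℕ) : ∃ (n : ℕ) (w : ℕ → A), M ≤ n ∧ w n = w 0 ∧ (∀ i < M, w i = y i) ∧
      ∀ i < n, R (w i) (w (i + 1)) := by
  have hret : ∀ j, Relation.ReflTransGen R (y j) (y 0) := by
    intro j
    induction j with
    | zero => exact Relation.ReflTransGen.refl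
    | succ j ih => exact (hback j).trans ih
  obtain ⟨k, q, h0, hk, hq⟩ := (hret M).exists_path
  have hw : ∀ i ≤ M, (if i < M then y i else q (i - M)) = y i := by
    intro i hi
    split_ifs with h
    · rfl
    · rw [show i = M by omega, Nat.sub_self, h0]
  refine ⟨M + k, fun i => if i < M then y i else q (i - M), Nat.le_add_right _ _, ?_,
    fun i hi => if_pos hi, fun i hi => ?_⟩
  · simp only
    rw [hw 0 (Nat.zero_le _), if_neg (by omega), Nat.add_sub_cancel_left, hk]
  · simp only
    rcases lt_or_ge i M with h | h
    · rw [hw i h.le, hw (i + 1) h]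
      exact hy i
    · rw [if_neg (by omega), if_neg (by omega), show i + 1 - M = i - M + 1 by omega]
      exact hq _ (by omega)

namespace HyperbolicSplitting

variable {Λ : Set E} {g h : E → E} {S U : E → E →L[ℂ] E}

/-- Two forward orbits shadowing the same pseudo-orbit in `Λ` are asymptotic. -/
theorem exists_tendsto_dist_of_shadow (H : HyperbolicSplitting Λ g h S U) :
    ∃ r > 0, ∀ y : ℕ → E, (∀ i, y i ∈ Λ) → (∀ i, dist (y (i + 1)) (g (y i)) < r) →
      ∀ a b, (∀ i, dist (g^[i] a) (y i) < r) → (∀ i, dist (g^[i] b) (y i) < r) →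
        Tendsto (fun i => dist (g^[i] a) (g^[i] b)) atTop (𝓝 0) := by
  obtain ⟨r, hr, hcone⟩ := H.exists_cone
  obtain ⟨C, hC, hbd⟩ := H.exists_bound
  refine ⟨r, hr, fun y hy hdy a b ha hb => ?_⟩
  set d : ℕ → E := fun i => g^[i] a - g^[i] b with hd
  have hstep : ∀ i, ‖S (y (i + 1)) (d (i + 1))‖ ≤ 1 / 4 * (‖S (y i) (d i)‖ + ‖U (y i) (d i)‖) ∧
      8 * ‖U (y i) (d i)‖ - (‖S (y i) (d i)‖ + ‖U (y i) (d i)‖) ≤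
        ‖U (y (i + 1)) (d (i + 1))‖ := by
    intro i
    have := (hcone _ (hy (i + 1)) _ (hy i) (hdy i)).2 _ _ (ha i) (hb i)
    simp only [hd, Function.iterate_succ_apply']
    exact this
  have hdr : ∀ i, ‖d i‖ ≤ 2 * r := by
    intro i
    have := dist_triangle_right (g^[i] a) (g^[i] b) (y i)
    rw [dist_eq_norm] at this
    linarith [ha i, hb i]
  have hUS : ∀ i, ‖U (y i) (d i)‖ ≤ ‖S (y i) (d i)‖ := by
    intro i
    by_contra! hlt
    have hgrow : ∀ k : ℕ, ‖S (y (i + k)) (d (i + k))‖ ≤ ‖U (y (i + k)) (d (i + k))‖ ∧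
        2 ^ k * ‖U (y i) (d i)‖ ≤ ‖U (y (i + k)) (d (i + k))‖ := by
      intro k
      induction k with
      | zero => simpa using hlt.le
      | succ k ih =>
        obtain ⟨h1, h2⟩ := hstep (i + k)
        rw [← Nat.add_assoc, pow_succ]
        have := norm_nonneg (U (y (i + k)) (d (i + k)))
        constructor <;> linarith [ih.1, ih.2]
    have hpos : 0 < ‖U (y i) (d i)‖ := (norm_nonneg _).trans_lt hlt
    obtain ⟨k, hk⟩ := pow_unbounded_of_one_lt (C * (2 * r) / ‖U (y i) (d i)‖) one_lt_two
    rw [div_lt_iff₀ hpos] at hk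
    have h1 := (hbd _ (hy (i + k)) (d (i + k))).2
    have h2 := mul_le_mul_of_nonneg_left (hdr (i + k)) hC.le
    linarith [(hgrow k).2]
  have hS : ∀ i, ‖S (y i) (d i)‖ ≤ (1 / 2) ^ i * ‖S (y 0) (d 0)‖ := by
    intro i
    induction i with
    | zero => simp
    | succ i ih =>
      rw [pow_succ]
      linarith [(hstep i).1, hUS i]
  have hlim : Tendsto (fun i : ℕ => 2 * ((1 / 2 : ℝ) ^ i * ‖S (y 0) (d 0)‖)) atTop (𝓝 0) := by
    have := (tendsto_pow_atTop_nhds_zero_of_lt_one (r := (1 / 2 : ℝ)) (by norm_num)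
      (by norm_num)).mul_const ‖S (y 0) (d 0)‖
    simpa using this.const_mul 2
  refine squeeze_zero (fun _ => dist_nonneg) (fun i => ?_) hlim
  rw [dist_eq_norm]
  have := H.norm_le (hy i) (d i)
  linarith [hS i, hUS i]

/-- If periodic points are dense in `Λ`, and if `Λ` contains all saddle periodic points, then
every forward orbit approaching `Λ` is asymptotic to an orbit in `Λ`. -/
theorem exists_tendsto_dist [FiniteDimensional ℂ E] (H : HyperbolicSplitting Λ g h S U)
    (hper : ∀ x ∈ Λ, ∀ ε > 0, ∃ y ∈ Λ, dist x y < ε ∧ ∃ p, 1 ≤ p ∧ g^[p] y = y)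
    (hsad : ∀ z n, 1 ≤ n → g^[n] z = z →
      (∃ v ≠ 0, ∃ μ : ℂ, 1 < ‖μ‖ ∧ fderiv ℂ (g^[n]) z v = μ • v) →
      (∃ v ≠ 0, ∃ μ : ℂ, 1 < ‖μ‖ ∧ fderiv ℂ (h^[n]) z v = μ • v) → z ∈ Λ)
    (hne : Λ.Nonempty) {x : E} (hx : Tendsto (fun i => infDist (g^[i] x) Λ) atTop (𝓝 0)) :
    ∃ p ∈ Λ, Tendsto (fun i => dist (g^[i] x) (g^[i] p)) atTop (𝓝 0) := by
  have hgc := H.contDiff_fwd.continuous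
  obtain ⟨r, hr, hasym⟩ := H.exists_tendsto_dist_of_shadow
  obtain ⟨δ, hδ, hclose⟩ := H.exists_saddle_orbit (half_pos hr)
  obtain ⟨δ₁, hδ₁, hg₁⟩ := H.isCompact.exists_dist_lt_of_continuous hgc hδ
  set η := min r (min δ δ₁) with hη
  have hη0 : 0 < η := by positivity
  obtain ⟨δ₂, hδ₂, hg₂⟩ := H.isCompact.exists_dist_lt_of_continuous hgc (half_pos hη0)
  set ζ := min (r / 2) (min (η / 2) δ₂) with hζ
  have hζ0 : 0 < ζ := by positivity
  obtain ⟨i₀, hi₀⟩ := eventually_atTop.1 (hx.eventually (gt_mem_nhds hζ0))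
  set x₀ := g^[i₀] x with hx₀
  have hy : ∀ i, ∃ y ∈ Λ, dist (g^[i] x₀) y < ζ ∧ ∃ p, 1 ≤ p ∧ g^[p] y = y := by
    intro i
    have h1 := hi₀ (i + i₀) (Nat.le_add_left _ _)
    rw [Function.iterate_add_apply] at h1
    obtain ⟨y₁, hy₁, h2⟩ := (infDist_lt_iff hne).1 h1
    obtain ⟨y, hy, h3, h4⟩ := hper y₁ hy₁ _ (sub_pos.2 h2)
    exact ⟨y, hy, by linarith [dist_triangle (g^[i] x₀) y₁ y], h4⟩
  choose y hyΛ hyd p hp hpy using hy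
  have hpo : ∀ i, dist (y (i + 1)) (g (y i)) < η := by
    intro i
    have h1 := (hyd (i + 1)).trans_le ((min_le_right _ _).trans (min_le_left _ _))
    have h2 := hg₂ (y i) (hyΛ i) (g^[i] x₀)
      ((hyd i).trans_le ((min_le_right _ _).trans (min_le_right _ _)))
    rw [← Function.iterate_succ_apply' g] at h2
    have h3 := dist_triangle_left (y (i + 1)) (g (y i)) (g^[i + 1] x₀)
    linarith
  set R : E → E → Prop := fun a b => a ∈ Λ ∧ dist b (g a) < δ with hR
  have horb : ∀ a ∈ Λ, ∀ k, Relation.ReflTransGen R a (g^[k] a) := by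
    intro a ha k
    induction k with
    | zero => exact Relation.ReflTransGen.refl
    | succ k ih =>
      refine ih.tail ⟨H.mapsTo_fwd.iterate k ha, ?_⟩
      rwa [Function.iterate_succ_apply', dist_self]
  have hfwd : ∀ i, R (y i) (y (i + 1)) := fun i =>
    ⟨hyΛ i, (hpo i).trans_le ((min_le_right _ _).trans (min_le_left _ _))⟩
  have hback : ∀ i, Relation.ReflTransGen R (y (i + 1)) (y i) := by
    intro i
    have h1 : R (y (i + 1)) (g (g (y i))) := by
      refine ⟨hyΛ _, ?_⟩
      rw [dist_comm]
      exact hg₁ (g (y i)) (H.mapsTo_fwd (hyΛ i)) (y (i + 1))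
        ((hpo i).trans_le ((min_le_right _ _).trans (min_le_right _ _)))
    have h2 := horb (g (g (y i))) (H.mapsTo_fwd (H.mapsTo_fwd (hyΛ i))) (2 * p i - 2)
    have h3 : g^[2 * p i - 2] (g (g (y i))) = y i := by
      rw [← Function.iterate_succ_apply, ← Function.iterate_succ_apply,
        show (2 * p i - 2).succ.succ = p i * 2 by have := hp i; omega, Function.iterate_mul]
      exact Function.IsFixedPt.iterate (hpy i) 2
    rw [h3] at h2
    exact Relation.ReflTransGen.head h1 h2
  have hK : ∀ M : ℕ, ∃ z ∈ Λ, ∀ i < M, dist (g^[i] z) (y i) ≤ r / 2 := by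
    intro M
    obtain ⟨n, w, hMn, hwn, hwy, hwR⟩ := exists_closed_chain hfwd hback (M + 1)
    obtain ⟨z, hz, hzw, he₁, he₂⟩ := hclose n w (by omega) hwn (fun i hi => (hwR i hi).1)
      fun i hi => (hwR i hi).2
    refine ⟨z, hsad z n (by omega) hz he₁ he₂, fun i hi => ?_⟩
    rw [← hwy i (by omega)]
    exact hzw i (by omega)
  set K : ℕ → Set E := fun M => {z | z ∈ Λ ∧ ∀ i < M, dist (g^[i] z) (y i) ≤ r / 2} with hKdef
  have hKcl : ∀ M, IsClosed (K M) := by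
    intro M
    simp only [hKdef, ofPred_and, ofPred_forall]
    exact H.isCompact.isClosed.inter (isClosed_iInter fun i => isClosed_iInter fun _ =>
      isClosed_le ((hgc.iterate i).dist continuous_const) continuous_const)
  obtain ⟨z, hz⟩ := IsCompact.nonempty_iInter_of_sequence_nonempty_isCompact_isClosed K
    (fun M z hz => ⟨hz.1, fun i hi => hz.2 i (by omega)⟩)
    (fun M => (hK M).imp fun z hz => hz)
    (H.isCompact.of_isClosed_subset (hKcl 0) fun z hz => hz.1) hKcl
  rw [mem_iInter] at hz
  have hlim := hasym y hyΛ (fun i => (hpo i).trans_le (min_le_left _ _)) x₀ z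
    (fun i => (hyd i).trans_le ((min_le_left _ _).trans (half_le_self hr.le)))
    (fun i => ((hz (i + 1)).2 i (Nat.lt_succ_self i)).trans_lt (half_lt_self hr))
  refine ⟨h^[i₀] z, H.mapsTo_bwd.iterate i₀ (hz 0).1, ?_⟩
  have hright : g^[i₀] (h^[i₀] z) = z :=
    (Function.RightInverse.iterate (f := g) (g := h) H.right_inv i₀) z
  refine (tendsto_add_atTop_iff_nat i₀).1 ?_
  simpa only [Function.iterate_add_apply, hright] using hlim

end HyperbolicSplitting

end Shadowing

section Projections

variable {E : Type*} [NormedAddCommGroup E] [NormedSpace ℂ E]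

theorem eq_of_add_eq_add_of_isCompl {p q : Submodule ℂ E} (hpq : IsCompl p q) {a b a' b' : E}
    (ha : a ∈ p) (hb : b ∈ q) (ha' : a' ∈ p) (hb' : b' ∈ q) (h : a + b = a' + b') :
    a = a' ∧ b = b' := by
  have h1 : a - a' = b' - b := by rw [sub_eq_sub_iff_add_eq_add, h, add_comm]
  have h2 : a - a' ∈ p := p.sub_mem ha ha'
  have h3 : a - a' ∈ q := by
    rw [h1]
    exact q.sub_mem hb' hb
  have h4 := Submodule.disjoint_def.1 hpq.disjoint _ h2 h3
  rw [h4] at h1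
  exact ⟨sub_eq_zero.1 h4, (sub_eq_zero.1 h1.symm).symm⟩

theorem exists_norm_le_norm_add_of_isCompl [FiniteDimensional ℂ E] {Λ : Set E}
    (hΛ : IsCompact Λ) {Es Eu : E → Submodule ℂ E} (hcompl : ∀ x ∈ Λ, IsCompl (Es x) (Eu x))
    (hs : IsClosed {q : E × E | q.1 ∈ Λ ∧ q.2 ∈ Es q.1})
    (hu : IsClosed {q : E × E | q.1 ∈ Λ ∧ q.2 ∈ Eu q.1}) :
    ∃ c > 0, ∀ x ∈ Λ, ∀ a ∈ Es x, ∀ b ∈ Eu x, c * ‖a‖ ≤ ‖a + b‖ := by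
  have : ProperSpace E := FiniteDimensional.proper ℂ E
  set Q : Set (E × E × E) := (Λ ×ˢ sphere 0 1 ×ˢ closedBall 0 2) ∩
    ((fun q : E × E × E => (q.1, q.2.1)) ⁻¹' {q : E × E | q.1 ∈ Λ ∧ q.2 ∈ Es q.1} ∩
      (fun q : E × E × E => (q.1, q.2.2)) ⁻¹' {q : E × E | q.1 ∈ Λ ∧ q.2 ∈ Eu q.1}) with hQ
  have hQc : IsCompact Q :=
    (hΛ.prod ((isCompact_sphere 0 1).prod (isCompact_closedBall 0 2))).inter_right
      ((hs.preimage (by fun_prop)).inter (hu.preimage (by fun_prop)))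
  obtain ⟨c, hc, hcQ⟩ := hQc.exists_forall_le' (f := fun q : E × E × E => ‖q.2.1 + q.2.2‖) (a := 0)
    (by fun_prop) (by
      rintro ⟨x, a, b⟩ ⟨⟨hx, ha1, -⟩, ⟨-, ha⟩, -, hb⟩
      refine norm_pos_iff.2 fun h0 => ?_
      have h1 := (eq_of_add_eq_add_of_isCompl (hcompl x hx) ha hb (Es x).zero_mem (Eu x).zero_mem
        (by simpa using h0)).1
      rw [mem_sphere_zero_iff_norm] at ha1
      simp only at h1
      simp [h1] at ha1)
  refine ⟨min c 1, lt_min hc one_pos, fun x hx a ha b hb => ?_⟩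
  rcases eq_or_ne a 0 with rfl | ha0
  · simp
  have ha1 : 0 < ‖a‖ := norm_pos_iff.2 ha0
  rcases le_or_gt ‖b‖ (2 * ‖a‖) with hle | hgt
  · have hn : ‖((‖a‖⁻¹ : ℝ) : ℂ)‖ = ‖a‖⁻¹ := by
      rw [Complex.norm_real, norm_inv, norm_norm]
    have h1 := hcQ (x, ((‖a‖⁻¹ : ℝ) : ℂ) • a, ((‖a‖⁻¹ : ℝ) : ℂ) • b) ⟨⟨hx, by
        rw [mem_sphere_zero_iff_norm, norm_smul, hn, inv_mul_cancel₀ ha1.ne'], by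
        rw [mem_closedBall_zero_iff, norm_smul, hn, inv_mul_le_iff₀ ha1]
        linarith⟩, ⟨hx, (Es x).smul_mem _ ha⟩, hx, (Eu x).smul_mem _ hb⟩
    simp only at h1
    rw [← smul_add, norm_smul, hn, ← div_eq_inv_mul, le_div_iff₀ ha1] at h1
    exact (mul_le_mul_of_nonneg_right (min_le_left _ _) ha1.le).trans h1
  · have h1 := norm_sub_norm_le b (-a)
    rw [norm_neg, sub_neg_eq_add, add_comm b a] at h1
    have h2 := mul_le_mul_of_nonneg_right (min_le_right c 1) ha1.le
    linarith

/-- A splitting with closed total spaces over a compact set has continuous projections. -/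
theorem exists_continuousOn_projections [FiniteDimensional ℂ E] {Λ : Set E}
    (hΛ : IsCompact Λ) {Es Eu : E → Submodule ℂ E} (hcompl : ∀ x ∈ Λ, IsCompl (Es x) (Eu x))
    (hs : IsClosed {q : E × E | q.1 ∈ Λ ∧ q.2 ∈ Es q.1})
    (hu : IsClosed {q : E × E | q.1 ∈ Λ ∧ q.2 ∈ Eu q.1}) :
    ∃ S U : E → E →L[ℂ] E, ContinuousOn S Λ ∧ ContinuousOn U Λ ∧
      ∀ x ∈ Λ, ∀ v, S x v ∈ Es x ∧ U x v ∈ Eu x ∧ S x v + U x v = v := by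
  have : ProperSpace E := FiniteDimensional.proper ℂ E
  classical
  have hex : ∀ x, ∃ T : E →L[ℂ] E, x ∈ Λ → ∀ v, T v ∈ Es x ∧ v - T v ∈ Eu x := by
    intro x
    by_cases hx : x ∈ Λ
    · refine ⟨LinearMap.toContinuousLinearMap ((Es x).projection (Eu x) (hcompl x hx)),
        fun _ v => ⟨?_, ?_⟩⟩
      · exact Submodule.projection_apply_mem _ v
      · exact Submodule.sub_projection_mem _ v
    · exact ⟨0, fun h => absurd h hx⟩
  choose S hS using hex
  obtain ⟨c, hc, hbd⟩ := exists_norm_le_norm_add_of_isCompl hΛ hcompl hs hu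
  have hcont : ContinuousOn S Λ := by
    rw [continuousOn_clm_apply]
    intro v x hx
    refine (tendsto_iff_ultrafilter _ _ _).2 fun 𝒰 h𝒰 => ?_
    have hmem : ∀ᶠ y in (𝒰 : Filter E), y ∈ Λ := h𝒰 self_mem_nhdsWithin
    have hball : ((𝒰.map fun y => S y v : Ultrafilter E) : Filter E) ≤
        𝓟 (closedBall 0 (c⁻¹ * ‖v‖)) := by
      rw [le_principal_iff, Ultrafilter.coe_map, mem_map]
      filter_upwards [hmem] with y hy
      rw [mem_preimage, mem_closedBall_zero_iff, ← div_eq_inv_mul, le_div_iff₀ hc, mul_comm]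
      simpa using hbd y hy _ (hS y hy v).1 _ (hS y hy v).2
    obtain ⟨w, -, hw⟩ := isCompact_iff_ultrafilter_le_nhds.1 (isCompact_closedBall _ _) _ hball
    have hw' : Tendsto (fun y => S y v) 𝒰 (𝓝 w) := hw
    have hx' : Tendsto (fun y : E => y) 𝒰 (𝓝 x) := h𝒰.trans nhdsWithin_le_nhds
    have h1 := hs.mem_of_tendsto (hx'.prodMk_nhds hw')
      (hmem.mono fun y hy => ⟨hy, (hS y hy v).1⟩)
    have h2 := hu.mem_of_tendsto (hx'.prodMk_nhds (tendsto_const_nhds.sub hw'))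
      (hmem.mono fun y hy => ⟨hy, (hS y hy v).2⟩)
    have h3 := (eq_of_add_eq_add_of_isCompl (hcompl x hx) h1.2 h2.2 (hS x hx v).1 (hS x hx v).2
      (by simp)).1
    simp only at h3
    rwa [h3] at hw'
  exact ⟨S, fun x => ContinuousLinearMap.id ℂ E - S x, hcont, continuousOn_const.sub hcont,
    fun x hx v => ⟨(hS x hx v).1, (hS x hx v).2, by simp⟩⟩

end Projections

section HenonMaps

theorem ContDiff.iterate_self {E : Type*} [NormedAddCommGroup E] [NormedSpace ℂ E] {f : E → E}
    (hf : ContDiff ℂ 1 f) (n : ℕ) : ContDiff ℂ 1 (f^[n]) := by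
  induction n with
  | zero => exact contDiff_id
  | succ n ih => exact ih.comp hf

theorem ElemHenon.contDiff_toFun (h : ElemHenon) : ContDiff ℂ 1 h.toFun := by
  have : ContDiff ℂ 1 fun z => h.P.eval z := h.P.differentiable.contDiff
  unfold ElemHenon.toFun
  fun_prop

theorem ElemHenon.contDiff_invFun (h : ElemHenon) : ContDiff ℂ 1 h.invFun := by
  have : ContDiff ℂ 1 fun z => h.P.eval z := h.P.differentiable.contDiff
  unfold ElemHenon.invFun
  simp only [div_eq_mul_inv]
  fun_prop

theorem ElemHenon.invFun_toFun (h : ElemHenon) (p : ℂ × ℂ) : h.invFun (h.toFun p) = p := by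
  have := h.ha
  have := h.hb
  simp only [ElemHenon.invFun, ElemHenon.toFun]
  ext
  · simp; field_simp
  · simp; field_simp; ring

theorem ElemHenon.toFun_invFun (h : ElemHenon) (p : ℂ × ℂ) : h.toFun (h.invFun p) = p := by
  have := h.ha
  have := h.hb
  simp only [ElemHenon.invFun, ElemHenon.toFun]
  ext <;> simp <;> field_simp; ring

theorem HenonMap.exists_inverse (H : HenonMap) : ContDiff ℂ 1 H.toFun ∧
    ∃ k, ContDiff ℂ 1 k ∧ (∀ x, k (H.toFun x) = x) ∧ ∀ x, H.toFun (k x) = x := by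
  unfold HenonMap.toFun
  induction H.comps with
  | nil => exact ⟨contDiff_id, id, contDiff_id, fun _ => rfl, fun _ => rfl⟩
  | cons e l ih =>
    obtain ⟨h1, k, h2, h3, h4⟩ := ih
    refine ⟨e.contDiff_toFun.comp h1, k ∘ e.invFun, h2.comp e.contDiff_invFun, fun x => ?_,
      fun x => ?_⟩
    · simp only [List.foldr_cons, Function.comp_apply, e.invFun_toFun, h3]
    · simp only [List.foldr_cons, Function.comp_apply, h4, e.toFun_invFun]

/-- Some iterate of a uniformly hyperbolic Hénon map has a splitting with definite rates. -/
theorem UniformlyHyperbolicOn.exists_hyperbolicSplitting {H : HenonMap} {Λ : Set (ℂ × ℂ)}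
    (hH : UniformlyHyperbolicOn H Λ) : ∃ (N : ℕ) (k : ℂ × ℂ → ℂ × ℂ)
      (S U : ℂ × ℂ → ℂ × ℂ →L[ℂ] ℂ × ℂ), 1 ≤ N ∧ (∀ x, H.toFun (k x) = x) ∧ ContDiff ℂ 1 k ∧
        HyperbolicSplitting Λ (H.toFun^[N]) (k^[N]) S U := by
  obtain ⟨hΛ, himg, Es, Eu, c, lam, hc, hlam0, hlam1, hEs, hEu, hcompl, hsc, huc, hsm, hum, hcs,
    hcu⟩ := hH
  obtain ⟨hf, k, hk, hkf, hfk⟩ := H.exists_inverse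
  obtain ⟨S, U, hS, hU, hSU⟩ := exists_continuousOn_projections hΛ hcompl hsc huc
  obtain ⟨A, hA⟩ := hΛ.exists_bound_of_continuousOn hS
  obtain ⟨B, hB⟩ := hΛ.exists_bound_of_continuousOn hU
  set C := max 1 (max A B) with hC
  have hC0 : 0 < C := by positivity
  have hSC : ∀ x ∈ Λ, ∀ v, ‖S x v‖ ≤ C * ‖v‖ := fun x hx v =>
    ContinuousLinearMap.le_of_opNorm_le _ ((hA x hx).trans (by simp [hC])) v
  have hUC : ∀ x ∈ Λ, ∀ v, ‖U x v‖ ≤ C * ‖v‖ := fun x hx v =>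
    ContinuousLinearMap.le_of_opNorm_le _ ((hB x hx).trans (by simp [hC])) v
  obtain ⟨N, hN1, hN⟩ : ∃ N, 1 ≤ N ∧ lam ^ N / c * C ≤ 1 / 8 := by
    have h1 : Tendsto (fun n : ℕ => lam ^ n / c * C) atTop (𝓝 0) := by
      have := ((tendsto_pow_atTop_nhds_zero_of_lt_one hlam0.le hlam1).div_const c).mul_const C
      simpa using this
    obtain ⟨N, h2, h3⟩ := ((eventually_ge_atTop 1).and
      (h1.eventually (gt_mem_nhds (show (0 : ℝ) < 1 / 8 by norm_num)))).exists
    exact ⟨N, h2, h3.le⟩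
  have hmf : MapsTo H.toFun Λ Λ := fun x hx => himg ▸ mem_image_of_mem _ hx
  have hmk : MapsTo k Λ Λ := by
    intro x hx
    rw [← himg] at hx
    obtain ⟨y, hy, rfl⟩ := hx
    rwa [hkf]
  have hfd : Differentiable ℂ H.toFun := hf.differentiable one_ne_zero
  have hinv : ∀ (F : ℂ × ℂ → Submodule ℂ (ℂ × ℂ)), (∀ x ∈ Λ, (F x).map
      (fderiv ℂ H.toFun x : (ℂ × ℂ) →ₗ[ℂ] (ℂ × ℂ)) = F (H.toFun x)) → ∀ n : ℕ, ∀ x ∈ Λ, ∀ v ∈ F x,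
        fderiv ℂ (H.toFun^[n]) x v ∈ F (H.toFun^[n] x) := by
    intro F hF n
    induction n with
    | zero => intro x _ v hv; simpa using hv
    | succ n ih =>
      intro x hx v hv
      rw [Function.iterate_succ', fderiv_comp _ (hfd _) (hfd.iterate n x), Function.comp_apply,
        ← hF _ (hmf.iterate n hx)]
      exact Submodule.mem_map_of_mem (ih x hx v hv)
  have hself : ∀ x ∈ Λ, ∀ v ∈ Es x, S x v = v ∧ U x v = 0 := fun x hx v hv =>
    eq_of_add_eq_add_of_isCompl (hcompl x hx) (hSU x hx v).1 (hSU x hx v).2.1 hv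
      (Eu x).zero_mem (by rw [(hSU x hx v).2.2, add_zero])
  have huself : ∀ x ∈ Λ, ∀ v ∈ Eu x, S x v = 0 ∧ U x v = v := fun x hx v hv =>
    eq_of_add_eq_add_of_isCompl (hcompl x hx) (hSU x hx v).1 (hSU x hx v).2.1 (Es x).zero_mem
      hv (by rw [(hSU x hx v).2.2, zero_add])
  have hmfN : MapsTo (H.toFun^[N]) Λ Λ := hmf.iterate N
  have hmkN : MapsTo (k^[N]) Λ Λ := hmk.iterate N
  have hfN : ContDiff ℂ 1 (H.toFun^[N]) := hf.iterate_self N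
  have hkN : ContDiff ℂ 1 (k^[N]) := hk.iterate_self N
  have hkfN : ∀ x, k^[N] (H.toFun^[N] x) = x :=
    Function.RightInverse.iterate (f := k) (g := H.toFun) hkf N
  have hfkN : ∀ x, H.toFun^[N] (k^[N] x) = x :=
    Function.RightInverse.iterate (f := H.toFun) (g := k) hfk N
  have hcomm : ∀ x ∈ Λ, ∀ v,
      S (H.toFun^[N] x) (fderiv ℂ (H.toFun^[N]) x v) = fderiv ℂ (H.toFun^[N]) x (S x v) ∧
      U (H.toFun^[N] x) (fderiv ℂ (H.toFun^[N]) x v) = fderiv ℂ (H.toFun^[N]) x (U x v) := by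
    intro x hx v
    obtain ⟨h1, h2, h3⟩ := hSU x hx v
    obtain ⟨h4, h5, h6⟩ := hSU _ (hmfN hx) (fderiv ℂ (H.toFun^[N]) x v)
    refine eq_of_add_eq_add_of_isCompl (hcompl _ (hmfN hx)) h4 h5 (hinv Es hsm N x hx _ h1)
      (hinv Eu hum N x hx _ h2) ?_
    rw [h6, ← map_add, h3]
  refine ⟨N, k, S, U, hN1, hfk, hk, ?_⟩
  exact
    { isCompact := hΛ
      contDiff_fwd := hfN
      contDiff_bwd := hkN
      left_inv := hkfN
      right_inv := hfkN
      mapsTo_fwd := hmfN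
      mapsTo_bwd := hmkN
      continuousOn_S := hS
      continuousOn_U := hU
      add := fun x hx v => (hSU x hx v).2.2
      S_U := fun x hx v => (huself x hx _ (hSU x hx v).2.1).1
      U_S := fun x hx v => (hself x hx _ (hSU x hx v).1).2
      comm_S := fun x hx v => (hcomm x hx v).1
      comm_U := fun x hx v => (hcomm x hx v).2
      contr_S := fun x hx v => by
        have h1 := hcs x hx _ (hSU x hx v).1 N hN1
        have h2 := mul_le_mul_of_nonneg_left (hSC x hx v) (show 0 ≤ lam ^ N / c by positivity)
        have h3 := mul_le_mul_of_nonneg_right hN (norm_nonneg v)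
        linarith
      contr_U := fun x hx v => by
        have h1 := hcu (k^[N] x) (hmkN hx) _ (hSU _ (hmkN hx) (fderiv ℂ (k^[N]) x v)).2.1 N hN1
        have h2 := (hcomm (k^[N] x) (hmkN hx) (fderiv ℂ (k^[N]) x v)).2
        rw [hfkN, fderiv_fderiv_of_inverse hfN hkN hfkN] at h2
        have h3 := fderiv_fderiv_of_inverse hkN hfN hkfN (k^[N] x)
          (U (k^[N] x) (fderiv ℂ (k^[N]) x v))
        rw [← h2, hfkN] at h3
        rw [← h2, ← h3, ge_iff_le, div_mul_eq_mul_div, div_le_iff₀ (by positivity)] at h1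
        have h4 := hUC x hx v
        have h5 := mul_le_mul_of_nonneg_right h4 (show 0 ≤ lam ^ N / c by positivity)
        have h6 := mul_le_mul_of_nonneg_right hN (norm_nonneg v)
        have h7 : ‖fderiv ℂ (k^[N]) x (U x v)‖ ≤ ‖U x v‖ * (lam ^ N / c) := by
          rw [← mul_div_assoc, le_div_iff₀ hc]
          linarith
        linarith
      exists_S := fun x hx => by
        obtain ⟨v, hv⟩ := Module.finrank_pos_iff_exists_ne_zero.1 (by rw [hEs x hx]; exact one_pos)
        exact ⟨v, by simpa using hv, (hself x hx v v.2).2⟩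
      exists_U := fun x hx => by
        obtain ⟨v, hv⟩ := Module.finrank_pos_iff_exists_ne_zero.1 (by rw [hEu x hx]; exact one_pos)
        exact ⟨v, by simpa using hv, (huself x hx v v.2).1⟩ }

theorem tendsto_dist_iterate_of_tendsto_dist_iterate_iterate {X : Type*} [PseudoMetricSpace X]
    {K : Set X} (hK : IsCompact K) {f : X → X} (hf : Continuous f) (hfK : MapsTo f K K) {N : ℕ}
    (hN : 1 ≤ N) {x p : X} (hp : p ∈ K)
    (h : Tendsto (fun i => dist ((f^[N])^[i] x) ((f^[N])^[i] p)) atTop (𝓝 0)) :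
    Tendsto (fun n => dist (f^[n] x) (f^[n] p)) atTop (𝓝 0) := by
  refine Metric.tendsto_nhds.2 fun ε hε => ?_
  have h1 : ∀ᶠ q in atTop, ∀ r ∈ Finset.range N,
      dist (f^[r] ((f^[N])^[q] x)) (f^[r] ((f^[N])^[q] p)) < ε := by
    refine (eventually_all_finset _).2 fun r _ => ?_
    obtain ⟨δ, hδ, hr⟩ := hK.exists_dist_lt_of_continuous (hf.iterate r) hε
    filter_upwards [h.eventually (gt_mem_nhds hδ)] with q hq
    exact hr _ ((hfK.iterate N).iterate q hp) _ hq
  filter_upwards [(Nat.tendsto_div_const_atTop (by omega : N ≠ 0)).eventually h1] with n hn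
  have h2 := hn (n % N) (Finset.mem_range.2 (Nat.mod_lt _ hN))
  rw [← Function.iterate_mul, ← Function.iterate_add_apply, ← Function.iterate_add_apply,
    Nat.mod_add_div] at h2
  simpa using h2

end HenonMaps

/-- If `H` is uniformly hyperbolic on `J*`, then `W^s_{J*} = ⋃_{p ∈ J*} W^s_p`. -/
theorem stableSet_Jstar_eq_iUnion_stable_manifolds (H : HenonMap)
    (hhyp : UniformlyHyperbolicOn H (Jstar H)) :
    WsSet H (Jstar H) = ⋃ p ∈ Jstar H, Ws H p := by
  have hmaps : MapsTo H.toFun (Jstar H) (Jstar H) := fun x hx => by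
    have := mem_image_of_mem H.toFun hx
    rwa [hhyp.2.1] at this
  obtain ⟨N, k, S, U, hN, hfk, hk, hsplit⟩ := hhyp.exists_hyperbolicSplitting
  have hf : ContDiff ℂ 1 H.toFun := H.exists_inverse.1
  have hfd : Differentiable ℂ H.toFun := hf.differentiable one_ne_zero
  ext x
  simp only [mem_iUnion, exists_prop]
  constructor
  · intro hx
    have hx' : Tendsto (fun i => infDist ((H.toFun^[N])^[i] x) (Jstar H)) atTop (𝓝 0) := by
      have h1 : Tendsto (fun i : ℕ => N * i) atTop atTop :=
        tendsto_id.const_mul_atTop' (by omega)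
      have h2 := Tendsto.comp (show Tendsto _ _ _ from hx) h1
      simpa only [Function.comp_def, Function.iterate_mul] using h2
    suffices h : ∃ p ∈ Jstar H,
        Tendsto (fun i => dist ((H.toFun^[N])^[i] x) ((H.toFun^[N])^[i] p)) atTop (𝓝 0) by
      obtain ⟨p, hp, hlim⟩ := h
      exact ⟨p, hp, tendsto_dist_iterate_of_tendsto_dist_iterate_iterate hhyp.1 hf.continuous
        hmaps hN hp hlim⟩
    refine hsplit.exists_tendsto_dist ?_ ?_ H.nonempty_Jstar hx'
    · intro y hy ε hε
      obtain ⟨z, hz, hyz⟩ := Metric.mem_closure_iff.1 hy ε hε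
      obtain ⟨m, hm, hmz, -⟩ := id hz
      refine ⟨z, subset_closure hz, hyz, m, hm, ?_⟩
      rw [← Function.iterate_mul, mul_comm, Function.iterate_mul]
      exact Function.IsFixedPt.iterate hmz N
    · rintro z n hn hz ⟨v, hv, μ, hμ, hvμ⟩ ⟨w, hw, ν, hν, hwν⟩
      refine subset_closure ⟨N * n, Nat.mul_pos hN hn, by rwa [Function.iterate_mul], w, v, ν⁻¹, μ,
        hw, hv, ?_, by rwa [Function.iterate_mul], ?_, hμ⟩
      · rw [Function.iterate_mul]
        have hfix : (k^[N])^[n] z = z := by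
          have h1 : ∀ x, (k^[N])^[n] ((H.toFun^[N])^[n] x) = x :=
            Function.RightInverse.iterate (f := k^[N]) (g := H.toFun^[N]) hsplit.left_inv n
          have h2 := h1 z
          rwa [hz] at h2
        have h3 := fderiv_fderiv_of_inverse (hsplit.contDiff_fwd.iterate_self n)
          (hsplit.contDiff_bwd.iterate_self n) (Function.RightInverse.iterate
            (f := H.toFun^[N]) (g := k^[N]) hsplit.right_inv n) z w
        have hν0 : ν ≠ 0 := norm_pos_iff.1 (one_pos.trans hν)
        rw [hfix, hwν, map_smul] at h3
        exact (eq_inv_smul_iff₀ hν0).2 h3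
      · rw [norm_inv]
        exact inv_lt_one_of_one_lt₀ hν
  · rintro ⟨p, hp, hlim⟩
    exact squeeze_zero (fun _ => infDist_nonneg)
      (fun n => infDist_le_dist_of_mem (hmaps.iterate n hp)) hlim

end
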